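/- Let D be a division ring with center F, and let G be a subnormal subgroup of D*. If M is a non-abelian solvable-by-finite maximal subgroup of G, then M is abelian-by-finite and D is finite-dimensional over F. -/

import Mathlib

/-- A subgroup `H` of a group is subnormal if there is a finite chain of subgroups
from `H` up to the whole group, each normal in the next. -/
def IsSubnormal {Γ : Type*} [Group Γ] (H : Subgroup Γ) : Prop :=
  ∃ (k : ℕ) (s : ℕ → Subgroup Γ), s 0 = H ∧ s k = ⊤ ∧
    ∀ i < k, s i ≤ s (i + 1) ∧ ((s i).subgroupOf (s (i + 1))).Normal

set_option linter.unusedSectionVars false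
open Polynomial

/-- local Ore type condition for a normal element -/
structure OL {R : Type*} [Ring R] (b : R) : Prop where
  ne : b ≠ 0
  not_dvd : ¬ b ∣ 1
  comm : ∀ x, ∃ y, x * b = b * y
  ore : ∀ p p', b ∣ p - 1 → b ∣ p' - 1 → ∃ g h, b ∣ g - 1 ∧ b ∣ h - 1 ∧ h * p = g * p'

theorem OL.dvd_mul_left' {R : Type*} [Ring R] {b : R} (hb : OL b) {x : R} (y : R) (h : b ∣ x) :
    b ∣ y * x := by
  obtain ⟨z, rfl⟩ := h
  obtain ⟨y', hy⟩ := hb.comm y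
  exact ⟨y' * z, by rw [← mul_assoc, hy, mul_assoc]⟩

theorem OL.sq_dvd_mul_left' {R : Type*} [Ring R] {b : R} (hb : OL b) {x : R} (y : R)
    (h : b * b ∣ x) : b * b ∣ y * x := by
  obtain ⟨z, rfl⟩ := h
  obtain ⟨y', hy⟩ := hb.comm y
  obtain ⟨y'', hy'⟩ := hb.comm y'
  exact ⟨y'' * z, by rw [← mul_assoc, ← mul_assoc, hy, mul_assoc b, hy']; simp only [mul_assoc]⟩

theorem OL.sq_dvd_mul {R : Type*} [Ring R] {b : R} (hb : OL b) {x y : R}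
    (h : b ∣ x) (h' : b ∣ y) : b * b ∣ x * y := by
  obtain ⟨z, rfl⟩ := h
  obtain ⟨w, rfl⟩ := h'
  obtain ⟨y', hy⟩ := hb.comm z
  exact ⟨y' * w, by rw [mul_assoc, ← mul_assoc z, hy]; simp only [mul_assoc]⟩

/-- iterated commutator -/
def wit {D : Type*} [DivisionRing D] (k : D) : ℕ → D → D
  | 0, a => a
  | n + 1, a => wit k n a * (k * wit k n a * k⁻¹)⁻¹

/-- iterated difference -/
def dl {R : Type*} [Ring R] (u : Rˣ) : ℕ → R → R
  | 0, a => a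
  | n + 1, a => dl u n a - u * dl u n a * (u⁻¹ : Rˣ)

theorem OL.lemmaG {R : Type*} [Ring R] [IsDomain R] {b : R} (hb : OL b) (u : Rˣ) (y : R)
    (hy : b ∣ y) (n : ℕ) :
    ∃ p q f : R, b ∣ p - 1 ∧ b ∣ q - 1 ∧ b * b ∣ p - q - dl u n y ∧ f ≠ 0 ∧
      ∀ (E : Type _) [DivisionRing E] (φ : R →+* E), φ f ≠ 0 →
        φ q ≠ 0 ∧ φ p ≠ 0 ∧ φ q * wit (φ u) n (1 + φ y) = φ p := by
  have ne0 : ∀ p : R, b ∣ p - 1 → p ≠ 0 := by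
    rintro p hp rfl
    apply hb.not_dvd
    simpa using hp
  induction n with
  | zero =>
    refine ⟨1 + y, 1, 1 + y, by simpa using hy, by simp, by simp [dl], ?_, ?_⟩
    · apply ne0; simpa using hy
    · intro E _ φ hf
      refine ⟨by simp, hf, by simp [wit]⟩
  | succ n ih =>
    obtain ⟨p, q, f, hp, hq, hpq, hf, H⟩ := ih
    set σ : R → R := fun x => u * x * (u⁻¹ : Rˣ) with hσ
    have hσ1 : ∀ x, b ∣ x → b ∣ σ x := fun x hx => (hb.dvd_mul_left' _ hx).mul_right _
    have hσ2 : ∀ x, b * b ∣ x → b * b ∣ σ x := fun x hx => (hb.sq_dvd_mul_left' _ hx).mul_right _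
    have hσs : ∀ x y, σ (x - y) = σ x - σ y := fun x y => by simp [hσ, mul_sub, sub_mul]
    have hσo : σ 1 = 1 := by simp [hσ]
    have hσp : b ∣ σ p - 1 := by rw [← hσo, ← hσs]; exact hσ1 _ hp
    have hσq : b ∣ σ q - 1 := by rw [← hσo, ← hσs]; exact hσ1 _ hq
    obtain ⟨g, h, hg, hh, hgh⟩ := hb.ore p (σ p) hp hσp
    have mul1 : ∀ x y, b ∣ x - 1 → b ∣ y - 1 → b ∣ x * y - 1 := fun x y hx hy => by
      have : x * y - 1 = (x - 1) * y + (y - 1) := by noncomm_ring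
      rw [this]; exact dvd_add (hx.mul_right _) hy
    refine ⟨g * σ q, h * q, f * p * h, mul1 _ _ hg hσq, mul1 _ _ hh hq, ?_, ?_, ?_⟩
    · have h1 := hb.sq_dvd_mul hg hσq
      have h2 := hb.sq_dvd_mul hh hq
      have h3 := hb.sq_dvd_mul hh hp
      have h4 := hb.sq_dvd_mul hg hσp
      have e : g * σ q - h * q - dl u (n+1) y = (g - 1) * (σ q - 1) - (h - 1) * (q - 1)
          + (h-1) * (p - 1) - (g - 1) * (σ p - 1) + ((p - q - dl u n y) - σ (p - q - dl u n y)) := by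
        have e1 : dl u (n+1) y = dl u n y - σ (dl u n y) := rfl
        rw [e1, hσs, hσs]
        have : g * σ p - h * p = 0 := by rw [hgh, sub_self]
        have e2 : g * σ q - h * q - (dl u n y - σ (dl u n y)) = (g - 1) * (σ q - 1) - (h - 1) * (q - 1)
          + (h-1) * (p - 1) - (g - 1) * (σ p - 1) + ((p - q - dl u n y) - (σ p - σ q - σ (dl u n y)))
          + (g * σ p - h * p) := by noncomm_ring
        rw [e2, this, add_zero]
      rw [e]
      exact dvd_add (dvd_sub (dvd_add (dvd_sub h1 h2) h3) h4) (dvd_sub hpq (hσ2 _ hpq))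
    · exact mul_ne_zero (mul_ne_zero hf (ne0 _ hp)) (ne0 _ hh)
    · intro E _ φ hφ
      rw [map_mul, map_mul] at hφ
      have hφf : φ f ≠ 0 := fun h => hφ (by simp [h])
      have hφp : φ p ≠ 0 := fun h => hφ (by simp [h])
      have hφh : φ h ≠ 0 := fun h => hφ (by simp [h])
      obtain ⟨hq0, hp0, hx⟩ := H E φ hφf
      have hu0 : φ u ≠ 0 := (u.isUnit.map φ).ne_zero
      have hui : φ (u⁻¹ : Rˣ) = (φ u)⁻¹ := by
        apply eq_inv_of_mul_eq_one_left
        rw [← map_mul]; simp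
      have hφσ : ∀ x, φ (σ x) = φ u * φ x * (φ u)⁻¹ := fun x => by simp [hσ, hui]
      have hgp : φ h * φ p = φ g * φ (σ p) := by rw [← map_mul, hgh, map_mul]
      have hg0 : φ g ≠ 0 := by
        intro h0; rw [h0, zero_mul] at hgp
        exact mul_ne_zero hφh hφp hgp
      refine ⟨by rw [map_mul]; exact mul_ne_zero hφh hq0, ?_, ?_⟩
      · rw [map_mul, hφσ]
        exact mul_ne_zero hg0 (mul_ne_zero (mul_ne_zero hu0 hq0) (inv_ne_zero hu0))
      · have e1 : wit (φ u) n (1 + φ y) = (φ q)⁻¹ * φ p := by rw [← hx, inv_mul_cancel_left₀ hq0]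
        rw [map_mul, map_mul]
        simp only [wit]
        rw [e1, hφσ]
        have e2 : φ u * ((φ q)⁻¹ * φ p) * (φ u)⁻¹ = (φ (σ q))⁻¹ * φ (σ p) := by
          rw [hφσ, hφσ]; simp only [mul_inv_rev, inv_inv, mul_assoc]
          rw [inv_mul_cancel_left₀ hu0]
        rw [e2, mul_inv_rev, inv_inv, ← mul_assoc, ← mul_assoc, mul_assoc (φ h),
          mul_inv_cancel_left₀ hq0, hgp]
        have hσp0 : φ (σ p) ≠ 0 := by
          rw [hφσ]; exact mul_ne_zero (mul_ne_zero hu0 hφp) (inv_ne_zero hu0)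
        rw [mul_assoc (φ g), mul_assoc (φ g), mul_inv_cancel₀ hσp0, one_mul, hφσ]

/-- skew polynomial presentation -/
structure Sk {L R : Type*} [DivisionRing L] [Ring R] [Module L R]
    (b : R) (τ : L ≃+* L) (ev : L[X] ≃ₗ[L] R) : Prop where
  one : ev 1 = 1
  mulX : ∀ p, b * ev p = ev (X * p.map (τ : L →+* L))

namespace Sk
variable {L R : Type*} [DivisionRing L] [Ring R] [Module L R] [IsScalarTower L R R]
  {b : R} {τ : L ≃+* L} {ev : L[X] ≃ₗ[L] R}

theorem map_symm (p : L[X]) : (p.map (τ.symm : L →+* L)).map (τ : L →+* L) = p := by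
  rw [Polynomial.map_map]
  convert Polynomial.map_id
  ext; simp

theorem evX (h : Sk b τ ev) (p : L[X]) : ev (X * p) = b * ev (p.map (τ.symm : L →+* L)) := by
  rw [h.mulX, map_symm]

theorem evC (h : Sk b τ ev) (l : L) : ev (C l) = l • 1 := by
  rw [← h.one, ← map_smul, smul_eq_C_mul, mul_one]

theorem decomp (h : Sk b τ ev) (p : L[X]) :
    ev p = b * ev (p.divX.map (τ.symm : L →+* L)) + p.coeff 0 • 1 := by
  conv_lhs => rw [← Polynomial.X_mul_divX_add p]
  rw [map_add, h.evX, h.evC]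

theorem dvd_iff (h : Sk b τ ev) (p : L[X]) : b ∣ ev p ↔ p.coeff 0 = 0 := by
  constructor
  · rintro ⟨y, hy⟩
    obtain ⟨q, rfl⟩ := ev.surjective y
    rw [h.mulX] at hy
    rw [ev.injective hy]; simp
  · intro h0
    rw [h.decomp, h0]; simp

theorem sq_dvd (h : Sk b τ ev) (p : L[X]) (hd : b * b ∣ ev p) : p.coeff 1 = 0 := by
  obtain ⟨y, hy⟩ := hd
  obtain ⟨q, rfl⟩ := ev.surjective y
  rw [mul_assoc, h.mulX, h.mulX] at hy
  rw [ev.injective hy]; simp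

theorem evmulb (h : Sk b τ ev) (p : L[X]) : ev p * b = ev (X * p) := by
  have hb : b = ev X := by have := h.mulX 1; rwa [h.one, mul_one, Polynomial.map_one, mul_one] at this
  have key : ∀ n (p : L[X]), p.natDegree ≤ n → ev p * b = ev (X * p) := by
    intro n
    induction n with
    | zero =>
      intro p hp
      rw [Polynomial.eq_C_of_natDegree_le_zero hp, h.evC, smul_mul_assoc, one_mul, hb, ← map_smul,
        X_mul, smul_eq_C_mul]
    | succ n ih =>
      intro p hp
      have e : ev (X * p) = b * ev (X * p.divX.map (τ.symm : L →+* L)) + p.coeff 0 • b := by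
        conv_lhs => rw [← Polynomial.X_mul_divX_add p]
        rw [mul_add, map_add, h.evX (X * p.divX), Polynomial.map_mul, Polynomial.map_X, X_mul_C,
          ← smul_eq_C_mul, map_smul, ← hb]
      rw [e, h.decomp, add_mul, mul_assoc, ih, smul_mul_assoc, one_mul]
      refine (Polynomial.natDegree_map_le).trans ?_
      rw [Polynomial.natDegree_divX_eq_natDegree_tsub_one]; omega
  exact key _ p le_rfl

theorem mul_deg (h : Sk b τ ev) : ∀ (n : ℕ) (m : ℕ) (p q : L[X]), p.natDegree ≤ n →
    q.natDegree ≤ m → ∃ r : L[X], r.natDegree ≤ n + m ∧ ev p * ev q = ev r := by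
  intro n
  induction n with
  | zero =>
    intro m p q hp hq
    refine ⟨p.coeff 0 • q, (natDegree_smul_le _ _).trans (by omega), ?_⟩
    conv_lhs => rw [Polynomial.eq_C_of_natDegree_le_zero hp]
    rw [h.evC, smul_mul_assoc, one_mul, map_smul]
  | succ n ih =>
    intro m p q hp hq
    obtain ⟨r, hr, hr'⟩ := ih m (p.divX.map (τ.symm : L →+* L)) q (by
      refine (Polynomial.natDegree_map_le).trans ?_
      rw [Polynomial.natDegree_divX_eq_natDegree_tsub_one]; omega) hq
    refine ⟨X * r.map (τ : L →+* L) + p.coeff 0 • q, ?_, ?_⟩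
    · refine (natDegree_add_le _ _).trans (max_le ?_ ((natDegree_smul_le _ _).trans (by omega)))
      refine natDegree_mul_le.trans ?_
      have := natDegree_map_le (f := (τ : L →+* L)) (p := r)
      have := natDegree_X_le (R := L)
      omega
    · rw [h.decomp p, add_mul, mul_assoc, hr', h.mulX, map_add, map_smul, smul_mul_assoc, one_mul]

theorem ore0 (h : Sk b τ ev) (p q : L[X]) :
    ∃ g h : L[X], (g ≠ 0 ∨ h ≠ 0) ∧ ev g * ev p = ev h * ev q := by
  set m := max p.natDegree q.natDegree with hm
  have hp : p.natDegree ≤ m := le_max_left _ _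
  have hq : q.natDegree ≤ m := le_max_right _ _
  have hlt : ∀ (k : ℕ) (f : L[X]), f ∈ degreeLT L (k+1) ↔ f.natDegree ≤ k := by
    intro k f
    rw [mem_degreeLT, degree_lt_iff_coeff_zero, natDegree_le_iff_coeff_eq_zero]
    exact ⟨fun h N hN => h N (by omega), fun h N hN => h N (by omega)⟩
  let φ : (degreeLT L (m+1) × degreeLT L (m+1)) →ₗ[L] degreeLT L (2 * m + 1) :=
    { toFun := fun x => ⟨ev.symm (ev x.1 * ev p - ev x.2 * ev q), by
        rw [hlt, map_sub]
        obtain ⟨r, hr, hr'⟩ := h.mul_deg m m x.1 p ((hlt _ _).1 x.1.2) hp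
        obtain ⟨s, hs, hs'⟩ := h.mul_deg m m x.2 q ((hlt _ _).1 x.2.2) hq
        rw [hr', hs', LinearEquiv.symm_apply_apply, LinearEquiv.symm_apply_apply]
        refine (natDegree_sub_le _ _).trans (max_le ?_ ?_) <;> omega⟩
      map_add' := fun x y => by
        ext1
        simp only [Prod.fst_add, Prod.snd_add, Submodule.coe_add, map_add, add_mul, map_sub]
        abel
      map_smul' := fun l x => by
        ext1
        simp only [Prod.smul_fst, Prod.smul_snd, Submodule.coe_smul, map_smul, smul_mul_assoc,
          map_sub, smul_sub, RingHom.id_apply] }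
  have : FiniteDimensional L (degreeLT L (m+1)) := (degreeLTEquiv L (m+1)).symm.finiteDimensional
  have : FiniteDimensional L (degreeLT L (2*m+1)) := (degreeLTEquiv L (2*m+1)).symm.finiteDimensional
  have hker := LinearMap.ker_ne_bot_of_finrank_lt (f := φ) (by
    rw [Module.finrank_prod, (degreeLTEquiv L (m+1)).finrank_eq, (degreeLTEquiv L (2*m+1)).finrank_eq]
    simp; omega)
  obtain ⟨x, hx, hx0⟩ := (Submodule.ne_bot_iff _).1 hker
  refine ⟨x.1, x.2, ?_, ?_⟩
  · by_contra! hc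
    apply hx0
    ext1 <;> ext1
    · exact hc.1
    · exact hc.2
  · have h1 : ((φ x : degreeLT L (2*m+1)) : L[X]) = 0 := by rw [LinearMap.mem_ker.1 hx]; rfl
    have h2 : ev.symm (ev x.1 * ev p - ev x.2 * ev q) = 0 := h1
    rw [LinearEquiv.map_eq_zero_iff, sub_eq_zero] at h2
    exact h2

theorem b_ne (h : Sk b τ ev) : b ≠ 0 := by
  have hb : b = ev X := by have := h.mulX 1; rwa [h.one, mul_one, Polynomial.map_one, mul_one] at this
  rw [hb]; intro h0
  rw [LinearEquiv.map_eq_zero_iff] at h0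
  exact X_ne_zero h0

theorem ore1 [IsDomain R] (h : Sk b τ ev) (p q : L[X]) :
    ∃ g h : L[X], (g.coeff 0 ≠ 0 ∨ h.coeff 0 ≠ 0) ∧ ev g * ev p = ev h * ev q := by
  obtain ⟨g, f, hne, he⟩ := h.ore0 p q
  have key : ∀ n (g f : L[X]), g.natDegree ≤ n → f.natDegree ≤ n → (g ≠ 0 ∨ f ≠ 0) →
      ev g * ev p = ev f * ev q →
      ∃ g h : L[X], (g.coeff 0 ≠ 0 ∨ h.coeff 0 ≠ 0) ∧ ev g * ev p = ev h * ev q := by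
    intro n
    induction n with
    | zero =>
      intro g f hg hf hne he
      refine ⟨g, f, ?_, he⟩
      by_contra! hc
      rw [Polynomial.eq_C_of_natDegree_le_zero hg, Polynomial.eq_C_of_natDegree_le_zero hf, hc.1,
        hc.2] at hne
      simp at hne
    | succ n ih =>
      intro g f hg hf hne he
      by_cases hc : g.coeff 0 = 0 ∧ f.coeff 0 = 0
      · have nd : ∀ p : L[X], p.natDegree ≤ n+1 → (p.divX.map (τ.symm : L →+* L)).natDegree ≤ n := by
          intro p hp
          refine (Polynomial.natDegree_map_le).trans ?_
          rw [Polynomial.natDegree_divX_eq_natDegree_tsub_one]; omega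
        have dz : ∀ p : L[X], p.coeff 0 = 0 → p ≠ 0 → (p.divX.map (τ.symm : L →+* L)) ≠ 0 := by
          intro p hp h0 h1
          rw [Polynomial.map_eq_zero] at h1
          rw [← Polynomial.X_mul_divX_add p, h1, hp] at h0
          simp at h0
        refine ih _ _ (nd g hg) (nd f hf) ?_ ?_
        · exact hne.imp (dz _ hc.1) (dz _ hc.2)
        · rw [h.decomp g, h.decomp f, hc.1, hc.2, zero_smul, add_zero, add_zero, mul_assoc,
            mul_assoc] at he
          exact mul_left_cancel₀ h.b_ne he
      · refine ⟨g, f, ?_, he⟩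
        by_contra! h'
        exact hc h'
  exact key _ g f (le_max_left _ _) (le_max_right _ _) hne he

theorem coeff_mul0 (h : Sk b τ ev) (p q r : L[X]) (he : ev p * ev q = ev r) :
    r.coeff 0 = p.coeff 0 * q.coeff 0 := by
  have : b ∣ ev (r - C (p.coeff 0 * q.coeff 0)) := by
    rw [map_sub, ← he, h.decomp p, h.decomp q, h.evC, add_mul, smul_mul_assoc, one_mul, smul_add,
      smul_smul, add_sub_assoc, add_sub_cancel_right, ← h.decomp q]
    refine dvd_add ((dvd_refl b).mul_right _ |>.mul_right _) ?_
    rw [← one_mul (b * ev _), ← smul_mul_assoc, ← h.evC, ← mul_assoc, h.evmulb, h.evX, mul_assoc]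
    exact (dvd_refl b).mul_right _
  rw [h.dvd_iff] at this
  simpa [sub_eq_zero] using this

theorem toOL [IsDomain R] (h : Sk b τ ev) : OL b where
  ne := h.b_ne
  not_dvd := by rw [← h.one, h.dvd_iff]; simp
  comm := fun x => by
    obtain ⟨p, rfl⟩ := ev.surjective x
    rw [h.evmulb, h.evX]; exact ⟨_, rfl⟩
  ore := fun p p' hp hp' => by
    obtain ⟨p, rfl⟩ := ev.surjective p
    obtain ⟨q, rfl⟩ := ev.surjective p'
    rw [← h.one, ← map_sub, h.dvd_iff] at hp hp'
    have hp1 : p.coeff 0 = 1 := by simpa [sub_eq_zero] using hp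
    have hq1 : q.coeff 0 = 1 := by simpa [sub_eq_zero] using hp'
    obtain ⟨f, g, hne, he⟩ := h.ore1 p q
    obtain ⟨r, hr⟩ := ev.surjective (ev f * ev p)
    have h1 := h.coeff_mul0 f p r hr.symm
    have h2 := h.coeff_mul0 g q r (by rw [hr, he])
    rw [hp1, mul_one] at h1
    rw [hq1, mul_one] at h2
    have hc : f.coeff 0 ≠ 0 := by
      rcases hne with h3 | h3
      · exact h3
      · rwa [← h1, h2]
    refine ⟨ev ((f.coeff 0)⁻¹ • g), ev ((f.coeff 0)⁻¹ • f), ?_, ?_, ?_⟩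
    · rw [← h.one, ← map_sub, h.dvd_iff]; simp [← h1, h2]
      rw [← h2, h1, inv_mul_cancel₀ hc, sub_self]
    · rw [← h.one, ← map_sub, h.dvd_iff]; simp [hc]
    · rw [map_smul, map_smul, smul_mul_assoc, smul_mul_assoc, he]

end Sk

set_option linter.unusedSectionVars false
open Polynomial

/-- iterated difference, division ring version -/
def del {D : Type*} [DivisionRing D] (k : D) : ℕ → D → D
  | 0, a => a
  | n + 1, a => del k n a - k * del k n a * k⁻¹

theorem dl_eq_del {D : Type*} [DivisionRing D] (u : Dˣ) (n : ℕ) (a : D) :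
    dl u n a = del (u : D) n a := by
  induction n with
  | zero => rfl
  | succ n ih => simp [dl, del, ih]

theorem map_dl {R S : Type*} [Ring R] [Ring S] (φ : R →+* S) (u : Rˣ) (n : ℕ) (a : R) :
    φ (dl u n a) = dl (Units.map (φ : R →* S) u) n (φ a) := by
  induction n with
  | zero => rfl
  | succ n ih => simp only [dl, map_sub, map_mul, ih]; rfl

theorem map_del {D E : Type*} [DivisionRing D] [DivisionRing E] (φ : D →+* E) (k : D) (n : ℕ)
    (a : D) : φ (del k n a) = del (φ k) n (φ a) := by
  induction n with
  | zero => rfl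
  | succ n ih => simp [del, ih]

theorem map_wit {D E : Type*} [DivisionRing D] [DivisionRing E] (φ : D →+* E) (k : D) (n : ℕ)
    (a : D) : φ (wit k n a) = wit (φ k) n (φ a) := by
  induction n with
  | zero => rfl
  | succ n ih => simp [wit, ih]

/-- centralizer as a division subring -/
def cen {D : Type*} [DivisionRing D] (S : Set D) : Subfield D :=
  { Subring.centralizer S with
    inv_mem' := fun x hx => by
      intro s hs
      have := hx s hs
      exact (Commute.inv_right₀ (show Commute s x from this)) }

theorem mem_cen {D : Type*} [DivisionRing D] {S : Set D} {x : D} :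
    x ∈ cen S ↔ ∀ s ∈ S, s * x = x * s := Iff.rfl

theorem eval_mul_c {E : Type*} [DivisionRing E] {t : E} (hc : ∀ x, t * x = x * t) (p q : E[X]) :
    (p * q).eval t = p.eval t * q.eval t :=
  Polynomial.eval₂_mul_noncomm _ _ (fun _ => (hc _).symm)

theorem finite_central_roots {E : Type*} [DivisionRing E] (T : Set E)
    (hc : ∀ t ∈ T, ∀ x, t * x = x * t) (p : E[X]) (hp : p ≠ 0) :
    {t ∈ T | p.eval t = 0}.Finite := by
  have key : ∀ n (p : E[X]), p.natDegree ≤ n → p ≠ 0 → {t ∈ T | p.eval t = 0}.Finite := by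
    intro n
    induction n with
    | zero =>
      intro p hp h0
      convert Set.finite_empty
      ext t
      simp only [Set.mem_ofPred_eq, Set.mem_empty_iff_false, iff_false, not_and]
      intro _ h
      rw [Polynomial.eq_C_of_natDegree_le_zero hp] at h h0
      simp at h
      simp [h] at h0
    | succ n ih =>
      intro p hp h0
      by_cases hne : ∃ t ∈ T, p.eval t = 0
      · obtain ⟨t, ht, h⟩ := hne
        have e : p = (X - C t) * (p /ₘ (X - C t)) := by
          have e1 := Polynomial.modByMonic_add_div p (X - C t)
          have h2 : p %ₘ (X - C t) = C ((p %ₘ (X - C t)).coeff 0) := by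
            apply Polynomial.eq_C_of_degree_le_zero
            have := degree_modByMonic_lt p (monic_X_sub_C t)
            rw [degree_X_sub_C] at this
            exact Order.le_of_lt_succ this
          have h3 := congrArg (eval t) e1
          rw [eval_add, eval_mul_c (hc t ht), h, h2] at h3
          simp only [eval_C, eval_sub, eval_X, sub_self, zero_mul, add_zero] at h3
          rw [h2, h3, C_0, zero_add] at e1
          exact e1.symm
        set q := p /ₘ (X - C t) with hq
        have hq0 : q ≠ 0 := by rintro h1; rw [h1, mul_zero] at e; exact h0 e
        have hd : q.natDegree ≤ n := by
          have := congrArg natDegree e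
          rw [natDegree_mul (X_sub_C_ne_zero t) hq0, natDegree_X_sub_C] at this
          omega
        refine ((ih q hd hq0).insert t).subset ?_
        rintro s ⟨hs, hs'⟩
        rw [e, eval_mul_c (hc s hs)] at hs'
        simp only [eval_sub, eval_X, eval_C, mul_eq_zero] at hs'
        rcases hs' with h1 | h1
        · left; exact sub_eq_zero.1 h1
        · right; exact ⟨hs, h1⟩
      · convert Set.finite_empty
        ext t
        simp only [Set.mem_ofPred_eq, Set.mem_empty_iff_false, iff_false, not_and]
        intro ht h
        exact hne ⟨t, ht, h⟩
  exact key _ p le_rfl hp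

theorem skPoly (E : Type*) [DivisionRing E] :
    Sk (L := E) (R := E[X]) X (RingEquiv.refl E) (LinearEquiv.refl E E[X]) where
  one := rfl
  mulX := fun p => by simp

/-- polynomial form of lemma G with central parameters -/
theorem polyG {E : Type*} [DivisionRing E] (T : Set E) (hc : ∀ t ∈ T, ∀ x, t * x = x * t)
    (k : E) (hk : k ≠ 0) (a : E) (n : ℕ) :
    ∃ p q : E[X], p.coeff 0 = 1 ∧ q.coeff 0 = 1 ∧ p.coeff 1 - q.coeff 1 = del k n a ∧
      ∃ S : Set E, S.Finite ∧ ∀ t ∈ T, t ∉ S → 1 + a * t ≠ 0 ∧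
        q.eval t * wit k n (1 + a * t) = p.eval t := by
  let u : (E[X])ˣ := Units.map (C : E →+* E[X]).toMonoidHom (Units.mk0 k hk)
  have hu : (u : E[X]) = C k := rfl
  have hui : ((u⁻¹ : (E[X])ˣ) : E[X]) = C k⁻¹ := by
    simp only [u]; rw [← map_inv]; simp
  obtain ⟨p, q, f, hp, hq, hpq, hf, H⟩ := (skPoly E).toOL.lemmaG u (C a * X)
    (by rw [X_dvd_iff]; simp) n
  have hdl : ∀ m, dl u m (C a * X) = C (del k m a) * X := by
    intro m
    induction m with
    | zero => rfl
    | succ m ih =>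
      rw [dl, ih, hu, hui, del, C_sub, C_mul, C_mul, sub_mul]
      simp only [mul_assoc, X_mul_C]
  refine ⟨p, q, ?_, ?_, ?_, {t ∈ T | f.eval t = 0} ∪ {t ∈ T | (1 + C a * X : E[X]).eval t = 0}, ?_, ?_⟩
  · rw [X_dvd_iff] at hp; simpa [sub_eq_zero] using hp
  · rw [X_dvd_iff] at hq; simpa [sub_eq_zero] using hq
  · have := (skPoly E).sq_dvd (p - q - dl u n (C a * X)) hpq
    rw [hdl] at this
    simpa [sub_eq_zero] using this
  · refine (finite_central_roots T hc f hf).union (finite_central_roots T hc _ ?_)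
    intro h
    have := congrArg (fun r => coeff r 0) h
    simp at this
  · intro t ht hts
    simp only [Set.mem_union, Set.mem_ofPred_eq, not_or, not_and] at hts
    refine ⟨by simpa [eval_mul_c (hc t ht)] using hts.2 ht, ?_⟩
    let φ : E[X] →+* E := eval₂RingHom' (RingHom.id E) t (fun x => (hc t ht x).symm)
    have hφ : ∀ r, φ r = r.eval t := fun r => rfl
    have := (H E φ (hts.1 ht)).2.2
    rw [hφ, hφ, hφ, hu, hφ] at this
    simpa [eval_mul_c (hc t ht)] using this

theorem P0c {E : Type*} [DivisionRing E] (T : Set E) (hT : T.Infinite)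
    (hc : ∀ t ∈ T, ∀ x, t * x = x * t)
    (k : E) (hk : k ≠ 0) (a g : E) (n : ℕ)
    (H : ∀ t ∈ T, 1 + a * t ≠ 0 → wit k n (1 + a * t) = g) : del k n a = 0 := by
  obtain ⟨p, q, hp, hq, hpq, S, hS, hx⟩ := polyG T hc k hk a n
  have h0 : q * C g = p := by
    by_contra hne
    have := finite_central_roots T hc (q * C g - p) (sub_ne_zero.2 hne)
    refine hT ((this.union hS).subset fun t ht => ?_)
    by_cases hts : t ∈ S
    · right; exact hts
    · left
      obtain ⟨h1, h2⟩ := hx t ht hts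
      refine ⟨ht, ?_⟩
      rw [eval_sub, eval_mul_c (hc t ht), eval_C, ← H t ht h1, h2, sub_self]
  have hg : g = 1 := by
    rw [← h0] at hp; simpa [hq] using hp
  rw [hg, C_1, mul_one] at h0
  rw [← hpq, h0, sub_self]

theorem Pc {E : Type*} [DivisionRing E] (T : Set E) (hT : T.Infinite)
    (hc : ∀ t ∈ T, ∀ x, t * x = x * t) (K : Subfield E) (hTK : T ⊆ K)
    (k : E) (hk : k ≠ 0) (a : E) (n : ℕ)
    (H : ∀ t ∈ T, 1 + a * t ≠ 0 → wit k n (1 + a * t) ∈ K) : del k n a ∈ K := by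
  obtain ⟨p, q, hp, hq, hpq, S, hS, hx⟩ := polyG T hc k hk a n
  by_contra he
  set e := del k n a with hee
  let _ : Module (↥K)ᵐᵒᵖ E := Module.compHom E (RingHom.op K.subtype)
  have hsm : ∀ (κ : K) (x : E), MulOpposite.op κ • x = x * κ := fun κ x => rfl
  have fK : ∀ (f : E →ₗ[(↥K)ᵐᵒᵖ] (↥K)ᵐᵒᵖ) (x : E) (κ : K),
      (f (x * κ)).unop = (f x).unop * κ := by
    intro f x κ
    rw [← hsm, map_smul]; rfl
  obtain ⟨f1, hf1, -⟩ := Submodule.exists_le_ker_of_notMem (K := (↥K)ᵐᵒᵖ) (V := E) (p := ⊥)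
    (v := 1) (by simp)
  obtain ⟨f2, hf2, hf2'⟩ := Submodule.exists_le_ker_of_notMem (K := (↥K)ᵐᵒᵖ) (V := E)
    (p := Submodule.span _ {1}) (v := e) (by
      rw [Submodule.mem_span_singleton]
      rintro ⟨κ, hκ⟩
      apply he
      rw [← hκ, ← MulOpposite.op_unop κ, hsm, one_mul]
      exact κ.unop.2)
  have hf21 : f2 1 = 0 := hf2' (Submodule.mem_span_singleton_self 1)
  -- coefficientwise application
  let pm : (E →ₗ[(↥K)ᵐᵒᵖ] (↥K)ᵐᵒᵖ) → E[X] → K[X] := fun f r =>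
    ∑ i ∈ Finset.range (r.natDegree + 1), C ((f (r.coeff i)).unop) * X ^ i
  have pmc : ∀ f r i, (pm f r).coeff i = (f (r.coeff i)).unop := by
    intro f r i
    simp only [pm, finset_sum_coeff, coeff_C_mul, coeff_X_pow, mul_ite, mul_one, mul_zero]
    rw [Finset.sum_ite_eq]
    split_ifs with h
    · rfl
    · rw [coeff_eq_zero_of_natDegree_lt (by simpa using h)]; simp
  have pme : ∀ f r (t : K), (pm f r).eval t = (f (r.eval (t : E))).unop := by
    intro f r t
    rw [eval_eq_sum_range' (n := r.natDegree + 1) (Nat.lt_succ_self _), map_sum]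
    simp only [pm, eval_finset_sum]
    rw [Finset.unop_sum]
    refine Finset.sum_congr rfl fun i _ => ?_
    have : (t : E) ^ i = ((t ^ i : K) : E) := by simp
    rw [this, fK, eval_C_mul]; rw [X_pow_eq_monomial, eval_monomial, one_mul]
  have hcK : ∀ t : K, (t : E) ∈ T → ∀ x : K, t * x = x * t := fun t ht x =>
    Subtype.ext (hc t ht x)
  obtain ⟨g, h, hgh, he'⟩ := (skPoly K).ore1 (pm f1 q) (pm f2 q).divX
  simp only [LinearEquiv.refl_apply] at he'
  have dX : ∀ r : E[X], r.coeff 0 = 1 → X * (pm f2 r).divX = pm f2 r := by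
    intro r hr
    conv_rhs => rw [← X_mul_divX_add (pm f2 r), pmc, hr, hf21]
    simp
  have main : g * pm f1 p = h * (pm f2 p).divX := by
    by_contra hne
    have := finite_central_roots {t : K | (t : E) ∈ T} hcK (g * pm f1 p - h * (pm f2 p).divX)
      (sub_ne_zero.2 hne)
    have h3 := (this.image ((↑) : K → E)).union (hS.union (Set.finite_singleton 0))
    refine hT (h3.subset fun t ht => ?_)
    by_cases hts : t ∈ S
    · right; left; exact hts
    by_cases ht0 : t = 0
    · right; right; exact ht0
    left
    obtain ⟨h1, h2⟩ := hx t ht hts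
    refine ⟨⟨t, hTK ht⟩, ⟨ht, ?_⟩, rfl⟩
    have hxK := H t ht h1
    set x := wit k n (1 + a * t)
    have ht' : ∀ x : K, (⟨t, hTK ht⟩ : K) * x = x * ⟨t, hTK ht⟩ := hcK ⟨t, hTK ht⟩ ht
    have fx : ∀ f, (pm f q).eval ⟨t, hTK ht⟩ * ⟨x, hxK⟩ = (pm f p).eval ⟨t, hTK ht⟩ := by
      intro f
      rw [pme, pme, ← fK]
      show (f (eval t q * x)).unop = _
      rw [h2]
    have fx2 : (pm f2 q).divX.eval ⟨t, hTK ht⟩ * ⟨x, hxK⟩ = (pm f2 p).divX.eval ⟨t, hTK ht⟩ := by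
      have := fx f2
      rw [← dX q hq, ← dX p hp, eval_mul_c ht', eval_mul_c ht', eval_X, mul_assoc] at this
      exact mul_left_cancel₀ (fun h => ht0 (congrArg Subtype.val h)) this
    have h5 := congrArg (eval ⟨t, hTK ht⟩) he'
    rw [eval_mul_c ht', eval_mul_c ht'] at h5
    rw [eval_sub, eval_mul_c ht', eval_mul_c ht', ← fx, ← fx2, ← mul_assoc, ← mul_assoc, h5, sub_self]
  have c1 := congrArg (fun r => coeff r 0) he'
  have c2 := congrArg (fun r => coeff r 0) main
  simp only [mul_coeff_zero, pmc, coeff_divX, hp, hq, zero_add] at c1 c2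
  have hh : h.coeff 0 ≠ 0 := by
    rcases hgh with h1 | h1
    · intro h2
      rw [h2, zero_mul] at c1
      rcases mul_eq_zero.1 c1 with h3 | h3
      · exact h1 h3
      · exact hf1 (MulOpposite.unop_eq_zero_iff _ |>.1 h3)
    · exact h1
  have := mul_left_cancel₀ hh (c1.symm.trans c2)
  apply hf2
  rw [← hpq, map_sub, MulOpposite.unop_injective this, sub_self]

theorem comm_cen {D : Type*} [DivisionRing D] {T : Set D} (hTT : ∀ s ∈ T, ∀ t ∈ T, s * t = t * s) :
    T ⊆ cen T := fun t ht s hs => hTT s hs t ht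

theorem P0 {D : Type*} [DivisionRing D] (T : Set D) (hT : T.Infinite)
    (hTT : ∀ s ∈ T, ∀ t ∈ T, s * t = t * s) (k : D) (hk : k ≠ 0) (a g : D)
    (hTk : ∀ t ∈ T, t * k = k * t) (hTa : ∀ t ∈ T, t * a = a * t) (n : ℕ)
    (H : ∀ t ∈ T, 1 + a * t ≠ 0 → wit k n (1 + a * t) = g) : del k n a = 0 := by
  let k' : cen T := ⟨k, hTk⟩
  let a' : cen T := ⟨a, hTa⟩
  have ht1 : ∃ t ∈ T, 1 + a * t ≠ 0 := by
    by_contra! hc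
    have : ∀ t ∈ T, a * t = -1 := fun t ht => by
      have := hc t ht
      rw [eq_neg_iff_add_eq_zero, add_comm]; exact this
    obtain ⟨t, ht, s, hs, hne⟩ := hT.nontrivial
    have ha : a ≠ 0 := by rintro rfl; simpa using this t ht
    exact hne (mul_left_cancel₀ ha ((this t ht).trans (this s hs).symm))
  obtain ⟨t0, ht0, ht0'⟩ := ht1
  let T' : Set (cen T) := Subtype.val ⁻¹' T
  have hT' : T'.Infinite := hT.preimage (by
    rw [Subtype.range_coe]; exact comm_cen hTT)
  have hw : ∀ t : cen T, ((wit k' n (1 + a' * t) : cen T) : D) = wit k n (1 + a * t) := fun t => by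
    have := map_wit (cen T).subtype k' n (1 + a' * t)
    simpa using! this
  have := P0c T' hT' (fun t ht x => Subtype.ext (x.2 _ ht)) k'
    (fun h => hk (congrArg Subtype.val h)) a' (wit k' n (1 + a' * ⟨t0, comm_cen hTT ht0⟩)) n (by
      intro t ht h
      apply Subtype.ext
      rw [hw, hw, H t ht, H t0 ht0 ht0']
      intro h1; apply h; apply Subtype.ext; exact h1)
  have h2 := map_del (cen T).subtype k' n a'
  rw [this] at h2
  simpa using! h2.symm

theorem Plem {D : Type*} [DivisionRing D] (T : Set D) (hT : T.Infinite)
    (hTT : ∀ s ∈ T, ∀ t ∈ T, s * t = t * s) (K : Subfield D) (hTK : T ⊆ K)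
    (k : D) (hk : k ≠ 0) (a : D)
    (hTk : ∀ t ∈ T, t * k = k * t) (hTa : ∀ t ∈ T, t * a = a * t) (n : ℕ)
    (H : ∀ t ∈ T, 1 + a * t ≠ 0 → wit k n (1 + a * t) ∈ K) : del k n a ∈ K := by
  let k' : cen T := ⟨k, hTk⟩
  let a' : cen T := ⟨a, hTa⟩
  let T' : Set (cen T) := Subtype.val ⁻¹' T
  have hT' : T'.Infinite := hT.preimage (by
    rw [Subtype.range_coe]; exact comm_cen hTT)
  have hw : ∀ t : cen T, ((wit k' n (1 + a' * t) : cen T) : D) = wit k n (1 + a * t) := fun t => by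
    have := map_wit (cen T).subtype k' n (1 + a' * t)
    simpa using! this
  have := Pc T' hT' (fun t ht x => Subtype.ext (x.2 _ ht)) (K.comap (cen T).subtype)
    (fun t ht => hTK ht) k'
    (fun h => hk (congrArg Subtype.val h)) a' n (by
      intro t ht h
      show ((wit k' n (1 + a' * t) : cen T) : D) ∈ K
      rw [hw]
      apply H t ht
      intro h1; apply h; apply Subtype.ext; exact h1)
  have h2 := map_del (cen T).subtype k' n a'
  have h3 : (cen T).subtype (del k' n a') ∈ K := this
  rw [h2] at h3
  exact h3

set_option linter.unusedSectionVars false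
open Polynomial

/-- `b` normalizes the division subring `L` -/
def Nrm {D : Type*} [DivisionRing D] (L : Subfield D) (b : D) : Prop :=
  b ≠ 0 ∧ ∀ x ∈ L, b * x * b⁻¹ ∈ L ∧ b⁻¹ * x * b ∈ L

/-- powers of `b` are independent over `L` -/
def Ind {D : Type*} [DivisionRing D] (L : Subfield D) (b : D) : Prop :=
  ∀ p : L[X], p.eval₂ L.subtype b = 0 → p = 0

section Q
variable {D : Type*} [DivisionRing D] {L : Subfield D} {b : D}

/-- conjugation by `b` on `L` -/
def Nrm.tau (h : Nrm L b) : L ≃+* L where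
  toFun x := ⟨b * x * b⁻¹, (h.2 x x.2).1⟩
  invFun x := ⟨b⁻¹ * x * b, (h.2 x x.2).2⟩
  left_inv x := by
    ext; simp only [mul_assoc]; rw [inv_mul_cancel_left₀ h.1, inv_mul_cancel₀ h.1, mul_one]
  right_inv x := by
    ext; simp only [mul_assoc]; rw [mul_inv_cancel_left₀ h.1, mul_inv_cancel₀ h.1, mul_one]
  map_mul' x y := by
    ext; simp only [mul_assoc, Subfield.coe_mul]; rw [inv_mul_cancel_left₀ h.1]
  map_add' x y := by
    ext; simp only [mul_add, add_mul, Subfield.coe_add]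

theorem Nrm.b_ev (h : Nrm L b) (p : L[X]) :
    b * p.eval₂ L.subtype b = (X * p.map (h.tau : L →+* L)).eval₂ L.subtype b := by
  induction p using Polynomial.induction_on' with
  | add p q hp hq => rw [eval₂_add, mul_add, hp, hq, Polynomial.map_add, mul_add, eval₂_add]
  | monomial i l =>
    rw [map_monomial, X_mul_monomial, eval₂_monomial, eval₂_monomial]
    show b * (l * b ^ i) = b * l * b⁻¹ * b ^ (i+1)
    rw [pow_succ' b i, mul_assoc _ b⁻¹, inv_mul_cancel_left₀ h.1, mul_assoc]

theorem Nrm.mul_ev (h : Nrm L b) (p q : L[X]) :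
    ∃ r : L[X], r.eval₂ L.subtype b = p.eval₂ L.subtype b * q.eval₂ L.subtype b := by
  induction p using Polynomial.induction_on' with
  | add p p' hp hp' =>
    obtain ⟨r, hr⟩ := hp
    obtain ⟨s, hs⟩ := hp'
    exact ⟨r + s, by rw [eval₂_add, eval₂_add, add_mul, hr, hs]⟩
  | monomial i l =>
    have : ∃ r : L[X], r.eval₂ L.subtype b = b ^ i * q.eval₂ L.subtype b := by
      induction i with
      | zero => exact ⟨q, by simp⟩
      | succ i ih =>
        obtain ⟨r, hr⟩ := ih
        exact ⟨_, by rw [pow_succ', mul_assoc, ← hr, h.b_ev]⟩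
    obtain ⟨r, hr⟩ := this
    refine ⟨l • r, ?_⟩
    rw [eval₂_smul, eval₂_monomial, hr, mul_assoc]

/-- the subring generated by `L` and `b` -/
def Nrm.R (h : Nrm L b) : Subring D where
  carrier := {x | ∃ p : L[X], p.eval₂ L.subtype b = x}
  mul_mem' := by
    rintro _ _ ⟨p, rfl⟩ ⟨q, rfl⟩
    exact h.mul_ev p q
  one_mem' := ⟨1, by simp⟩
  add_mem' := by
    rintro _ _ ⟨p, rfl⟩ ⟨q, rfl⟩
    exact ⟨p + q, by rw [eval₂_add]⟩
  zero_mem' := ⟨0, by simp⟩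
  neg_mem' := by
    rintro _ ⟨p, rfl⟩
    exact ⟨-p, by rw [eval₂_neg]⟩

/-- inclusion of scalars -/
def Nrm.incl (h : Nrm L b) : L →+* h.R where
  toFun l := ⟨l, C l, by simp⟩
  map_one' := rfl
  map_zero' := rfl
  map_mul' _ _ := rfl
  map_add' _ _ := rfl

instance (h : Nrm L b) : Module L h.R := Module.compHom _ h.incl

instance (h : Nrm L b) : IsScalarTower L h.R h.R := ⟨fun l x y => mul_assoc (h.incl l) x y⟩

/-- linear equivalence of the skew polynomial presentation -/
noncomputable def Nrm.ev (h : Nrm L b) (hi : Ind L b) : L[X] ≃ₗ[L] h.R :=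
  LinearEquiv.ofBijective
    { toFun := fun p => ⟨p.eval₂ L.subtype b, p, rfl⟩
      map_add' := fun p q => Subtype.ext (by simp [eval₂_add])
      map_smul' := fun l p => Subtype.ext (by
        simp only [eval₂_smul, RingHom.id_apply]; rfl) } (by
    constructor
    · rw [injective_iff_map_eq_zero]
      intro p hp
      exact hi p (congrArg Subtype.val hp)
    · rintro ⟨_, p, rfl⟩
      exact ⟨p, rfl⟩)

theorem Nrm.ev_coe (h : Nrm L b) (hi : Ind L b) (p : L[X]) :
    ((h.ev hi p : h.R) : D) = p.eval₂ L.subtype b := rfl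

theorem Nrm.bmem (h : Nrm L b) : b ∈ h.R := ⟨X, by simp⟩

theorem Nrm.sk (h : Nrm L b) (hi : Ind L b) : Sk (⟨b, h.bmem⟩ : h.R) h.tau (h.ev hi) where
  one := Subtype.ext (by rw [h.ev_coe]; simp)
  mulX := fun p => Subtype.ext (by
    rw [h.ev_coe, ← h.b_ev]; rfl)

theorem Nrm.lemQ (h : Nrm L b) (hi : Ind L b) (k : D) (hk : k ≠ 0) (hkL : k ∈ L)
    (e : D) (he : e ∈ L) (n : ℕ) :
    ∃ P Q : L[X], P.coeff 0 = 1 ∧ Q.coeff 0 = 1 ∧ Q.eval₂ L.subtype b ≠ 0 ∧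
      Q.eval₂ L.subtype b * wit k n (1 + e * b) = P.eval₂ L.subtype b ∧
      ((P.coeff 1 : D) - Q.coeff 1) * b = del k n (e * b) := by
  have S := h.sk hi
  let u : h.Rˣ := Units.map h.incl.toMonoidHom (Units.mk0 ⟨k, hkL⟩ (fun h => hk (congrArg Subtype.val h)))
  have hu : ((u : h.R) : D) = k := rfl
  let y : h.R := h.incl ⟨e, he⟩ * ⟨b, h.bmem⟩
  have hy : (y : D) = e * b := rfl
  obtain ⟨p, q, f, hp, hq, hpq, hf, H⟩ := S.toOL.lemmaG u y
    (S.toOL.dvd_mul_left' _ dvd_rfl) n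
  obtain ⟨P, rfl⟩ := (h.ev hi).surjective p
  obtain ⟨Q, rfl⟩ := (h.ev hi).surjective q
  have hd : ∀ m, ∃ l : L, ((dl u m y : h.R) : D) = l * b := by
    intro m
    induction m with
    | zero => exact ⟨⟨e, he⟩, rfl⟩
    | succ m ih =>
      obtain ⟨l, hl⟩ := ih
      have : (((u⁻¹ : h.Rˣ) : h.R) : D) = k⁻¹ := by
        simp only [u]; rw [← map_inv]; simp [Nrm.incl]
      refine ⟨l - ⟨k, hkL⟩ * l * ⟨b * k⁻¹ * b⁻¹, (h.2 _ (L.inv_mem hkL)).1⟩, ?_⟩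
      simp only [dl, AddSubgroupClass.coe_sub, Subring.coe_mul, hl, hu, this, Subfield.coe_sub,
        Subfield.coe_mul, sub_mul, mul_assoc, inv_mul_cancel₀ h.1, mul_one]
  obtain ⟨l, hl⟩ := hd n
  have hdl : dl u n y = h.ev hi (C l * X) := by
    apply Subtype.ext
    rw [h.ev_coe, hl]; simp
  have hdel : ((dl u n y : h.R) : D) = del k n (e * b) := by
    have h1 := map_dl h.R.subtype u n y
    have h2 := dl_eq_del (Units.map (h.R.subtype : h.R →* D) u) n (h.R.subtype y)
    rw [h2] at h1
    exact h1
  refine ⟨P, Q, ?_, ?_, ?_, ?_, ?_⟩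
  · rw [← S.one, ← map_sub, S.dvd_iff] at hp; simpa [sub_eq_zero] using hp
  · rw [← S.one, ← map_sub, S.dvd_iff] at hq; simpa [sub_eq_zero] using hq
  · exact (H D h.R.subtype (fun h0 => hf (Subtype.ext h0))).1
  · exact (H D h.R.subtype (fun h0 => hf (Subtype.ext h0))).2.2
  · rw [hdl, ← map_sub, ← map_sub] at hpq
    have := S.sq_dvd _ hpq
    simp only [coeff_sub, coeff_C_mul, coeff_X_one, mul_one, sub_eq_zero] at this
    rw [← hdel, hl, ← this]; simp

theorem Nrm.uniq (h : Nrm L b) (hi : Ind L b) (P Q P' Q' : L[X]) (x : D)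
    (hP : P.coeff 0 = 1) (hQ : Q.coeff 0 = 1) (hP' : P'.coeff 0 = 1) (hQ' : Q'.coeff 0 = 1)
    (e : Q.eval₂ L.subtype b * x = P.eval₂ L.subtype b)
    (e' : Q'.eval₂ L.subtype b * x = P'.eval₂ L.subtype b) :
    P.coeff 1 - Q.coeff 1 = P'.coeff 1 - Q'.coeff 1 := by
  have S := h.sk hi
  have d : ∀ P : L[X], P.coeff 0 = 1 → (⟨b, h.bmem⟩ : h.R) ∣ h.ev hi P - 1 := by
    intro P hP
    rw [← S.one, ← map_sub, S.dvd_iff]; simp [hP]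
  obtain ⟨f, g, hf, hg, hfg⟩ := S.toOL.ore _ _ (d Q hQ) (d Q' hQ')
  have hfg' : g * h.ev hi P = f * h.ev hi P' := by
    apply Subtype.ext
    have := congrArg Subtype.val hfg
    simp only [Subring.coe_mul, h.ev_coe] at this ⊢
    rw [← e, ← e', ← mul_assoc, ← mul_assoc, this]
  have h1 := S.toOL.sq_dvd_mul hg (d Q hQ)
  have h2 := S.toOL.sq_dvd_mul hf (d Q' hQ')
  have h3 := S.toOL.sq_dvd_mul hg (d P hP)
  have h4 := S.toOL.sq_dvd_mul hf (d P' hP')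
  have h5 : (⟨b, h.bmem⟩ : h.R) * ⟨b, h.bmem⟩ ∣ h.ev hi (P - Q - (P' - Q')) := by
    have e1 := sub_eq_zero.2 hfg
    have e2 := sub_eq_zero.2 hfg'
    have : h.ev hi (P - Q - (P' - Q')) = (g - 1) * (h.ev hi Q - 1) - (f - 1) * (h.ev hi Q' - 1)
      - ((g - 1) * (h.ev hi P - 1) - (f - 1) * (h.ev hi P' - 1)) := by
      have e3 : (g - 1) * (h.ev hi Q - 1) - (f - 1) * (h.ev hi Q' - 1)
        - ((g - 1) * (h.ev hi P - 1) - (f - 1) * (h.ev hi P' - 1)) =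
          (g * h.ev hi Q - f * h.ev hi Q') - (g * h.ev hi P - f * h.ev hi P') +
          (h.ev hi P - h.ev hi Q - (h.ev hi P' - h.ev hi Q')) := by noncomm_ring
      rw [e3, e1, e2]; simp only [map_sub]; abel
    rw [this]
    exact dvd_sub (dvd_sub h1 h2) (dvd_sub h3 h4)
  have := S.sq_dvd _ h5
  simpa [sub_eq_zero] using this

theorem Nrm.del_zero (h : Nrm L b) (hi : Ind L b) (k : D) (hk : k ≠ 0) (hkL : k ∈ L)
    (e : D) (he : e ∈ L) (n : ℕ) (hx : wit k n (1 + e * b) ∈ L) : del k n (e * b) = 0 := by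
  obtain ⟨P, Q, hP, hQ, h0, hx', hd⟩ := h.lemQ hi k hk hkL e he n
  have S := h.sk hi
  have h1 : h.ev hi Q * h.ev hi (C ⟨_, hx⟩) = h.ev hi P := by
    apply Subtype.ext
    rw [Subring.coe_mul, h.ev_coe, h.ev_coe, h.ev_coe, eval₂_C]; exact hx'
  have h2 := S.coeff_mul0 _ _ _ h1
  rw [hP, hQ, coeff_C_zero, one_mul] at h2
  have h3 := congrArg Subtype.val h2
  simp only [Subfield.coe_one] at h3
  rw [← h3, mul_one, ← sub_eq_zero, ← eval₂_sub] at hx'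
  have := hi _ hx'
  rw [sub_eq_zero] at this
  rw [← hd, this, sub_self, zero_mul]

end Q

set_option linter.unusedSectionVars false
open Polynomial

section sub
variable {Γ : Type*} [Group Γ]

theorem IsSubnormal.exists_step {H : Subgroup Γ} (hH : IsSubnormal H) (X : Subgroup Γ) (hX : H ≤ X)
    (hT : X ≠ ⊤) : ∃ S : Subgroup Γ, IsSubnormal S ∧ H ≤ S ∧ S ≤ X ∧ ∃ b, b ∉ X ∧
      (∀ x ∈ S, b * x * b⁻¹ ∈ S) ∧ (∀ x ∈ S, b⁻¹ * x * b ∈ S) := by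
  obtain ⟨N, s, h0, hN, hs⟩ := hH
  have hmono : ∀ i ≤ N, H ≤ s i := by
    intro i
    induction i with
    | zero => intro _; rw [h0]
    | succ i ih => intro hi; exact (ih (by omega)).trans (hs i (by omega)).1
  have : ∃ i < N, s i ≤ X ∧ ¬ s (i+1) ≤ X := by
    by_contra! hc
    have : ∀ i ≤ N, s i ≤ X := by
      intro i
      induction i with
      | zero => intro _; rw [h0]; exact hX
      | succ i ih => intro hi; exact hc i (by omega) (ih (by omega))
    have := this N le_rfl
    rw [hN] at this
    exact hT (top_le_iff.1 this)
  obtain ⟨i, hi, h1, h2⟩ := this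
  obtain ⟨b, hb, hbX⟩ := SetLike.not_le_iff_exists.1 h2
  have hn : ∀ b ∈ s (i+1), ∀ x ∈ s i, b * x * b⁻¹ ∈ s i := by
    intro b hb x hx
    have := (hs i hi).2.conj_mem ⟨x, (hs i hi).1 hx⟩ (Subgroup.mem_subgroupOf.2 hx) ⟨b, hb⟩
    exact Subgroup.mem_subgroupOf.1 this
  refine ⟨s i, ⟨N - i, fun j => s (i + j), by simp, by simp [show i + (N - i) = N by omega, hN], ?_⟩,
    hmono i hi.le, h1, b, hbX, hn b hb, ?_⟩
  · intro j hj
    exact hs (i + j) (by omega)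
  · intro x hx
    have := hn b⁻¹ (inv_mem hb) x hx
    simpa using this

theorem IsSubnormal.of_normal {H N : Subgroup Γ} (hH : IsSubnormal H) (hN : N ≤ H)
    (h : ∀ g ∈ H, ∀ x ∈ N, g * x * g⁻¹ ∈ N) : IsSubnormal N := by
  obtain ⟨k, s, h0, hk, hs⟩ := hH
  refine ⟨k + 1, fun i => match i with | 0 => N | i + 1 => s i, rfl, hk, ?_⟩
  intro i hi
  cases i with
  | zero =>
    simp only [h0]
    refine ⟨hN, ⟨fun x hx g => ?_⟩⟩
    exact h g (h0 ▸ g.2) x hx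
  | succ i => exact hs i (by omega)

theorem IsSubnormal.comap {Δ : Type*} [Group Δ] (f : Δ →* Γ) {H : Subgroup Γ}
    (hH : IsSubnormal H) : IsSubnormal (H.comap f) := by
  obtain ⟨k, s, h0, hk, hs⟩ := hH
  refine ⟨k, fun i => (s i).comap f, by simp [h0], by simp [hk], ?_⟩
  intro i hi
  refine ⟨Subgroup.comap_mono (hs i hi).1, ⟨fun x hx g => ?_⟩⟩
  have := (hs i hi).2.conj_mem ⟨f x, x.2⟩ hx ⟨f g, g.2⟩
  rw [Subgroup.mem_subgroupOf] at this ⊢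
  simpa using! this

end sub

section
variable {D : Type*} [DivisionRing D]

theorem wit_succ_mem {H : Subgroup Dˣ} {k : Dˣ} (hk : k ∈ H) {w : D} {g : Dˣ} (hg : (g : D) = w) :
    w * (k * w * (k:D)⁻¹)⁻¹ = ((g * k * g⁻¹ * k⁻¹ : Dˣ) : D) := by
  subst hg
  simp [mul_assoc]

theorem IsSubnormal.wit_mem {H : Subgroup Dˣ} (hH : IsSubnormal H) :
    ∃ n, ∀ m ≥ n, ∀ k ∈ H, ∀ a : D, a ≠ 0 → ∃ g ∈ H, (g : D) = wit (k : D) m a := by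
  obtain ⟨N, s, h0, hN, hs⟩ := hH
  have hmono : ∀ i ≤ N, H ≤ s i := by
    intro i
    induction i with
    | zero => intro _; rw [h0]
    | succ i ih => intro hi; exact (ih (by omega)).trans (hs i (by omega)).1
  have key : ∀ k ∈ H, ∀ a : D, a ≠ 0 → ∀ i ≤ N, ∃ g ∈ s (N - i), (g : D) = wit (k : D) i a := by
    intro k hk a ha i
    induction i with
    | zero => intro _; exact ⟨Units.mk0 a ha, by simp [hN], rfl⟩
    | succ i ih =>
      intro hi
      obtain ⟨g, hg, hgw⟩ := ih (by omega)
      refine ⟨g * k * g⁻¹ * k⁻¹, ?_, (wit_succ_mem hk hgw).symm⟩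
      have h1 := hs (N - (i+1)) (by omega)
      have e : N - (i + 1) + 1 = N - i := by omega
      have hk' := hmono (N - (i+1)) (by omega) hk
      refine mul_mem ?_ (inv_mem hk')
      have := h1.2.conj_mem ⟨k, h1.1 hk'⟩ (Subgroup.mem_subgroupOf.2 hk') ⟨g, by rw [e]; exact hg⟩
      exact Subgroup.mem_subgroupOf.1 this
  refine ⟨N, fun m hm k hk a ha => ?_⟩
  induction m, hm using Nat.le_induction with
  | base => have := key k hk a ha N le_rfl; rwa [Nat.sub_self, h0] at this
  | succ m hm ih =>
    obtain ⟨g, hg, hgw⟩ := ih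
    exact ⟨g * k * g⁻¹ * k⁻¹, mul_mem (mul_mem (mul_mem hg hk) (inv_mem hg)) (inv_mem hk),
      (wit_succ_mem hk hgw).symm⟩

theorem finite_submonoid_comm (p : ℕ) (hp : p.Prime) [CharP D p] (S : Submonoid D)
    (hS : (S : Set D).Finite) (x y : D) (hx : x ∈ S) (hy : y ∈ S) : x * y = y * x := by
  have := Fact.mk hp
  let _ : Algebra (ZMod p) D := ZMod.algebra D p
  let A := Algebra.adjoin (ZMod p) (S : Set D)
  have h1 : Subalgebra.toSubmodule A = Submodule.span (ZMod p) (S : Set D) := by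
    rw [Algebra.adjoin_eq_span, Submonoid.closure_eq]
  have h2 : Module.Finite (ZMod p) A := by
    have : Module.Finite (ZMod p) (Submodule.span (ZMod p) (S : Set D)) := Module.Finite.span_of_finite _ hS
    rw [← h1] at this
    exact this
  have h3 : Finite A := Module.finite_of_finite (ZMod p)
  have h4 : IsField A := Finite.isDomain_to_isField A
  have := h4.mul_comm ⟨x, Algebra.subset_adjoin hx⟩ ⟨y, Algebra.subset_adjoin hy⟩
  exact congrArg Subtype.val this

theorem Nrm.pow {L : Subfield D} {b : D} (h : Nrm L b) (i : ℕ) : Nrm L (b ^ i) := by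
  induction i with
  | zero => exact ⟨by simp, fun x hx => by simpa using hx⟩
  | succ i ih =>
    refine ⟨pow_ne_zero _ h.1, fun x hx => ⟨?_, ?_⟩⟩
    · have := (h.2 _ (ih.2 x hx).1).1
      rw [pow_succ']; simpa [mul_assoc] using this
    · have := (ih.2 _ (h.2 x hx).2).2
      rw [pow_succ']; simpa [mul_assoc] using this

theorem fix_fin (L : Subfield D) (hL : ∀ x ∈ L, ∀ y ∈ L, x * y = y * x) (b : D) (hb : Nrm L b)
    (m : ℕ) (hm : 1 ≤ m) (hbm : ∀ x ∈ L, b ^ m * x = x * b ^ m)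
    (hf : {x ∈ (L : Set D) | b * x = x * b}.Finite) : (L : Set D).Finite := by
  let _ : Field L := { (inferInstance : DivisionRing L) with mul_comm := fun x y => Subtype.ext (hL x x.2 y y.2) }
  let τ : L ≃+* L := hb.tau
  have hτ : ∀ (i : ℕ) (x : L), (((τ : RingAut L) ^ i) x : D) = b ^ i * x * (b ^ i)⁻¹ := by
    intro i
    induction i with
    | zero => intro x; simp
    | succ i ih =>
      intro x
      rw [pow_succ, RingAut.mul_apply, ih]
      show b ^ i * (b * x * b⁻¹) * (b ^ i)⁻¹ = _
      rw [pow_succ]; simp [mul_assoc]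
  have hτm : (τ : RingAut L) ^ m = 1 := by
    ext x
    rw [hτ, hbm x x.2, mul_assoc, mul_inv_cancel₀ (pow_ne_zero _ hb.1)]; simp
  let G := Subgroup.zpowers (τ : RingAut L)
  have hG : Finite G := by
    have : IsOfFinOrder (τ : RingAut L) := isOfFinOrder_iff_pow_eq_one.2 ⟨m, hm, hτm⟩
    exact (Set.finite_coe_iff.2 this.finite_zpowers)
  have hfix : Finite (FixedPoints.subfield G L) := by
    have := hf.to_subtype
    refine Finite.of_injective (β := {x ∈ (L : Set D) | b * x = x * b})
      (fun x => ⟨x.1.1, x.1.2, ?_⟩) ?_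
    · have h1 := x.2 ⟨τ, Subgroup.mem_zpowers _⟩
      have h2 : b * x.1.1 * b⁻¹ = x.1.1 := congrArg Subtype.val h1
      rw [← h2]; simp [mul_assoc, hb.1]
      have h3 : b * (x.1.1 * b⁻¹) = x.1.1 := by rw [← mul_assoc]; exact h2
      rw [h3]
    · intro x y h
      apply Subtype.ext; apply Subtype.ext
      simpa using h
  have : FiniteDimensional (FixedPoints.subfield G L) L := inferInstance
  have h3 : Finite L := Module.finite_of_finite (FixedPoints.subfield G L)
  exact Set.toFinite _

theorem dedekind {ι Y : Type*} (L : Subfield D) (v : ι → D) (hv : ∀ i, v i ≠ 0)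
    (φ : Y → D →+ D) (hφ : ∀ y, ∀ l ∈ L, ∀ x, φ y (l * x) = l * φ y x)
    (w : ι → Y → D) (hw : ∀ i y, w i y ∈ L) (hwc : ∀ i y, ∀ l ∈ L, l * w i y = w i y * l)
    (hev : ∀ i y, φ y (v i) = w i y * v i) (s : Finset ι)
    (hd : ∀ i ∈ s, ∀ j ∈ s, i ≠ j → ∃ y, w i y ≠ w j y)
    (l : ι → D) (hl : ∀ i ∈ s, l i ∈ L)
    (h0 : ∑ i ∈ s, l i * v i = 0) : ∀ i ∈ s, l i = 0 := by
  classical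
  induction s using Finset.induction_on generalizing l with
  | empty => simp
  | insert j s hj ih =>
    have key : ∀ i ∈ s, l i = 0 := by
      intro i hi
      obtain ⟨y, hy⟩ := hd i (Finset.mem_insert_of_mem hi) j (Finset.mem_insert_self _ _)
        (by rintro rfl; exact hj hi)
      have e1 : ∑ i ∈ s, (l i * (w i y - w j y)) * v i = 0 := by
        have h1 := congrArg (φ y) h0
        rw [map_sum, map_zero] at h1
        have h2 : ∑ i ∈ insert j s, w j y * (l i * v i) = 0 := by rw [← Finset.mul_sum, h0, mul_zero]
        have h3 := congrArg₂ (· - ·) h1 h2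
        simp only [sub_zero] at h3
        rw [← Finset.sum_sub_distrib, Finset.sum_insert hj] at h3
        have h4 : ∀ i ∈ insert j s, φ y (l i * v i) - w j y * (l i * v i) =
            (l i * (w i y - w j y)) * v i := by
          intro i hi
          rw [hφ y _ (hl i hi), hev, ← mul_assoc (w j y), ← hwc j y _ (hl i hi)]
          simp only [mul_sub, sub_mul, mul_assoc]
        rw [h4 j (Finset.mem_insert_self _ _), sub_self, mul_zero, zero_mul, zero_add] at h3
        rw [← h3]
        exact Finset.sum_congr rfl fun i hi => (h4 i (Finset.mem_insert_of_mem hi)).symm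
      have e2 := ih (fun i hi j hj => hd i (Finset.mem_insert_of_mem hi) j (Finset.mem_insert_of_mem hj))
        (fun i => l i * (w i y - w j y))
        (fun i hi => L.mul_mem (hl i (Finset.mem_insert_of_mem hi)) (L.sub_mem (hw _ _) (hw _ _))) e1 i hi
      rcases mul_eq_zero.1 e2 with h | h
      · exact h
      · exact absurd (sub_eq_zero.1 h) hy
    intro i hi
    rcases Finset.mem_insert.1 hi with rfl | hi
    · rw [Finset.sum_insert hj, Finset.sum_eq_zero (fun i hi => by rw [key i hi, zero_mul]), add_zero] at h0
      exact (mul_eq_zero.1 h0).resolve_right (hv i)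
    · exact key i hi

theorem ind_of (L : Subfield D) (b : D) (hb : b ≠ 0) (P : Set D) (hPL : P ⊆ L)
    (hPc : ∀ y ∈ P, ∀ l ∈ L, l * y = y * l) (hPb : ∀ y ∈ P, b * y * b⁻¹ ∈ P)
    (hm : ∀ m, 1 ≤ m → ∃ y ∈ P, b ^ m * y ≠ y * b ^ m) : Ind L b := by
  have hPi : ∀ (i : ℕ), ∀ y ∈ P, b ^ i * y * (b ^ i)⁻¹ ∈ P := by
    intro i
    induction i with
    | zero => intro y hy; simpa using hy
    | succ i ih =>
      intro y hy
      have := hPb _ (ih y hy)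
      rw [pow_succ']; simpa [mul_assoc] using this
  intro p hp
  rw [eval₂_eq_sum_range] at hp
  have := dedekind (ι := ℕ) (Y := P) L (fun i => b ^ i) (fun i => pow_ne_zero _ hb)
    (fun y => AddMonoidHom.mulRight (y : D)) (fun y l hl x => by simp [mul_assoc])
    (fun i y => b ^ i * y * (b ^ i)⁻¹) (fun i y => hPL (hPi i y y.2)) (fun i y l hl => hPc _ (hPi i y y.2) l hl)
    (fun i y => by
      show b ^ i * y = _
      rw [mul_assoc _ _ (b ^ i), inv_mul_cancel₀ (pow_ne_zero _ hb), mul_one])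
    (Finset.range (p.natDegree + 1)) ?_ (fun i => p.coeff i) (fun i _ => (p.coeff i).2) hp
  · ext i
    by_cases hi : i < p.natDegree + 1
    · simpa using this i (Finset.mem_range.2 hi)
    · rw [coeff_eq_zero_of_natDegree_lt (by omega)]; simp
  · have main : ∀ i j : ℕ, i < j → ∃ y : P, b ^ i * (y : D) * (b ^ i)⁻¹ ≠ b ^ j * y * (b ^ j)⁻¹ := by
      intro i j hij
      obtain ⟨y, hy, hne⟩ := hm (j - i) (by omega)
      refine ⟨⟨y, hy⟩, fun h => hne ?_⟩
      obtain ⟨d, rfl⟩ : ∃ d, j = i + d := ⟨j - i, by omega⟩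
      simp only [Nat.add_sub_cancel_left] at hne ⊢
      have hbi : b ^ i ≠ 0 := pow_ne_zero _ hb
      have hbd : b ^ d ≠ 0 := pow_ne_zero _ hb
      simp only [pow_add, mul_inv_rev, mul_assoc] at h
      have h1 := mul_left_cancel₀ hbi h
      have h2 : y = b ^ d * y * (b ^ d)⁻¹ := by
        have h3 := congrArg (· * b ^ i) h1
        simpa [mul_assoc, hbi] using h3
      conv_rhs => rw [h2]
      rw [mul_assoc _ _ (b ^ d), inv_mul_cancel₀ hbd, mul_one]
    intro i _ j _ hij
    rcases lt_or_gt_of_ne hij with h | h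
    · exact main i j h
    · obtain ⟨y, hy⟩ := main j i h
      exact ⟨y, hy.symm⟩

end

set_option linter.unusedSectionVars false
open Polynomial

section
variable {D : Type*} [DivisionRing D]

theorem closure_comm1 {S : Set D} {x : D} (h : ∀ s ∈ S, s * x = x * s) :
    ∀ y ∈ Subfield.closure S, y * x = x * y := by
  have : Subfield.closure S ≤ cen {x} := Subfield.closure_le.2 (fun s hs t ht => by
    rw [Set.mem_singleton_iff.1 ht]; exact (h s hs).symm)
  intro y hy
  exact ((mem_cen.1 (this hy)) x rfl).symm

theorem closure_comm {S : Set D} (h : ∀ s ∈ S, ∀ t ∈ S, s * t = t * s) :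
    ∀ x ∈ Subfield.closure S, ∀ y ∈ Subfield.closure S, x * y = y * x := by
  intro x hx y hy
  refine closure_comm1 (fun s hs => ?_) x hx
  exact (closure_comm1 (fun t ht => h t ht s hs) y hy).symm

/-- conjugation -/
def cj (b : D) (hb : b ≠ 0) : D →+* D where
  toFun x := b * x * b⁻¹
  map_one' := by simp [hb]
  map_mul' x y := by simp [mul_assoc, hb]
  map_zero' := by simp
  map_add' x y := by rw [mul_add, add_mul]

theorem closure_cj {S : Set D} {b : D} (hb : b ≠ 0) (K : Subfield D) (h : ∀ s ∈ S, b * s * b⁻¹ ∈ K) :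
    ∀ x ∈ Subfield.closure S, b * x * b⁻¹ ∈ K := by
  have : Subfield.closure S ≤ K.comap (cj b hb) := Subfield.closure_le.2 h
  exact fun x hx => this hx

theorem closure_nrm {S : Set D} {b : D} (hb : b ≠ 0)
    (h : ∀ s ∈ S, b * s * b⁻¹ ∈ Subfield.closure S) (h' : ∀ s ∈ S, b⁻¹ * s * b ∈ Subfield.closure S) :
    Nrm (Subfield.closure S) b :=
  ⟨hb, fun x hx => ⟨closure_cj hb _ h x hx, by
    have := closure_cj (inv_ne_zero hb) (Subfield.closure S) (fun s hs => by simpa using h' s hs) x hx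
    simpa using this⟩⟩

theorem del_sub (k : D) (n : ℕ) (a b : D) : del k n (a - b) = del k n a - del k n b := by
  induction n with
  | zero => rfl
  | succ n ih => simp only [del, ih]; noncomm_ring

theorem del_conj (k : D) (hk : k ≠ 0) (n : ℕ) (a : D) : del k n (k * a * k⁻¹) = k * del k n a * k⁻¹ := by
  induction n with
  | zero => rfl
  | succ n ih => simp only [del, ih]; noncomm_ring

theorem del_succ' (k : D) (hk : k ≠ 0) (n : ℕ) (a : D) : del k (n+1) a = del k n (a - k * a * k⁻¹) := by
  rw [del_sub, del_conj k hk]; rfl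

theorem del_eig (k b c : D) (hck : c * k = k * c) (h : k * b * k⁻¹ = c * b) (n : ℕ) :
    del k n b = (1 - c) ^ n * b := by
  induction n with
  | zero => simp [del]
  | succ n ih =>
    have h1 : Commute k ((1 - c)^n) := by
      apply Commute.pow_right
      apply Commute.sub_right (Commute.one_right _) hck.symm
    have : k * ((1 - c)^n * b) * k⁻¹ = (1-c)^n * (c * b) := by
      rw [← mul_assoc, h1.eq, mul_assoc, mul_assoc, ← mul_assoc k, h]
    rw [del, ih, this, pow_succ]
    noncomm_ring

theorem del_mul (k : D) (e v : D) (hv : k * v = v * k) (hk : k ≠ 0) (n : ℕ) :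
    del k n (e * v) = del k n e * v := by
  induction n with
  | zero => rfl
  | succ n ih =>
    have : v * k⁻¹ = k⁻¹ * v := (Commute.inv_right₀ (show Commute v k from hv.symm))
    rw [del, del, ih, sub_mul]
    congr 1
    simp only [mul_assoc, this]

theorem del_mem {K : Subfield D} {k : D} (hk : k ∈ K) (n : ℕ) {a : D} (ha : a ∈ K) : del k n a ∈ K := by
  induction n with
  | zero => exact ha
  | succ n ih => exact sub_mem ih (mul_mem (mul_mem hk ih) (inv_mem hk))

theorem del_memb {K : Subfield D} {k b : D} (hb : Nrm K b) (hk : k ∈ K) (n : ℕ) {e : D} (he : e ∈ K) :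
    ∃ e' ∈ K, del k n (e * b) = e' * b := by
  induction n with
  | zero => exact ⟨e, he, rfl⟩
  | succ n ih =>
    obtain ⟨e', he', h⟩ := ih
    refine ⟨e' - k * e' * (b * k⁻¹ * b⁻¹), sub_mem he' (mul_mem (mul_mem hk he')
      (hb.2 _ (inv_mem hk)).1), ?_⟩
    rw [del, h, sub_mul]
    simp [mul_assoc, hb.1]

theorem unip [CharZero D] (k : D) (m : ℕ) (hm : 1 ≤ m) (hkm : k ^ m = 1) (n : ℕ) (a : D)
    (h : del k n a = 0) : k * a = a * k := by
  have hk : k ≠ 0 := by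
    rintro rfl
    rw [zero_pow (by omega)] at hkm
    exact zero_ne_one hkm
  have main : ∀ a, del k 2 a = 0 → del k 1 a = 0 := by
    intro a h
    simp only [del] at h ⊢
    set d := a - k * a * k⁻¹ with hd
    have hfix : k * d * k⁻¹ = d := (sub_eq_zero.1 h).symm
    have : ∀ i : ℕ, k ^ i * a * (k ^ i)⁻¹ = a - i * d := by
      intro i
      induction i with
      | zero => simp
      | succ i ih =>
        have e : k ^ (i+1) * a * (k ^ (i+1))⁻¹ = k * (k ^ i * a * (k ^ i)⁻¹) * k⁻¹ := by
          rw [pow_succ']; simp [mul_assoc]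
        rw [e, ih, mul_sub, sub_mul]
        have e2 : k * ((i:D) * d) * k⁻¹ = i * d := by
          rw [← mul_assoc, ← (Nat.cast_commute i k).eq, mul_assoc, mul_assoc, ← mul_assoc k, hfix]
        have e3 : k * a * k⁻¹ = a - d := by rw [hd]; abel
        rw [e2, e3]; push_cast; rw [add_mul, one_mul]; abel
    have h2 := this m
    rw [hkm] at h2
    have h3 : (m : D) * d = 0 := by
      have : a = a - m * d := by simpa using h2
      exact (sub_eq_self.1 this.symm)
    rcases mul_eq_zero.1 h3 with h4 | h4
    · exact absurd (Nat.cast_eq_zero.1 h4) (by omega)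
    · exact h4
  have : ∀ n a, del k n a = 0 → del k 1 a = 0 := by
    intro n
    induction n with
    | zero => intro a h; simp only [del] at h ⊢; simp [h]
    | succ n ih =>
      intro a h
      rw [del_succ' k hk] at h
      have := ih _ h
      rw [← del_succ' k hk] at this
      exact main a this
  have h1 := this n a h
  simp only [del] at h1
  have := sub_eq_zero.1 h1
  rw [eq_mul_inv_iff_mul_eq₀ hk] at this
  exact this.symm

theorem keyEnd {K : Subfield D} {b k : D} (hb : Nrm K b) (hk : k ∈ K) (hk0 : k ≠ 0) (n : ℕ)
    (H : ∀ e ∈ K, del k n (e * b) = 0) (e : D) (he : e ∈ K) (hs : ∀ s, del k s e ≠ 0) : False := by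
  have hex : ∃ j, del k j b = 0 := ⟨n, by simpa using H 1 (one_mem _)⟩
  classical
  have hj := Nat.find_spec hex
  have hmin := fun m hm => Nat.find_min hex (m := m) hm
  set j := Nat.find hex with hjdef
  clear_value j
  cases j with
  | zero => exact hb.1 hj
  | succ j =>
    have hv0 : del k j b ≠ 0 := hmin j (by omega)
    obtain ⟨e0, he0, h0⟩ := del_memb hb hk j (one_mem K)
    rw [one_mul] at h0
    set v := del k j b with hv
    have hkv : k * v = v * k := by
      have : v - k * v * k⁻¹ = 0 := hj
      have := sub_eq_zero.1 this
      rw [eq_mul_inv_iff_mul_eq₀ hk0] at this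
      exact this.symm
    have h1 := H (e * e0) (mul_mem he he0)
    rw [mul_assoc, ← h0, del_mul k e v hkv hk0] at h1
    rcases mul_eq_zero.1 h1 with h | h
    · exact hs n h
    · exact hv0 h

theorem key {K : Subfield D} {b k : D} (hb : Nrm K b) (hbK : b ∉ K) (hk : k ∈ K) (hk0 : k ≠ 0) (n : ℕ)
    (T : Set D) (hT : T.Infinite) (hTK : T ⊆ K) (hTc : ∀ t ∈ T, ∀ x ∈ K, t * x = x * t)
    (hTb : ∀ t ∈ T, t * b = b * t) (H : ∀ a : D, a ≠ 0 → wit k n a ∈ K)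
    (e : D) (he : e ∈ K) (hs : ∀ s, del k s e ≠ 0) : False := by
  refine keyEnd hb hk hk0 n (fun e he => ?_) e he hs
  have h1 := Plem T hT (fun s hs t ht => hTc s hs t (hTK ht)) K hTK k hk0 (e * b)
    (fun t ht => hTc t ht k hk) (fun t ht => by rw [← mul_assoc, hTc t ht e he, mul_assoc, hTb t ht, mul_assoc])
    n (fun t ht h => H _ h)
  obtain ⟨e', he', h2⟩ := del_memb hb hk n he
  rw [h2] at h1 ⊢
  by_cases h0 : e' = 0
  · simp [h0]
  · exfalso
    apply hbK
    have := mul_mem (inv_mem he') h1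
    rwa [inv_mul_cancel_left₀ h0] at this

end

set_option linter.unusedSectionVars false
set_option linter.unusedVariables false
open Polynomial

section grp
open scoped commutatorElement
variable {Γ : Type*} [Group Γ]

/-- derived series of a subgroup, inside the big group -/
def ds (H : Subgroup Γ) : ℕ → Subgroup Γ
  | 0 => H
  | n + 1 => ⁅ds H n, ds H n⁆

theorem ds_succ' (H : Subgroup Γ) (n : ℕ) : ds ⁅H, H⁆ n = ds H (n+1) := by
  induction n with
  | zero => rfl
  | succ n ih => rw [ds, ih]; rfl

theorem comm_le_self (H : Subgroup Γ) : ⁅H, H⁆ ≤ H :=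
  Subgroup.commutator_le.2 fun a ha b hb => by
    rw [commutatorElement_def]
    exact mul_mem (mul_mem (mul_mem ha hb) (inv_mem ha)) (inv_mem hb)

theorem ds_le (H : Subgroup Γ) (n : ℕ) : ds H n ≤ H := by
  induction n with
  | zero => exact le_rfl
  | succ n ih => exact (comm_le_self _).trans ih

theorem comm_conj {H : Subgroup Γ} {g : Γ} (h : ∀ x ∈ H, g * x * g⁻¹ ∈ H) :
    ∀ x ∈ ⁅H, H⁆, g * x * g⁻¹ ∈ ⁅H, H⁆ := by
  have : ⁅H, H⁆ ≤ ⁅H, H⁆.comap (MulAut.conj g).toMonoidHom := by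
    refine Subgroup.commutator_le.2 fun a ha b hb => ?_
    rw [Subgroup.mem_comap, map_commutatorElement]
    exact Subgroup.commutator_mem_commutator (h a ha) (h b hb)
  exact fun x hx => this hx

theorem ds_conj {H : Subgroup Γ} {g : Γ} (h : ∀ x ∈ H, g * x * g⁻¹ ∈ H) (n : ℕ) :
    ∀ x ∈ ds H n, g * x * g⁻¹ ∈ ds H n := by
  induction n with
  | zero => exact h
  | succ n ih => exact comm_conj ih

theorem ds_bot {H : Subgroup Γ} (hs : IsSolvable H) : ∃ n, ds H n = ⊥ := by
  obtain ⟨n, hn⟩ := hs.solvable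
  refine ⟨n, ?_⟩
  have : ∀ n, (derivedSeries H n).map H.subtype = ds H n := by
    intro n
    induction n with
    | zero => rw [derivedSeries_zero, ← MonoidHom.range_eq_map, Subgroup.range_subtype]; rfl
    | succ n ih => rw [derivedSeries_succ, Subgroup.map_commutator, ih]; rfl
  rw [← this n, hn, Subgroup.map_bot]

theorem comm_bot_of {H : Subgroup Γ} (h : ∀ x ∈ H, ∀ y ∈ H, x * y = y * x) : ⁅H, H⁆ = ⊥ := by
  rw [eq_bot_iff]
  refine Subgroup.commutator_le.2 fun a ha b hb => ?_
  rw [Subgroup.mem_bot, commutatorElement_eq_one_iff_mul_comm]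
  exact h a ha b hb

/-- solvable-by-finite -/
def SBF (H : Subgroup Γ) : Prop := ∃ N ≤ H, (∀ g ∈ H, ∀ x ∈ N, g * x * g⁻¹ ∈ N) ∧
  IsSolvable N ∧ N.relIndex H ≠ 0

theorem SBF.pull {Δ : Type*} [Group Δ] {M : Subgroup Γ} (hM : SBF M) (f : Δ →* Γ)
    (hf : Function.Injective f) (H : Subgroup Δ) (hH : ∀ x ∈ H, f x ∈ M) : SBF H := by
  obtain ⟨N, hNM, hn, hs, hi⟩ := hM
  refine ⟨N.comap f ⊓ H, inf_le_right, ?_, ?_, ?_⟩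
  · rintro g hg x ⟨hx, hxH⟩
    refine ⟨?_, H.mul_mem (H.mul_mem hg hxH) (H.inv_mem hg)⟩
    show f _ ∈ N
    rw [map_mul, map_mul, map_inv]
    exact hn _ (hH g hg) _ hx
  · let φ : ↥(N.comap f ⊓ H) →* N := (f.comp (N.comap f ⊓ H).subtype).codRestrict N (fun x => x.2.1)
    have hs' : Group.IsSolvable N := hs
    show Group.IsSolvable _
    apply Group.isSolvable_of_isSolvable_injective (f := φ)
    intro x y hxy
    have : f x = f y := congrArg Subtype.val hxy
    exact Subtype.ext (hf this)
  · rw [Subgroup.inf_relIndex_right, Subgroup.relIndex_comap]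
    intro h0
    exact hi (Subgroup.relIndex_eq_zero_of_le_right (Subgroup.map_le_iff_le_comap.2 hH) h0)

theorem schur {H N : Subgroup Γ} (hN : N ≤ H) (hc : ∀ x ∈ N, ∀ y ∈ H, x * y = y * x)
    (hi : N.relIndex H ≠ 0) : ((⁅H, H⁆ : Subgroup Γ) : Set Γ).Finite := by
  have hfi : (N.subgroupOf H).FiniteIndex := ⟨hi⟩
  have hfin : Finite (H ⧸ N.subgroupOf H) := inferInstance
  have : Finite (commutatorSet H) := by
    let g : (H ⧸ N.subgroupOf H) × (H ⧸ N.subgroupOf H) → H := fun p => ⁅p.1.out, p.2.out⁆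
    refine (Set.finite_range g).subset ?_
    rintro _ ⟨a, b, rfl⟩
    refine ⟨(↑a, ↑b), ?_⟩
    obtain ⟨z, hz⟩ := QuotientGroup.mk_out_eq_mul (N.subgroupOf H) a
    obtain ⟨w, hw⟩ := QuotientGroup.mk_out_eq_mul (N.subgroupOf H) b
    have hz' : ∀ y : H, z.1 * y = y * z.1 := fun y => Subtype.ext (hc _ z.2 y y.2)
    have hw' : ∀ y : H, w.1 * y = y * w.1 := fun y => Subtype.ext (hc _ w.2 y y.2)
    show ⁅(a : H ⧸ N.subgroupOf H).out, (b : H ⧸ N.subgroupOf H).out⁆ = ⁅a, b⁆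
    rw [hz, hw, commutatorElement_def, commutatorElement_def]
    have e1 : a * z.1 * (b * w.1) * (a * z.1)⁻¹ * (b * w.1)⁻¹
      = a * (z.1 * b) * (w.1 * z.1⁻¹) * a⁻¹ * w.1⁻¹ * b⁻¹ := by group
    rw [e1, hz', hw']
    have e2 : a * (b * z.1) * (z.1⁻¹ * w.1) * a⁻¹ * w.1⁻¹ * b⁻¹
      = a * b * (w.1 * a⁻¹) * w.1⁻¹ * b⁻¹ := by group
    rw [e2, hw']; group
  have h2 : Finite (commutator H) := inferInstance
  have h3 : (commutator H).map H.subtype = ⁅H, H⁆ := by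
    rw [commutator_def, Subgroup.map_commutator, ← MonoidHom.range_eq_map, Subgroup.range_subtype]
  rw [← h3, Subgroup.coe_map]
  exact (Set.toFinite _).image _

end grp

section
variable {D : Type*} [DivisionRing D]

theorem char_of_finite (L : Subfield D) (hL : (L : Set D).Finite) : ∃ p, p.Prime ∧ CharP D p := by
  obtain ⟨p, hp⟩ := CharP.exists D
  rcases CharP.char_is_prime_or_zero D p with h | h
  · exact ⟨p, h, hp⟩
  · subst h
    have := CharP.charP_to_charZero D
    exfalso
    refine (Set.infinite_range_of_injective (Nat.cast_injective (R := D))).mono ?_ hL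
    rintro _ ⟨n, rfl⟩
    exact natCast_mem L n

theorem finite_subgroup_comm (p : ℕ) (hp : p.Prime) [CharP D p] (S : Subgroup Dˣ)
    (hS : (S : Set Dˣ).Finite) (x y : Dˣ) (hx : x ∈ S) (hy : y ∈ S) : x * y = y * x := by
  have := finite_submonoid_comm p hp (S.toSubmonoid.map (Units.coeHom D))
    (by rw [Submonoid.coe_map]; exact hS.image _) x y ⟨x, hx, rfl⟩ ⟨y, hy, rfl⟩
  exact Units.ext this

theorem finite_pow_of {b : D} {N : ℕ} (hN : 1 ≤ N) (h : b ^ N = 1) :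
    (Submonoid.powers b : Set D).Finite :=
  (isOfFinOrder_iff_pow_eq_one.2 ⟨N, hN, h⟩).finite_powers

theorem wit_one {k w : D} (hw : w ≠ 0) (hk : k ≠ 0) (h : k * w = w * k) : w * (k * w * k⁻¹)⁻¹ = 1 := by
  rw [h, mul_assoc, mul_inv_cancel₀ hk, mul_one, mul_inv_cancel₀ hw]

theorem finR (F : Subfield D) (hF : (F : Set D).Finite) : ∃ r ≥ 1, ∀ f ∈ F, f ≠ 0 → f ^ r = 1 := by
  have : Finite F := hF
  refine ⟨Nat.card Fˣ, Nat.card_pos, fun f hf h0 => ?_⟩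
  have := pow_card_eq_one' (x := (Units.mk0 (⟨f, hf⟩ : F) (by simpa [Subtype.ext_iff] using h0)))
  have := congrArg (fun u : Fˣ => ((u : F) : D)) this
  simpa only [Units.val_pow_eq_pow_val, SubmonoidClass.coe_pow, Units.val_mk0, Units.val_one, OneMemClass.coe_one] using this

theorem finQ (F : Subfield D) (hF : (F : Set D).Finite) (hFc : ∀ f ∈ F, ∀ x, f * x = x * f)
    (u k c : D) (hu0 : u ≠ 0) (hk0 : k ≠ 0) (hc : c ∈ F) (r : ℕ) (hr : 1 ≤ r) (hu : u ^ r ∈ F) (hk : k ^ r ∈ F)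
    (h : k * u = c * (u * k)) : k * u = u * k := by
  obtain ⟨p, hp, hcp⟩ := char_of_finite F hF
  obtain ⟨q, hq, hFq⟩ := finR F hF
  have hfu : (Submonoid.powers u : Set D).Finite := finite_pow_of (N := r * q) (by nlinarith)
    (by rw [pow_mul]; exact hFq _ hu (pow_ne_zero _ hu0))
  have hfk : (Submonoid.powers k : Set D).Finite := finite_pow_of (N := r * q) (by nlinarith)
    (by rw [pow_mul]; exact hFq _ hk (pow_ne_zero _ hk0))
  have h1 : ∀ j, ∃ f ∈ F, k ^ j * u = f * (u * k ^ j) := by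
    intro j
    induction j with
    | zero => exact ⟨1, one_mem _, by simp⟩
    | succ j ih =>
      obtain ⟨f, hf, e⟩ := ih
      refine ⟨f * c, mul_mem hf hc, ?_⟩
      rw [pow_succ', mul_assoc, e, ← mul_assoc, ← hFc f hf, mul_assoc, ← mul_assoc k u, h]
      simp only [mul_assoc]
  have h2 : ∀ j i, ∃ f ∈ F, k ^ j * u ^ i = f * (u ^ i * k ^ j) := by
    intro j i
    induction i with
    | zero => exact ⟨1, one_mem _, by simp⟩
    | succ i ih =>
      obtain ⟨f, hf, e⟩ := ih
      obtain ⟨g, hg, e'⟩ := h1 j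
      refine ⟨f * g, mul_mem hf hg, ?_⟩
      rw [pow_succ, ← mul_assoc, e, mul_assoc, mul_assoc, e', ← mul_assoc _ g, ← hFc g hg]
      simp only [mul_assoc]
  let S : Submonoid D :=
    { carrier := {x | ∃ f ∈ F, ∃ i j : ℕ, x = f * (u ^ i * k ^ j)}
      one_mem' := ⟨1, one_mem _, 0, 0, by simp⟩
      mul_mem' := by
        rintro _ _ ⟨f, hf, i, j, rfl⟩ ⟨g, hg, i', j', rfl⟩
        obtain ⟨e, he, hh⟩ := h2 j i'
        refine ⟨f * g * e, mul_mem (mul_mem hf hg) he, i + i', j + j', ?_⟩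
        calc f * (u ^ i * k ^ j) * (g * (u ^ i' * k ^ j'))
            = f * (u ^ i * k ^ j * g) * (u ^ i' * k ^ j') := by simp only [mul_assoc]
          _ = f * g * (u ^ i * (k ^ j * u ^ i') * k ^ j') := by
              rw [← hFc g hg]; simp only [mul_assoc]
          _ = f * g * ((u ^ i * e) * u ^ i' * k ^ j * k ^ j') := by rw [hh]; simp only [mul_assoc]
          _ = _ := by rw [← hFc e he, pow_add, pow_add]; simp only [mul_assoc] }
  refine finite_submonoid_comm p hp S ?_ k u ⟨1, one_mem _, 0, 1, by simp⟩ ⟨1, one_mem _, 1, 0, by simp⟩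
  refine (hF.image2 (fun f x => f * x) (hfu.image2 (fun x y => x * y) hfk)).subset ?_
  rintro _ ⟨f, hf, i, j, rfl⟩
  exact ⟨f, hf, _, ⟨u ^ i, ⟨i, rfl⟩, k ^ j, ⟨j, rfl⟩, rfl⟩, rfl⟩

end

set_option linter.unusedSectionVars false
set_option linter.unusedVariables false
open Polynomial

section
variable {D : Type*} [DivisionRing D]

theorem T2a {H : Subgroup Dˣ} (hH : IsSubnormal H) (k : Dˣ) (hk : k ∈ H) (hc : ∀ x ∈ H, k * x = x * k) :
    ∀ a : D, (k:D) * a = a * k := by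
  by_contra! hcon
  obtain ⟨a0, ha0⟩ := hcon
  have ha00 : a0 ≠ 0 := by rintro rfl; simp at ha0
  have hX : H ≤ Subgroup.centralizer {k} := fun x hx => by
    rw [Subgroup.mem_centralizer_singleton_iff]; exact (hc x hx).symm
  have hT : Subgroup.centralizer {k} ≠ ⊤ := by
    intro h
    have : Units.mk0 a0 ha00 ∈ Subgroup.centralizer {k} := by rw [h]; trivial
    rw [Subgroup.mem_centralizer_singleton_iff] at this
    exact ha0 (congrArg Units.val this).symm
  obtain ⟨S, hS, hHS, hSX, b, hbX, hb1, hb2⟩ := hH.exists_step _ hX hT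
  rw [Subgroup.mem_centralizer_singleton_iff] at hbX
  have hkS : ∀ x ∈ S, k * x = x * k := fun x hx => by
    have := hSX hx
    rw [Subgroup.mem_centralizer_singleton_iff] at this
    exact this.symm
  let A : Set D := {x | ∃ u ∈ S, (u : D) = x ∧ ∀ v ∈ S, u * v = v * u}
  let L := Subfield.closure A
  have hkA : (k : D) ∈ A := ⟨k, hHS hk, rfl, hkS⟩
  have hA : ∀ s ∈ A, ∀ t ∈ A, s * t = t * s := by
    rintro _ ⟨u, hu, rfl, hu'⟩ _ ⟨v, hv, rfl, hv'⟩
    exact congrArg Units.val (hu' v hv)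
  have hL : ∀ x ∈ L, ∀ y ∈ L, x * y = y * x := closure_comm hA
  have hb0 : (b:D) ≠ 0 := b.ne_zero
  have cjA : ∀ (g : Dˣ), (∀ x ∈ S, g * x * g⁻¹ ∈ S) → (∀ x ∈ S, g⁻¹ * x * g ∈ S) →
      ∀ s ∈ A, (g:D) * s * (g:D)⁻¹ ∈ A := by
    rintro g h1 h2 _ ⟨u, hu, rfl, hu'⟩
    refine ⟨g * u * g⁻¹, h1 u hu, by simp, fun v hv => ?_⟩
    have := hu' _ (h2 v hv)
    calc g * u * g⁻¹ * v = g * (u * (g⁻¹ * v * g)) * g⁻¹ := by group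
      _ = _ := by rw [this]; group
  have hNrm : Nrm L (b:D) := by
    refine closure_nrm hb0 (fun s hs => Subfield.subset_closure (cjA b hb1 hb2 s hs)) (fun s hs => Subfield.subset_closure ?_)
    have := cjA b⁻¹ (fun x hx => by simpa using hb2 x hx) (fun x hx => by simpa using hb1 x hx) s hs
    simpa using this
  have hkL : (k:D) ∈ L := Subfield.subset_closure hkA
  obtain ⟨n, hn⟩ := hS.wit_mem
  have hw : ∀ a : D, a ≠ 0 → wit (k:D) (n+1) a = 1 := by
    intro a ha
    obtain ⟨g, hg, e⟩ := hn n le_rfl k (hHS hk) a ha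
    have : wit (k:D) (n+1) a = wit (k:D) n a * (k * wit (k:D) n a * (k:D)⁻¹)⁻¹ := rfl
    rw [this, ← e]
    exact wit_one g.ne_zero k.ne_zero (congrArg Units.val (hkS g hg))
  set c : D := k * b * (k:D)⁻¹ * (b:D)⁻¹ with hcdef
  have hcL : c ∈ L := by
    have := mul_mem hkL (hNrm.2 _ (inv_mem hkL)).1
    rw [hcdef]; simpa [mul_assoc] using this
  have hcb : (k:D) * b * (k:D)⁻¹ = c * b := by simp [hcdef]
  have hbk : (b:D) * k ≠ k * b := fun h => hbX (Units.ext h)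
  have hc1 : 1 - c ≠ 0 := by
    intro h
    rw [← (sub_eq_zero.1 h), one_mul, mul_inv_eq_iff_eq_mul₀ k.ne_zero] at hcb
    exact hbk hcb.symm
  have hdel : del (k:D) (n+1) b ≠ 0 := by
    rw [del_eig (k:D) b c (hL c hcL k hkL) hcb]
    exact mul_ne_zero (pow_ne_zero _ hc1) hb0
  have hb1' : (1:D) + b ≠ 0 := by
    intro h
    have : (b:D) = -1 := by rw [eq_neg_iff_add_eq_zero, add_comm]; exact h
    rw [this] at hbk; simp at hbk
  by_cases hm : ∀ m : ℕ, 1 ≤ m → ∃ y ∈ (L : Set D), (b:D) ^ m * y ≠ y * (b:D) ^ m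
  · have hi : Ind L (b:D) := ind_of L b hb0 L subset_rfl (fun y hy l hl => hL l hl y hy)
      (fun y hy => (hNrm.2 y hy).1) hm
    have := hNrm.del_zero hi k k.ne_zero hkL 1 (one_mem _) (n+1) (by
      rw [one_mul, hw _ hb1']; exact one_mem _)
    rw [one_mul] at this
    exact hdel this
  push Not at hm
  obtain ⟨m, hm1, hm⟩ := hm
  by_cases hT : {x ∈ (L : Set D) | (b:D) * x = x * b}.Infinite
  · exact hdel (P0 _ hT (fun s hs t ht => hL s hs.1 t ht.1) k k.ne_zero b 1 (fun t ht => hL t ht.1 k hkL)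
      (fun t ht => ht.2.symm) (n+1) (fun t ht h => hw _ h))
  have hLf := fix_fin L hL b hNrm m hm1 hm (Set.not_infinite.1 hT)
  obtain ⟨p, hp, hcp⟩ := char_of_finite L hLf
  by_cases hT : (Set.range (fun j : ℕ => (b:D) ^ (m * j))).Infinite
  · refine hdel (P0 _ hT ?_ k k.ne_zero b 1 ?_ ?_ (n+1) (fun t ht h => hw _ h))
    · rintro _ ⟨i, rfl⟩ _ ⟨j, rfl⟩
      simp only [← pow_add, add_comm]
    · rintro _ ⟨i, rfl⟩
      show (b:D) ^ (m * i) * k = k * (b:D) ^ (m * i)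
      rw [pow_mul]
      exact ((show Commute ((b:D)^m) k from hm k hkL).pow_left i).eq
    · rintro _ ⟨i, rfl⟩
      exact ((Commute.refl (b:D)).pow_left _).eq
  rw [Set.not_infinite] at hT
  have hni : ¬ Function.Injective (fun j : ℕ => (b:D) ^ (m * j)) := fun h =>
    Set.infinite_range_of_injective h hT
  have : ∃ N ≥ 1, (b:D) ^ N = 1 := by
    simp only [Function.Injective, not_forall] at hni
    obtain ⟨i, j, e, hij⟩ := hni
    have aux : ∀ i j : ℕ, i < j → (b:D) ^ (m * i) = (b:D) ^ (m * j) → ∃ N ≥ 1, (b:D) ^ N = 1 := by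
      intro i j h e
      refine ⟨m * (j - i), Nat.mul_pos hm1 (by omega), ?_⟩
      have : (b:D) ^ (m * i) * (b:D) ^ (m * (j - i)) = (b:D) ^ (m * i) := by
        rw [← pow_add, ← Nat.mul_add, Nat.add_sub_cancel' h.le, e]
      exact (mul_eq_left₀ (pow_ne_zero _ hb0)).1 this
    rcases lt_or_gt_of_ne hij with h | h
    · exact aux i j h e
    · exact aux j i h e.symm
  obtain ⟨N, hN, hbN⟩ := this
  have hpw := finite_pow_of hN hbN
  let S0 : Submonoid D :=
    { carrier := {x | ∃ l ∈ L, ∃ i : ℕ, x = l * (b:D) ^ i}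
      one_mem' := ⟨1, one_mem _, 0, by simp⟩
      mul_mem' := by
        rintro _ _ ⟨f, hf, i, rfl⟩ ⟨g, hg, j, rfl⟩
        refine ⟨f * ((b:D) ^ i * g * ((b:D)^i)⁻¹), mul_mem hf ((hNrm.pow i).2 g hg).1, i + j, ?_⟩
        rw [pow_add]; simp [mul_assoc] }
  refine hbk (finite_submonoid_comm p hp S0 ?_ b k ⟨1, one_mem _, 1, by simp⟩ ⟨k, hkL, 0, by simp⟩)
  refine (hLf.image2 (fun f x => f * x) hpw).subset ?_
  rintro _ ⟨f, hf, i, rfl⟩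
  exact ⟨f, hf, _, ⟨i, rfl⟩, rfl⟩

/-- the centre as a division subring -/
abbrev ctr (D : Type*) [DivisionRing D] : Subfield D := cen (Set.univ : Set D)

theorem mem_ctr {x : D} : x ∈ ctr D ↔ ∀ s, s * x = x * s := by simp [mem_cen]

theorem T2b (n : ℕ) : ∀ {H : Subgroup Dˣ} (hH : IsSubnormal H) (hn : ds H n = ⊥),
    ∀ k ∈ H, ∀ a : D, (k:D) * a = a * k := by
  induction n with
  | zero =>
    intro H hH hn k hk a
    have : k ∈ (⊥ : Subgroup Dˣ) := hn ▸ hk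
    rw [Subgroup.mem_bot] at this
    simp [this]
  | succ n ih =>
    intro H hH hn
    have hsub : IsSubnormal ⁅H, H⁆ := hH.of_normal (comm_le_self H) (fun g hg => comm_conj
      (fun x hx => mul_mem (mul_mem hg hx) (inv_mem hg)))
    have hcen := ih hsub (by rw [ds_succ']; exact hn)
    have hcm : ∀ x ∈ H, ∀ y ∈ H, x * y * x⁻¹ * y⁻¹ ∈ ⁅H, H⁆ := fun x hx y hy =>
      Subgroup.commutator_mem_commutator hx hy
    suffices ∀ k ∈ H, ∀ u ∈ H, k * u = u * k from fun k hk => T2a hH k hk (this k hk)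
    intro k hk u hu
    by_contra hne
    set c : D := ((k * u * k⁻¹ * u⁻¹ : Dˣ) : D) with hcdef
    have hcz : ∀ a, c * a = a * c := hcen _ (hcm k hk u hu)
    have hcF : c ∈ ctr D := mem_ctr.2 fun s => (hcz s).symm
    have hcb : (k:D) * u * (k:D)⁻¹ = c * u := by simp [hcdef]
    have hku : (k:D) * u ≠ u * k := fun h => hne (Units.ext h)
    have hc1 : 1 - c ≠ 0 := by
      intro h
      rw [← (sub_eq_zero.1 h), one_mul, mul_inv_eq_iff_eq_mul₀ k.ne_zero] at hcb
      exact hku hcb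
    by_cases hF : (ctr D : Set D).Infinite
    · obtain ⟨n, hn⟩ := hH.wit_mem
      have hw : ∀ a : D, a ≠ 0 → wit (k:D) (n+2) a = 1 := by
        intro a ha
        obtain ⟨g, hg, e⟩ := hn n le_rfl k hk a ha
        have h1 : wit (k:D) (n+1) a = wit (k:D) n a * (k * wit (k:D) n a * (k:D)⁻¹)⁻¹ := rfl
        rw [← e, wit_succ_mem (H := H) hk rfl] at h1
        have : wit (k:D) (n+2) a = wit (k:D) (n+1) a * (k * wit (k:D) (n+1) a * (k:D)⁻¹)⁻¹ := rfl
        rw [this, h1]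
        exact wit_one (Units.ne_zero _) k.ne_zero (hcen _ (hcm g hg k hk) _).symm
      have := P0 _ hF (fun s hs t ht => mem_ctr.1 ht s) k k.ne_zero u 1 (fun t ht => (mem_ctr.1 ht k).symm)
        (fun t ht => (mem_ctr.1 ht u).symm) (n+2) (fun t ht h => hw _ h)
      rw [del_eig (k:D) u c (hcz _) hcb] at this
      exact mul_ne_zero (pow_ne_zero _ hc1) u.ne_zero this
    · rw [Set.not_infinite] at hF
      obtain ⟨r, hr, hFr⟩ := finR (ctr D) hF
      have hpw : ∀ x ∈ H, ((x ^ r : Dˣ) : D) ∈ ctr D := by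
        intro x hx
        refine mem_ctr.2 fun s => ?_
        refine (T2a hH (x^r) (pow_mem hx r) (fun y hy => ?_) s).symm
        have hz := hcen _ (hcm x hx y hy)
        have h0 : ((x * y * x⁻¹ * y⁻¹ : Dˣ) : D) ^ r = 1 :=
          hFr _ (mem_ctr.2 fun s => (hz s).symm) (Units.ne_zero _)
        set z := x * y * x⁻¹ * y⁻¹ with hzdef
        have hzc : ∀ w : Dˣ, z * w = w * z := fun w => Units.ext (hz w)
        have hxy : x * y = z * (y * x) := by rw [hzdef]; group
        have : ∀ i : ℕ, x ^ i * y = z ^ i * (y * x ^ i) := by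
          intro i
          induction i with
          | zero => simp
          | succ i ih =>
            have hz2 : z ^ i * x = x * z ^ i := ((show Commute z x from hzc x).pow_left i).eq
            rw [pow_succ', mul_assoc, ih, ← mul_assoc, ← hz2, mul_assoc, ← mul_assoc x y, hxy, pow_succ]
            simp only [mul_assoc]
        rw [this r, show z ^ r = 1 from Units.ext (by rw [Units.val_pow_eq_pow_val, h0]; rfl), one_mul]
      refine hku (finQ (ctr D) hF (fun f hf x => (mem_ctr.1 hf x).symm) u k c u.ne_zero k.ne_zero hcF r hr
        (by simpa using hpw u hu) (by simpa using hpw k hk) ?_)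
      rw [← mul_assoc, ← hcb]; simp

theorem T2 {H : Subgroup Dˣ} (hH : IsSubnormal H) (hs : SBF H) : ∀ k ∈ H, ∀ a : D, (k:D) * a = a * k := by
  obtain ⟨N, hNH, hnorm, hsol, hi⟩ := hs
  obtain ⟨n0, hn0⟩ := ds_bot hsol
  have hNc := T2b n0 (hH.of_normal hNH hnorm) hn0
  have hfin := schur hNH (fun x hx y _ => Units.ext (hNc x hx y)) hi
  have hsub : IsSubnormal ⁅H, H⁆ := hH.of_normal (comm_le_self H) (fun g hg => comm_conj
      (fun x hx => mul_mem (mul_mem hg hx) (inv_mem hg)))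
  refine T2b 2 hH ?_
  show ⁅⁅H, H⁆, ⁅H, H⁆⁆ = ⊥
  obtain ⟨p, hp⟩ := CharP.exists D
  rcases CharP.char_is_prime_or_zero D p with h | h
  · exact comm_bot_of fun x hx y hy => finite_subgroup_comm p h _ hfin x y hx hy
  · subst h
    have := CharP.charP_to_charZero D
    refine comm_bot_of fun k hk y _ => ?_
    by_contra hne
    set a : D := (y : D) with ha
    have hka : (k:D) * a ≠ a * k := fun h => hne (Units.ext h)
    have hnz : ∀ t : ℕ, 1 + a * (t:D) ≠ 0 := by
      intro t h
      apply hka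
      have ht : (t:D) ≠ 0 := by rintro h0; rw [h0] at h; simp at h
      have : a = - (t:D)⁻¹ := by
        rw [(eq_mul_inv_iff_mul_eq₀ ht).2 (eq_neg_of_add_eq_zero_right h), neg_one_mul]
      rw [this]
      simp only [mul_neg, neg_mul, neg_inj]
      exact ((Nat.cast_commute t (k:D)).inv_left₀).eq.symm
    obtain ⟨n, hn⟩ := hsub.wit_mem
    have hf : Finite (⁅H, H⁆ : Subgroup Dˣ) := hfin
    choose g hg hgw using fun t : ℕ => hn n le_rfl k hk (1 + a * (t:D)) (hnz t)
    obtain ⟨z, hz⟩ := Finite.exists_infinite_fiber (fun t : ℕ => (⟨g t, hg t⟩ : (⁅H, H⁆ : Subgroup Dˣ)))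
    rw [Set.infinite_coe_iff] at hz
    have hz2 : ((fun t : ℕ => (t : D)) '' ((fun t : ℕ => (⟨g t, hg t⟩ : (⁅H, H⁆ : Subgroup Dˣ))) ⁻¹' {z})).Infinite :=
      hz.image (Nat.cast_injective.injOn)
    have hd := P0 _ hz2 (by rintro _ ⟨s, -, rfl⟩ _ ⟨t, -, rfl⟩; exact (Nat.cast_commute _ _).eq) k k.ne_zero a
      (z : Dˣ) (by rintro _ ⟨s, -, rfl⟩; exact (Nat.cast_commute _ _).eq)
      (by rintro _ ⟨s, -, rfl⟩; exact (Nat.cast_commute _ _).eq) n (by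
        rintro _ ⟨s, hs, rfl⟩ _
        rw [← hgw s]
        have := Set.mem_singleton_iff.1 hs
        rw [← this])
    have : IsOfFinOrder (⟨k, hk⟩ : (⁅H, H⁆ : Subgroup Dˣ)) := isOfFinOrder_of_finite _
    obtain ⟨m, hm, hkm⟩ := isOfFinOrder_iff_pow_eq_one.1 this
    refine hka (unip (k:D) m hm ?_ n a hd)
    have := congrArg (fun x : (⁅H, H⁆ : Subgroup Dˣ) => ((x : Dˣ) : D)) hkm
    simpa using this

theorem T2K {G M : Subgroup Dˣ} (hG : IsSubnormal G) (hM : SBF M) (K : Subfield D)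
    (h : ∀ x ∈ G, (x:D) ∈ K → x ∈ M) : ∀ x ∈ G, (x:D) ∈ K → ∀ y ∈ K, (x:D) * y = y * x := by
  let f : Kˣ →* Dˣ := Units.map (K.subtype : K →* D)
  have hf : Function.Injective f := Units.map_injective Subtype.val_injective
  intro x hx hxK y hy
  have hs : SBF (G.comap f) := hM.pull f hf _ (fun z hz => h _ hz z.1.2)
  have := T2 (hG.comap f) hs (Units.mk0 ⟨x, hxK⟩ (by simp [Subtype.ext_iff])) (by
    rw [Subgroup.mem_comap]
    convert hx
    ext; rfl) ⟨y, hy⟩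
  exact congrArg Subtype.val this

end

set_option linter.unusedSectionVars false
set_option linter.unusedVariables false
open Polynomial
open scoped Pointwise

section
variable {D : Type*} [DivisionRing D]

/-- left span of a set of units -/
def sp (L : Subfield D) (A : Set Dˣ) : Submodule L D := Submodule.span L (Units.val '' A)

theorem smul_sf (L : Subfield D) (l : L) (x : D) : l • x = (l : D) * x := rfl

theorem mem_sp {L : Subfield D} {A : Set Dˣ} {w : Dˣ} (hw : w ∈ A) : (w:D) ∈ sp L A :=
  Submodule.subset_span ⟨w, hw, rfl⟩

theorem sp_mono {L : Subfield D} {A B : Set Dˣ} (h : A ⊆ B) : sp L A ≤ sp L B :=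
  Submodule.span_mono (Set.image_mono h)

theorem sp_mul {L : Subfield D} {A B : Set Dˣ} (hA : ∀ w ∈ A, Nrm L (w:D)) {x y : D} (hx : x ∈ sp L A)
    (hy : y ∈ sp L B) : x * y ∈ sp L (A * B) := by
  induction hx using Submodule.span_induction with
  | mem x hx =>
    obtain ⟨u, hu, rfl⟩ := hx
    induction hy using Submodule.span_induction with
    | mem y hy =>
      obtain ⟨v, hv, rfl⟩ := hy
      rw [← Units.val_mul]
      exact mem_sp (Set.mul_mem_mul hu hv)
    | zero => simp
    | add y z _ _ h1 h2 => rw [mul_add]; exact add_mem h1 h2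
    | smul l y _ h =>
      have : (u:D) * (l • y) = (⟨_, ((hA u hu).2 l l.2).1⟩ : L) • ((u:D) * y) := by
        rw [smul_sf, smul_sf]; simp [mul_assoc]
      rw [this]
      exact Submodule.smul_mem _ _ h
  | zero => simp
  | add y z _ _ h1 h2 => rw [add_mul]; exact add_mem h1 h2
  | smul l x _ h =>
    rw [smul_mul_assoc]; exact Submodule.smul_mem _ _ h

theorem sp_mul' {L : Subfield D} {W : Subgroup Dˣ} (hA : ∀ w ∈ W, Nrm L (w:D)) {x y : D} (hx : x ∈ sp L (W:Set Dˣ))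
    (hy : y ∈ sp L (W:Set Dˣ)) : x * y ∈ sp L (W:Set Dˣ) := by
  have := sp_mul hA hx hy
  rwa [coe_mul_coe] at this

theorem le_sp {L : Subfield D} {W : Subgroup Dˣ} {x : D} (hx : x ∈ L) : x ∈ sp L (W:Set Dˣ) := by
  have := Submodule.smul_mem _ (⟨x, hx⟩ : L) (mem_sp (L := L) (one_mem W))
  simpa [smul_sf] using this

/-- right multiplication -/
def rmul (L : Subfield D) (a : D) : D →ₗ[L] D where
  toFun x := x * a
  map_add' x y := add_mul x y a
  map_smul' l x := by simp [smul_mul_assoc]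

theorem sp_finset {L : Subfield D} {A : Set Dˣ} {x : D} (hx : x ∈ sp L A) : ∃ S : Finset Dˣ, (S : Set Dˣ) ⊆ A ∧
    x ∈ sp L (S : Set Dˣ) := by
  classical
  obtain ⟨T, hT, hx⟩ := Submodule.mem_span_finite_of_mem_span hx
  obtain ⟨S, hS, rfl⟩ := Finset.subset_set_image_iff.1 hT
  exact ⟨S, hS, by rw [sp, ← Finset.coe_image]; exact hx⟩

/-- classes with bounded exponents -/
noncomputable def Tn {Q : Type*} [CommGroup Q] (T : Finset Q) (n : ℕ) : Finset Q :=
  open Classical in (Fintype.piFinset (fun _ : T => Finset.range (n+1))).image (fun e => ∏ s : T, (s : Q) ^ (e s))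

theorem Tn_card {Q : Type*} [CommGroup Q] (T : Finset Q) (n : ℕ) : (Tn T n).card ≤ (n+1) ^ T.card := by
  classical
  refine Finset.card_image_le.trans ?_
  rw [Fintype.card_piFinset]
  simp

theorem Tn_zero {Q : Type*} [CommGroup Q] (T : Finset Q) : 1 ∈ Tn T 0 := by
  classical
  refine Finset.mem_image.2 ⟨fun _ => 0, by simp, by simp⟩

theorem Tn_succ {Q : Type*} [CommGroup Q] (T : Finset Q) (n : ℕ) (x y : Q) (hx : x ∈ Tn T n) (hy : y ∈ T) :
    x * y ∈ Tn T (n+1) := by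
  classical
  obtain ⟨e, he, rfl⟩ := Finset.mem_image.1 hx
  refine Finset.mem_image.2 ⟨fun s => e s + if s = ⟨y, hy⟩ then 1 else 0, ?_, ?_⟩
  · rw [Fintype.mem_piFinset] at he ⊢
    intro s
    have := Finset.mem_range.1 (he s)
    rw [Finset.mem_range]
    split_ifs <;> omega
  · simp only [pow_add, Finset.prod_mul_distrib]
    congr 1
    rw [Finset.prod_eq_single ⟨y, hy⟩]
    · simp
    · intro b _ hb; simp [hb]
    · simp

theorem exp_beats (d : ℕ) : ∃ n : ℕ, (n+1)^d < 2^n := by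
  have h := tendsto_pow_const_div_const_pow_of_one_lt d (r := 2) (by norm_num)
  have h2 := (h.comp (Filter.tendsto_add_atTop_nat 1)).eventually (gt_mem_nhds (show (0:ℝ) < 1/2 by norm_num))
  obtain ⟨n, hn⟩ := h2.exists
  refine ⟨n, ?_⟩
  have h3 : ((n+1 : ℕ):ℝ)^d / 2^(n+1) < 1/2 := hn
  rw [div_lt_iff₀ (by positivity), pow_succ] at h3
  have : ((n+1 : ℕ):ℝ)^d < 2^n := by linarith
  exact_mod_cast this

/-- words -/
def Vn (L : Subfield D) (a b : D) : ℕ → Submodule L D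
  | 0 => Submodule.span L {1}
  | n + 1 => (Vn L a b n).map (rmul L a) ⊔ (Vn L a b n).map (rmul L b)

theorem ore {L : Subfield D} {W : Subgroup Dˣ} (hn : ∀ w ∈ W, Nrm L (w:D))
    (hc : ∀ u ∈ W, ∀ v ∈ W, ((u * v * u⁻¹ * v⁻¹ : Dˣ) : D) ∈ L) {a b : D}
    (ha : a ∈ sp L (W:Set Dˣ)) (hb : b ∈ sp L (W:Set Dˣ)) (ha0 : a ≠ 0) :
    ∃ s ∈ sp L (W:Set Dˣ), s ≠ 0 ∧ ∃ t ∈ sp L (W:Set Dˣ), s * b = t * a := by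
  classical
  by_cases hb0 : b = 0
  · exact ⟨1, le_sp (one_mem _), one_ne_zero, 0, zero_mem _, by simp [hb0]⟩
  by_contra! hcon
  obtain ⟨Sa, hSa, haS⟩ := sp_finset ha
  obtain ⟨Sb, hSb, hbS⟩ := sp_finset hb
  -- classes
  let π : W →* Abelianization W := Abelianization.of
  have hπ : Function.Surjective π := QuotientGroup.mk_surjective
  have hcl : ∀ u ∈ commutator W, ((u : Dˣ) : D) ∈ L := by
    intro u hu
    let Y : Subgroup W :=
      { carrier := {u | ((u : Dˣ) : D) ∈ L}
        one_mem' := by simp [one_mem]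
        mul_mem' := by intro x y hx hy; simpa using mul_mem hx hy
        inv_mem' := by intro x hx; simpa using inv_mem (show ((x : Dˣ) : D) ∈ L from hx) }
    have : commutator W ≤ Y := by
      rw [commutator_def]
      refine Subgroup.commutator_le.2 fun x _ y _ => ?_
      exact hc x x.2 y y.2
    exact this hu
  let E : Finset (Abelianization W) → Set Dˣ := fun T => {w | ∃ h : w ∈ W, π ⟨w, h⟩ ∈ T}
  have hE : ∀ T, FiniteDimensional L (sp L (E T)) ∧ Module.finrank L (sp L (E T)) ≤ T.card := by
    intro T
    let rep : Abelianization W → D := fun q => ((Function.surjInv hπ q : W) : Dˣ)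
    have hle : sp L (E T) ≤ Submodule.span L ((T.image rep : Finset D) : Set D) := by
      refine Submodule.span_le.2 ?_
      rintro _ ⟨w, ⟨hw, hwT⟩, rfl⟩
      set q := π ⟨w, hw⟩ with hq
      have h1 : π (Function.surjInv hπ q) = π ⟨w, hw⟩ := Function.surjInv_eq hπ q
      have h2 : (⟨w, hw⟩ : W) * (Function.surjInv hπ q)⁻¹ ∈ commutator W := by
        have := QuotientGroup.eq.1 h1
        have := (inferInstance : (commutator W).Normal).mem_comm this
        exact this
      have h3 := hcl _ h2
      have : (w : D) = (⟨_, h3⟩ : L) • rep q := by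
        rw [smul_sf]; simp [rep, mul_assoc]
      rw [this]
      exact Submodule.smul_mem _ _ (Submodule.subset_span (by
        simp only [Finset.coe_image]; exact ⟨q, hwT, rfl⟩))
    have hfd : FiniteDimensional L (Submodule.span L ((T.image rep : Finset D) : Set D)) :=
      FiniteDimensional.span_finset _ _
    refine ⟨Submodule.finiteDimensional_of_le hle, ?_⟩
    exact (Submodule.finrank_mono hle).trans ((finrank_span_finset_le_card _).trans Finset.card_image_le)
  let T0 : Finset (Abelianization W) := ((Sa ∪ Sb).subtype (· ∈ W)).image π
  have haT : a ∈ sp L (E T0) := by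
    refine sp_mono ?_ haS
    intro w hw
    exact ⟨hSa hw, Finset.mem_image.2 ⟨⟨w, hSa hw⟩, by simp; left; exact hw, rfl⟩⟩
  have hbT : b ∈ sp L (E T0) := by
    refine sp_mono ?_ hbS
    intro w hw
    exact ⟨hSb hw, Finset.mem_image.2 ⟨⟨w, hSb hw⟩, by simp; right; exact hw, rfl⟩⟩
  have hEn : ∀ n, ∀ x ∈ sp L (E (Tn T0 n)), ∀ c ∈ sp L (E T0), x * c ∈ sp L (E (Tn T0 (n+1))) := by
    intro n x hx c hc'
    refine sp_mono ?_ (sp_mul (fun w hw => hn w hw.1) hx hc')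
    rintro _ ⟨u, ⟨hu, hu'⟩, v, ⟨hv, hv'⟩, rfl⟩
    refine ⟨mul_mem hu hv, ?_⟩
    have : π ⟨u * v, mul_mem hu hv⟩ = π ⟨u, hu⟩ * π ⟨v, hv⟩ := by rw [← map_mul]; rfl
    show π ⟨u * v, mul_mem hu hv⟩ ∈ _
    rw [this]
    exact Tn_succ _ _ _ _ hu' hv'
  have hV : ∀ n, Vn L a b n ≤ sp L (E (Tn T0 n)) := by
    intro n
    induction n with
    | zero =>
      refine Submodule.span_le.2 ?_
      rintro _ rfl
      refine mem_sp (w := 1) ⟨one_mem _, ?_⟩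
      have : (⟨1, one_mem W⟩ : W) = 1 := rfl
      rw [this, map_one]
      exact Tn_zero _
    | succ n ih =>
      refine sup_le ?_ ?_
      · rintro _ ⟨x, hx, rfl⟩
        exact hEn n x (ih hx) a haT
      · rintro _ ⟨x, hx, rfl⟩
        exact hEn n x (ih hx) b hbT
  have hER : ∀ T, sp L (E T) ≤ sp L (W:Set Dˣ) := fun T => sp_mono fun w hw => hw.1
  have hfr : ∀ n, Module.finrank L (Vn L a b n) = 2 ^ n := by
    intro n
    induction n with
    | zero =>
      show Module.finrank L (Submodule.span L {(1:D)}) = 1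
      exact finrank_span_singleton one_ne_zero
    | succ n ih =>
      have hfd : FiniteDimensional L (Vn L a b n) :=
        have := (hE (Tn T0 n)).1
        Submodule.finiteDimensional_of_le (hV n)
      have e : ∀ c : D, c ≠ 0 → Module.finrank L ((Vn L a b n).map (rmul L c)) = 2 ^ n := by
        intro c hc0
        rw [← ih]
        refine (LinearEquiv.finrank_eq (Submodule.equivMapOfInjective (rmul L c) ?_ _)).symm
        intro x y h
        exact mul_right_cancel₀ hc0 h
      have h1 := Submodule.finrank_sup_add_finrank_inf_eq ((Vn L a b n).map (rmul L a)) ((Vn L a b n).map (rmul L b))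
      have h2 : (Vn L a b n).map (rmul L a) ⊓ (Vn L a b n).map (rmul L b) = ⊥ := by
        rw [eq_bot_iff]
        rintro _ ⟨⟨x, hx, rfl⟩, ⟨y, hy, hxy⟩⟩
        rw [Submodule.mem_bot]
        by_contra h0
        have hy0 : y ≠ 0 := by rintro rfl; apply h0; rw [← hxy]; simp
        exact hcon y (hER _ (hV n hy)) hy0 x (hER _ (hV n hx)) hxy
      rw [h2, finrank_bot, e a ha0, e b hb0] at h1
      rw [Vn, pow_succ]; omega
  obtain ⟨n, hn'⟩ := exp_beats T0.card
  have := (hE (Tn T0 n)).1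
  have h1 := Submodule.finrank_mono (hV n)
  rw [hfr] at h1
  have := h1.trans ((hE _).2.trans (Tn_card T0 n))
  omega

/-- the ring of left fractions -/
def Fr (L : Subfield D) (W : Subgroup Dˣ) (hn : ∀ w ∈ W, Nrm L (w:D))
    (hc : ∀ u ∈ W, ∀ v ∈ W, ((u * v * u⁻¹ * v⁻¹ : Dˣ) : D) ∈ L) : Subfield D where
  carrier := {x | ∃ r ∈ sp L (W:Set Dˣ), r ≠ 0 ∧ r * x ∈ sp L (W:Set Dˣ)}
  zero_mem' := ⟨1, le_sp (one_mem _), one_ne_zero, by simp⟩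
  one_mem' := ⟨1, le_sp (one_mem _), one_ne_zero, by simpa using le_sp (one_mem _)⟩
  neg_mem' := by
    rintro x ⟨r, hr, hr0, h⟩
    exact ⟨r, hr, hr0, by rw [mul_neg]; exact neg_mem h⟩
  add_mem' := by
    rintro x y ⟨r, hr, hr0, h⟩ ⟨r', hr', hr0', h'⟩
    obtain ⟨s, hs, hs0, t, ht, e⟩ := ore hn hc hr' hr hr0'
    refine ⟨s * r, sp_mul' hn hs hr, mul_ne_zero hs0 hr0, ?_⟩
    have : s * r * (x + y) = s * (r * x) + t * (r' * y) := by
      rw [mul_add, e, ← mul_assoc t, ← e]; simp only [mul_assoc]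
    rw [this]
    exact add_mem (sp_mul' hn hs h) (sp_mul' hn ht h')
  mul_mem' := by
    rintro x y ⟨r, hr, hr0, h⟩ ⟨r', hr', hr0', h'⟩
    obtain ⟨s, hs, hs0, t, ht, e⟩ := ore hn hc hr' h hr0'
    refine ⟨s * r, sp_mul' hn hs hr, mul_ne_zero hs0 hr0, ?_⟩
    have : s * r * (x * y) = t * (r' * y) := by
      rw [← mul_assoc t, ← e]; simp only [mul_assoc]
    rw [this]
    exact sp_mul' hn ht h'
  inv_mem' := by
    rintro x ⟨r, hr, hr0, h⟩
    by_cases hx : x = 0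
    · exact ⟨1, le_sp (one_mem _), one_ne_zero, by simp [hx]⟩
    · exact ⟨r * x, h, mul_ne_zero hr0 hx, by rw [mul_assoc, mul_inv_cancel₀ hx, mul_one]; exact hr⟩

theorem sp_le_Fr {L : Subfield D} {W : Subgroup Dˣ} (hn : ∀ w ∈ W, Nrm L (w:D))
    (hc : ∀ u ∈ W, ∀ v ∈ W, ((u * v * u⁻¹ * v⁻¹ : Dˣ) : D) ∈ L) {x : D} (hx : x ∈ sp L (W:Set Dˣ)) :
    x ∈ Fr L W hn hc := ⟨1, le_sp (one_mem _), one_ne_zero, by rwa [one_mul]⟩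

theorem Fr_common {L : Subfield D} {W : Subgroup Dˣ} (hn : ∀ w ∈ W, Nrm L (w:D))
    (hc : ∀ u ∈ W, ∀ v ∈ W, ((u * v * u⁻¹ * v⁻¹ : Dˣ) : D) ∈ L) {ι : Type*} (s : Finset ι) (x : ι → D)
    (hx : ∀ i ∈ s, x i ∈ Fr L W hn hc) :
    ∃ r ∈ sp L (W:Set Dˣ), r ≠ 0 ∧ ∀ i ∈ s, r * x i ∈ sp L (W:Set Dˣ) := by
  classical
  induction s using Finset.induction_on with
  | empty => exact ⟨1, le_sp (one_mem _), one_ne_zero, by simp⟩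
  | insert j s hj ih =>
    obtain ⟨r, hr, hr0, h⟩ := ih (fun i hi => hx i (Finset.mem_insert_of_mem hi))
    obtain ⟨r', hr', hr0', h'⟩ := hx j (Finset.mem_insert_self _ _)
    obtain ⟨s, hs, hs0, t, ht, e⟩ := ore hn hc hr' hr hr0'
    refine ⟨s * r, sp_mul' hn hs hr, mul_ne_zero hs0 hr0, fun i hi => ?_⟩
    rcases Finset.mem_insert.1 hi with rfl | hi
    · rw [e, mul_assoc]; exact sp_mul' hn ht h'
    · rw [mul_assoc]; exact sp_mul' hn hs (h i hi)

end

set_option linter.unusedSectionVars false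
set_option linter.unusedVariables false
open Polynomial
open scoped Pointwise

section
variable {D : Type*} [DivisionRing D]

/-- the configuration of the core theorem -/
structure Cfg (G M : Subgroup Dˣ) : Prop where
  hG : IsSubnormal G
  le : M ≤ G
  max : ∀ H : Subgroup Dˣ, M ≤ H → H ≤ G → H = M ∨ H = G
  nab : ∃ x ∈ M, ∃ y ∈ M, x * y ≠ y * x
  sbf : SBF M
  gen : Subfield.closure (Units.val '' (M : Set Dˣ)) = ⊤

/-- division subring generated by the centre and a subgroup -/
def cl (A : Subgroup Dˣ) : Subfield D := Subfield.closure ((ctr D : Set D) ∪ Units.val '' (A : Set Dˣ))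

theorem ctr_le_cl (A : Subgroup Dˣ) {x : D} (hx : x ∈ ctr D) : x ∈ cl A :=
  Subfield.subset_closure (Or.inl hx)

theorem mem_cl {A : Subgroup Dˣ} {a : Dˣ} (ha : a ∈ A) : (a:D) ∈ cl A :=
  Subfield.subset_closure (Or.inr ⟨a, ha, rfl⟩)

theorem cl_le {A : Subgroup Dˣ} {K : Subfield D} (h1 : ∀ x ∈ ctr D, x ∈ K) (h2 : ∀ a ∈ A, (a:D) ∈ K) :
    cl A ≤ K := by
  refine Subfield.closure_le.2 ?_
  rintro x (hx | ⟨a, ha, rfl⟩)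
  · exact h1 x hx
  · exact h2 a ha

theorem cl_comm1 {A : Subgroup Dˣ} {x : D} (h : ∀ a ∈ A, (a:D) * x = x * a) : ∀ y ∈ cl A, y * x = x * y := by
  refine closure_comm1 ?_
  rintro s (hs | ⟨a, ha, rfl⟩)
  · exact (mem_ctr.1 hs x).symm
  · exact h a ha

theorem cl_comm {A : Subgroup Dˣ} (h : ∀ a ∈ A, ∀ b ∈ A, a * b = b * a) : ∀ x ∈ cl A, ∀ y ∈ cl A, x * y = y * x := by
  refine closure_comm ?_
  rintro s (hs | ⟨a, ha, rfl⟩) t (ht | ⟨b, hb, rfl⟩)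
  · exact (mem_ctr.1 hs t).symm
  · exact (mem_ctr.1 hs _).symm
  · exact (mem_ctr.1 ht _)
  · exact congrArg Units.val (h a ha b hb)

theorem cl_nrm {A : Subgroup Dˣ} {g : Dˣ} (h1 : ∀ a ∈ A, g * a * g⁻¹ ∈ A) (h2 : ∀ a ∈ A, g⁻¹ * a * g ∈ A) :
    Nrm (cl A) (g:D) := by
  refine closure_nrm g.ne_zero ?_ ?_
  · rintro s (hs | ⟨a, ha, rfl⟩)
    · change _ ∈ cl A
      rw [mem_ctr.1 hs]; simpa using ctr_le_cl A hs
    · change _ ∈ cl A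
      simpa using mem_cl (h1 a ha)
  · rintro s (hs | ⟨a, ha, rfl⟩)
    · change _ ∈ cl A
      rw [mem_ctr.1 hs]; simpa using ctr_le_cl A hs
    · change _ ∈ cl A
      simpa using mem_cl (h2 a ha)

theorem nrm_of {A M : Subgroup Dˣ} (h : ∀ m ∈ M, ∀ a ∈ A, m * a * m⁻¹ ∈ A) : ∀ m ∈ M, Nrm (cl A) (m:D) :=
  fun m hm => cl_nrm (h m hm) (fun a ha => by simpa using h m⁻¹ (inv_mem hm) a ha)

/-- normalizer of a division subring -/
def nrmSub (K : Subfield D) : Subgroup Dˣ where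
  carrier := {g | Nrm K (g:D)}
  one_mem' := ⟨by simp, fun x hx => by simpa using hx⟩
  mul_mem' := by
    rintro a b ha hb
    refine ⟨Units.ne_zero _, fun x hx => ⟨?_, ?_⟩⟩
    · have := (ha.2 _ (hb.2 x hx).1).1
      simpa [mul_assoc] using this
    · have := (hb.2 _ (ha.2 x hx).2).2
      simpa [mul_assoc] using this
  inv_mem' := by
    rintro a ha
    refine ⟨Units.ne_zero _, fun x hx => ⟨?_, ?_⟩⟩
    · simpa using (ha.2 x hx).2
    · simpa using (ha.2 x hx).1

theorem Nrm.of_mem {K : Subfield D} {x : D} (h : x ∈ K) (h0 : x ≠ 0) : Nrm K x :=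
  ⟨h0, fun y hy => ⟨mul_mem (mul_mem h hy) (inv_mem h), mul_mem (mul_mem (inv_mem h) hy) h⟩⟩

variable {G M : Subgroup Dˣ}

theorem Cfg.central (c : Cfg G M) {x : D} (h : ∀ m ∈ M, (m:D) * x = x * m) : ∀ y, y * x = x * y := by
  intro y
  refine closure_comm1 (S := Units.val '' (M : Set Dˣ)) ?_ y (by rw [c.gen]; trivial)
  rintro _ ⟨m, hm, rfl⟩
  exact h m hm

theorem Cfg.dichot (c : Cfg G M) {A : Subgroup Dˣ} (hA : A ≤ M) (hn : ∀ m ∈ M, ∀ a ∈ A, m * a * m⁻¹ ∈ A)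
    (hab : ∃ x ∈ A, ∃ y ∈ A, x * y ≠ y * x) : ∀ g ∈ G, Nrm (cl A) (g:D) := by
  obtain ⟨x, hx, y, hy, hxy⟩ := hab
  by_cases h : ∀ x ∈ G, (x:D) ∈ cl A → x ∈ M
  · exact absurd (Units.ext (T2K c.hG c.sbf (cl A) h x (c.le (hA hx)) (mem_cl hx) y (mem_cl hy))) hxy
  push Not at h
  obtain ⟨z, hzG, hzK, hzM⟩ := h
  have h1 : M ≤ G ⊓ nrmSub (cl A) := fun m hm => ⟨c.le hm, nrm_of hn m hm⟩
  rcases c.max _ h1 inf_le_left with h | h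
  · exfalso
    apply hzM
    rw [← h]
    exact ⟨hzG, Nrm.of_mem hzK z.ne_zero⟩
  · intro g hg
    rw [← h] at hg
    exact hg.2

theorem wit_in {G : Subgroup Dˣ} (hG : IsSubnormal G) {K : Subfield D} (hK : ∀ g ∈ G, Nrm K (g:D)) {k : Dˣ}
    (hk : k ∈ G) (hkK : (k:D) ∈ K) : ∃ n, ∀ a : D, a ≠ 0 → wit (k:D) n a ∈ K := by
  obtain ⟨n, hn⟩ := hG.wit_mem
  refine ⟨n + 1, fun a ha => ?_⟩
  obtain ⟨g, hg, e⟩ := hn n le_rfl k hk a ha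
  have h1 : wit (k:D) (n+1) a = wit (k:D) n a * (k * wit (k:D) n a * (k:D)⁻¹)⁻¹ := rfl
  rw [h1, ← e, wit_succ_mem (H := G) hk rfl]
  have := mul_mem ((hK g hg).2 _ hkK).1 (inv_mem hkK)
  simpa using this

theorem sp_sum {L : Subfield D} {S : Finset Dˣ} {x : D} (hx : x ∈ sp L (S : Set Dˣ)) :
    ∃ a : Dˣ → L, ∑ u ∈ S, a u • (u:D) = x := by
  classical
  obtain ⟨a, ha⟩ := (Submodule.mem_span_image_finset_iff_exists_fun L).1 hx
  refine ⟨fun u => if h : u ∈ S then a ⟨u, h⟩ else 0, ?_⟩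
  rw [← ha, ← Finset.sum_coe_sort S]
  refine Finset.sum_congr rfl fun u _ => ?_
  simp

theorem sp_disj {Y : Type*} (L : Subfield D) (U V : Set Dˣ)
    (φ : Y → D →+ D) (hφ : ∀ y, ∀ l ∈ L, ∀ x, φ y (l * x) = l * φ y x)
    (w : Dˣ → Y → D) (hw : ∀ u ∈ U ∪ V, ∀ y, w u y ∈ L) (hwc : ∀ u ∈ U ∪ V, ∀ y, ∀ l ∈ L, l * w u y = w u y * l)
    (hev : ∀ u ∈ U ∪ V, ∀ y, φ y u = w u y * u) (hd : ∀ u ∈ U, ∀ v ∈ V, w u ≠ w v)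
    (x : D) (hx : x ∈ sp L U) (hx' : x ∈ sp L V) : x = 0 := by
  classical
  obtain ⟨S, hS, hxS⟩ := sp_finset hx
  obtain ⟨T, hT, hxT⟩ := sp_finset hx'
  obtain ⟨a, ha⟩ := sp_sum hxS
  obtain ⟨b, hb⟩ := sp_sum hxT
  let Φ := S.image w
  let Ψ := T.image w
  let va : (Y → D) → D := fun f => ∑ u ∈ S with w u = f, a u • (u:D)
  let vb : (Y → D) → D := fun f => ∑ u ∈ T with w u = f, b u • (u:D)
  have sa : ∑ f ∈ Φ ∪ Ψ, va f = x := by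
    rw [← ha]
    exact Finset.sum_fiberwise_of_maps_to (fun u hu => Finset.mem_union_left _ (Finset.mem_image_of_mem w hu)) _
  have sb : ∑ f ∈ Φ ∪ Ψ, vb f = x := by
    rw [← hb]
    exact Finset.sum_fiberwise_of_maps_to (fun u hu => Finset.mem_union_right _ (Finset.mem_image_of_mem w hu)) _
  let v := fun f => va f - vb f
  have sv : ∑ f ∈ Φ ∪ Ψ, v f = 0 := by rw [Finset.sum_sub_distrib, sa, sb, sub_self]
  have eg : ∀ f ∈ Φ ∪ Ψ, ∀ y, f y ∈ L ∧ ∀ l ∈ L, l * f y = f y * l := by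
    intro f hf y
    rcases Finset.mem_union.1 hf with h | h
    · obtain ⟨u, hu, rfl⟩ := Finset.mem_image.1 h
      exact ⟨hw u (Or.inl (hS hu)) y, hwc u (Or.inl (hS hu)) y⟩
    · obtain ⟨u, hu, rfl⟩ := Finset.mem_image.1 h
      exact ⟨hw u (Or.inr (hT hu)) y, hwc u (Or.inr (hT hu)) y⟩
  have ev1 : ∀ (R : Finset Dˣ) (hR : (R : Set Dˣ) ⊆ U ∪ V) (d : Dˣ → L) f y,
      φ y (∑ u ∈ R with w u = f, d u • (u:D)) = f y * ∑ u ∈ R with w u = f, d u • (u:D) := by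
    intro R hR d f y
    rw [map_sum, Finset.mul_sum]
    refine Finset.sum_congr rfl fun u hu => ?_
    obtain ⟨hu1, hu2⟩ := Finset.mem_filter.1 hu
    subst hu2
    rw [smul_sf, hφ y _ (d u).2, hev u (hR hu1), ← mul_assoc, ← mul_assoc, hwc u (hR hu1) y _ (d u).2]
  have hev' : ∀ f y, φ y (v f) = f y * v f := by
    intro f y
    rw [map_sub, mul_sub, ev1 S (hS.trans Set.subset_union_left), ev1 T (hT.trans Set.subset_union_right)]
  have hz : ∀ f ∈ Φ ∪ Ψ, v f = 0 := by
    by_contra! hcon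
    obtain ⟨f0, hf0, hv0⟩ := hcon
    have key := dedekind (ι := {f // f ∈ Φ ∪ Ψ ∧ v f ≠ 0}) (Y := Y) L (fun i => v i.1) (fun i => i.2.2) φ hφ
      (fun i => i.1) (fun i y => (eg i.1 i.2.1 y).1) (fun i y => (eg i.1 i.2.1 y).2) (fun i y => hev' i.1 y)
      ((Φ ∪ Ψ).subtype (fun f => f ∈ Φ ∪ Ψ ∧ v f ≠ 0))
      (fun i _ j _ hij => by
        by_contra! hc
        exact hij (Subtype.ext (funext hc))) (fun _ => 1) (fun _ _ => one_mem _) (by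
        simp only [one_mul]
        rw [Finset.sum_subtype_eq_sum_filter]
        refine Eq.trans ?_ sv
        refine Finset.sum_subset (Finset.filter_subset _ _) (fun f hf hf' => ?_)
        by_contra h
        exact hf' (Finset.mem_filter.2 ⟨hf, hf, h⟩))
    exact one_ne_zero (key ⟨f0, hf0, hv0⟩ (by simpa using! hf0))
  rw [← sa]
  refine Finset.sum_eq_zero fun f hf => ?_
  by_cases hfΦ : f ∈ Φ
  · have h1 := hz f hf
    have h2 : vb f = 0 := by
      refine Finset.sum_eq_zero fun u hu => ?_
      obtain ⟨hu1, hu2⟩ := Finset.mem_filter.1 hu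
      subst hu2
      obtain ⟨u', hu', e⟩ := Finset.mem_image.1 hfΦ
      exact absurd e (hd u' (hS hu') u (hT hu1))
    have : va f - vb f = 0 := h1
    rwa [h2, sub_zero] at this
  · refine Finset.sum_eq_zero fun u hu => ?_
    obtain ⟨hu1, hu2⟩ := Finset.mem_filter.1 hu
    subst hu2
    exact absurd (Finset.mem_image_of_mem w hu1) hfΦ

theorem finLb {L : Subfield D} (hLf : (L : Set D).Finite) {b k : D} (hb : Nrm L b) {m : ℕ} (hm : 1 ≤ m)
    (hbm : b ^ m ∈ L) (hk : k ∈ L) : b * k = k * b := by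
  obtain ⟨p, hp, hcp⟩ := char_of_finite L hLf
  obtain ⟨q, hq, hFq⟩ := finR L hLf
  have hpw : (Submonoid.powers b : Set D).Finite := finite_pow_of (N := m * q) (by nlinarith)
    (by rw [pow_mul]; exact hFq _ hbm (pow_ne_zero _ hb.1))
  let S0 : Submonoid D :=
    { carrier := {x | ∃ l ∈ L, ∃ i : ℕ, x = l * b ^ i}
      one_mem' := ⟨1, one_mem _, 0, by simp⟩
      mul_mem' := by
        rintro _ _ ⟨f, hf, i, rfl⟩ ⟨g, hg, j, rfl⟩
        refine ⟨f * (b ^ i * g * (b^i)⁻¹), mul_mem hf ((hb.pow i).2 g hg).1, i + j, ?_⟩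
        rw [pow_add]; simp [mul_assoc, hb.1] }
  refine finite_submonoid_comm p hp S0 ?_ b k ⟨1, one_mem _, 1, by simp⟩ ⟨k, hk, 0, by simp⟩
  refine (hLf.image2 (fun f x => f * x) hpw).subset ?_
  rintro _ ⟨f, hf, i, rfl⟩
  exact ⟨f, hf, _, ⟨i, rfl⟩, rfl⟩

end

set_option linter.unusedSectionVars false
set_option linter.unusedVariables false
open Polynomial
open scoped Pointwise

section
variable {D : Type*} [DivisionRing D]
variable {G M C W : Subgroup Dˣ}

theorem mem_Fr {L : Subfield D} {W : Subgroup Dˣ} (hn : ∀ w ∈ W, Nrm L (w:D))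
    (hc : ∀ u ∈ W, ∀ v ∈ W, ((u * v * u⁻¹ * v⁻¹ : Dˣ) : D) ∈ L) {x : D} (hx : x ∈ Fr L W hn hc) :
    ∃ r ∈ sp L (W : Set Dˣ), r ≠ 0 ∧ r * x ∈ sp L (W : Set Dˣ) := hx

/-- self-centralizing abelian normal subgroup -/
structure SC (M C : Subgroup Dˣ) : Prop where
  le : C ≤ M
  nrm : ∀ m ∈ M, ∀ x ∈ C, m * x * m⁻¹ ∈ C
  comm : ∀ x ∈ C, ∀ y ∈ C, x * y = y * x
  self : ∀ m ∈ M, (∀ c ∈ C, m * c = c * m) → m ∈ C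

theorem SC.disj (h : SC M C) {U V : Set Dˣ} (hU : U ⊆ M) (hV : V ⊆ M) (hd : ∀ u ∈ U, ∀ v ∈ V, u⁻¹ * v ∉ C)
    {x : D} (hx : x ∈ sp (cl C) U) (hx' : x ∈ sp (cl C) V) : x = 0 := by
  have hUV : U ∪ V ⊆ M := Set.union_subset hU hV
  have hmem : ∀ u ∈ U ∪ V, ∀ y : C, ((u * y * u⁻¹ : Dˣ) : D) ∈ cl C := fun u hu y =>
    mem_cl (h.nrm u (hUV hu) y y.2)
  refine sp_disj (Y := C) (cl C) U V (fun y => AddMonoidHom.mulRight ((y:Dˣ):D)) ?_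
    (fun u y => ((u * y * u⁻¹ : Dˣ) : D)) hmem ?_ ?_ ?_ x hx hx'
  · intro y l hl x
    simp [mul_assoc]
  · intro u hu y l hl
    exact cl_comm h.comm _ hl _ (hmem u hu y)
  · intro u hu y
    simp
  · intro u hu v hv e
    refine hd u hu v hv (h.self _ (mul_mem (inv_mem (hU hu)) (hV hv)) fun c hc => ?_)
    have h1 : u * c * u⁻¹ = v * c * v⁻¹ := Units.ext (congrFun e ⟨c, hc⟩)
    calc u⁻¹ * v * c = u⁻¹ * (v * c * v⁻¹) * v := by group
      _ = u⁻¹ * (u * c * u⁻¹) * v := by rw [h1]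
      _ = c * (u⁻¹ * v) := by group

set_option maxHeartbeats 1000000 in
theorem claimI (c : Cfg G M) (h : SC M C) (hW : W ≤ M) (hCW : C ≤ W) (hWn : ∀ m ∈ M, ∀ x ∈ W, m * x * m⁻¹ ∈ W)
    (hWc : ∀ u ∈ W, ∀ v ∈ W, u * v * u⁻¹ * v⁻¹ ∈ C) {w : Dˣ} (hw : w ∈ W) (hwC : w ∉ C) : M ≤ W := by
  have hLn := nrm_of h.nrm
  have hn : ∀ w ∈ W, Nrm (cl C) (w:D) := fun w hw => hLn w (hW hw)
  have hc : ∀ u ∈ W, ∀ v ∈ W, ((u * v * u⁻¹ * v⁻¹ : Dˣ) : D) ∈ cl C := fun u hu v hv => mem_cl (hWc u hu v hv)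
  have hLc := cl_comm h.comm
  have hKG : ∀ g ∈ G, Nrm (cl W) (g:D) := by
    refine c.dichot hW hWn ?_
    by_contra! hcon
    exact hwC (h.self w (hW hw) fun c hc => hcon w hw c (hCW hc))
  have hLK : cl C ≤ cl W := cl_le (fun x hx => ctr_le_cl _ hx) (fun a ha => mem_cl (hCW ha))
  have hKF : cl W ≤ Fr (cl C) W hn hc := cl_le (fun x hx => sp_le_Fr hn hc (le_sp (ctr_le_cl _ hx)))
    (fun a ha => sp_le_Fr hn hc (mem_sp ha))
  intro b hbM
  by_contra hbW
  have hbF : (b:D) ∉ Fr (cl C) W hn hc := by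
    intro hbF
    obtain ⟨r, hr, hr0, hrb⟩ := mem_Fr hn hc hbF
    have h1 : r * b ∈ sp (cl C) ((W : Set Dˣ) * {b}) := sp_mul hn hr (mem_sp rfl)
    have hV : ((W : Set Dˣ) * {b}) ⊆ (M : Set Dˣ) := by
      rintro _ ⟨u, hu, b', hb', rfl⟩
      rw [Set.mem_singleton_iff.1 hb']
      exact mul_mem (hW hu) hbM
    have hUV : ∀ u ∈ (W : Set Dˣ), ∀ v ∈ ((W : Set Dˣ) * {b}), u⁻¹ * v ∉ C := by
      rintro u hu _ ⟨v, hv, b', hb', rfl⟩ hh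
      rw [Set.mem_singleton_iff.1 hb'] at hh
      apply hbW
      have h5 : u⁻¹ * (v * b) ∈ W := hCW hh
      rw [W.mul_mem_cancel_left (inv_mem hu), W.mul_mem_cancel_left hv] at h5
      exact h5
    have h2 : r * (b:D) = 0 := h.disj hW hV hUV hrb h1
    exact mul_ne_zero hr0 b.ne_zero h2
  obtain ⟨k, hk, hkb⟩ : ∃ k ∈ C, b * k ≠ k * b := by
    by_contra! hcon
    exact hbW (hCW (h.self b hbM hcon))
  obtain ⟨n, hwit⟩ := wit_in c.hG hKG (c.le (h.le hk)) (mem_cl (hCW hk))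
  set d : Dˣ := k * b * k⁻¹ * b⁻¹ with hd
  have hdC : d ∈ C := by
    have := mul_mem hk (h.nrm b hbM _ (inv_mem hk))
    simpa [d, mul_assoc] using this
  have hd1 : d ≠ 1 := by
    intro h1
    apply hkb
    calc b * k = d⁻¹ * (k * b) := by simp only [d]; group
      _ = k * b := by rw [h1]; simp
  have hdel : del (k:D) n b = (1 - (d:D)) ^ n * b := by
    refine del_eig _ _ _ (congrArg Units.val (h.comm d hdC k hk)) ?_ n
    simp [d]
  have hd0 : (1 - (d:D)) ^ n ≠ 0 := pow_ne_zero _ (sub_ne_zero.2 fun e => hd1 (Units.ext (by simpa using e.symm)))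
  have hbK : (b:D) ∉ cl W := fun hh => hbF (hKF hh)
  by_cases hi : ∃ m : ℕ, 1 ≤ m ∧ b ^ m ∈ C
  · obtain ⟨m, hm, hbm⟩ := hi
    have hbmL : (b:D) ^ m ∈ cl C := by simpa using mem_cl hbm
    have hT : {x : D | x ∈ (cl C : Set D) ∧ (b:D) * x = x * b}.Infinite := by
      intro hfin
      have := fix_fin (cl C) hLc b (hLn b hbM) m hm (fun x hx => hLc _ hbmL x hx) hfin
      exact hkb (Units.ext (finLb this (hLn b hbM) hm hbmL (mem_cl hk)))
    have := Plem _ hT (fun s hs t ht => hLc s hs.1 t ht.1) (cl W) (fun x hx => hLK hx.1) (k:D) k.ne_zero (b:D)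
      (fun t ht => hLc t ht.1 _ (mem_cl hk)) (fun t ht => ht.2.symm) n (fun t _ h0 => hwit _ h0)
    rw [hdel] at this
    apply hbK
    have h2 := mul_mem (inv_mem (pow_mem (sub_mem (one_mem (cl W)) (mem_cl (hCW hdC))) n)) this
    rwa [inv_mul_cancel_left₀ hd0] at h2
  · push Not at hi
    have hind : Ind (cl C) (b:D) := by
      refine ind_of (cl C) b b.ne_zero (cl C : Set D) subset_rfl (fun y hy l hl => hLc l hl y hy)
        (fun y hy => ((hLn b hbM).2 y hy).1) ?_
      intro m hm
      by_contra! hcon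
      refine hi m hm (h.self _ (pow_mem hbM m) fun c hc => Units.ext ?_)
      simpa using hcon c (mem_cl hc)
    obtain ⟨P, Q, hP, hQ, hQ0, e, hPQ⟩ := (hLn b hbM).lemQ hind (k:D) k.ne_zero (mem_cl hk) 1 (one_mem _) n
    have hx : wit (k:D) n (1 + 1 * b) ∈ cl W := by
      apply hwit
      intro h0
      apply hbK
      have : (b:D) = -1 := by rw [one_mul, add_comm] at h0; exact eq_neg_of_add_eq_zero_left h0
      rw [this]
      exact neg_mem (one_mem _)
    set x := wit (k:D) n (1 + 1 * b) with hxdef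
    classical
    set N := max P.natDegree Q.natDegree + 1 with hN
    rw [eval₂_eq_sum_range' (cl C).subtype (n := N) (by omega), eval₂_eq_sum_range' (cl C).subtype (n := N) (by omega)] at e
    have hbi : ∀ i, Nrm (cl W) ((b:D)^i) := fun i => (hKG b (c.le hbM)).pow i
    let y : ℕ → D := fun i => (Q.coeff i : D) * ((b:D)^i * x * ((b:D)^i)⁻¹)
    have hy : ∀ i, y i * (b:D)^i = (Q.coeff i : D) * (b:D)^i * x := by
      intro i
      simp only [y, mul_assoc]
      rw [inv_mul_cancel₀ (pow_ne_zero _ b.ne_zero), mul_one]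
    obtain ⟨r, hr, hr0, hry⟩ := Fr_common hn hc (Finset.range N) y (fun i _ => hKF
      (mul_mem (hLK (Q.coeff i).2) ((hbi i).2 x hx).1))
    let z : ℕ → D := fun i => r * y i - r * (P.coeff i : D)
    have hz : ∀ i ∈ Finset.range N, z i ∈ sp (cl C) (W : Set Dˣ) := fun i hi =>
      sub_mem (hry i hi) (sp_mul' hn hr (le_sp (P.coeff i).2))
    have hzb : ∀ i ∈ Finset.range N, z i * (b:D)^i ∈ sp (cl C) ((W : Set Dˣ) * {b^i}) := fun i hi =>
      sp_mul hn (hz i hi) (by have := mem_sp (L := cl C) (A := {b^i}) (w := b^i) rfl; simpa using! this)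
    have hzs : ∀ i, z i * (b:D)^i = r * ((Q.coeff i : D) * (b:D)^i * x - (P.coeff i : D) * (b:D)^i) := by
      intro i
      simp only [z, sub_mul, mul_sub, mul_assoc]
      rw [hy]
      simp only [mul_assoc]
    have hsum : ∑ i ∈ Finset.range N, z i * (b:D)^i = 0 := by
      simp only [hzs]
      rw [← Finset.mul_sum, Finset.sum_sub_distrib, ← Finset.sum_mul]
      simp only [Subfield.coe_subtype] at e
      rw [e, sub_self, mul_zero]
    let J := (Finset.range N).filter (fun i => b^i ∈ W)
    have h1 : ∑ i ∈ J, z i * (b:D)^i ∈ sp (cl C) (W : Set Dˣ) := by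
      refine sum_mem fun i hi => ?_
      obtain ⟨hi1, hi2⟩ := Finset.mem_filter.1 hi
      refine sp_mono ?_ (hzb i hi1)
      rintro _ ⟨u, hu, _, rfl, rfl⟩
      exact mul_mem hu hi2
    have h2 : ∑ i ∈ J, z i * (b:D)^i ∈ sp (cl C) {v | v ∈ M ∧ v ∉ W} := by
      have := Finset.sum_filter_add_sum_filter_not (Finset.range N) (fun i => b^i ∈ W) (fun i => z i * (b:D)^i)
      rw [hsum] at this
      rw [eq_neg_of_add_eq_zero_left this]
      refine neg_mem (sum_mem fun i hi => ?_)
      obtain ⟨hi1, hi2⟩ := Finset.mem_filter.1 hi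
      refine sp_mono ?_ (hzb i hi1)
      rintro _ ⟨u, hu, _, rfl, rfl⟩
      refine ⟨mul_mem (hW hu) (pow_mem hbM i), fun hh => hi2 ?_⟩
      exact (W.mul_mem_cancel_left hu).1 hh
    have h3 := h.disj (U := W) (V := {v | v ∈ M ∧ v ∉ W}) hW (fun v hv => hv.1)
      (fun u hu v hv hh => hv.2 ((W.mul_mem_cancel_left (inv_mem hu)).1 (hCW hh))) h1 h2
    simp only [hzs] at h3
    rw [← Finset.mul_sum, mul_eq_zero, or_iff_right hr0, Finset.sum_sub_distrib, ← Finset.sum_mul, sub_eq_zero] at h3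
    have hJ0 : 0 ∈ J := Finset.mem_filter.2 ⟨Finset.mem_range.2 (by omega), by simp⟩
    have hJ1 : 1 ∉ J := fun hh => hbW (by simpa using (Finset.mem_filter.1 hh).2)
    let tr : (cl C)[X] → (cl C)[X] := fun P => ∑ i ∈ J, monomial i (P.coeff i)
    have tr0 : ∀ P, (tr P).coeff 0 = P.coeff 0 := by
      intro P
      simp only [tr, finsetSum_coeff, coeff_monomial]
      simp [hJ0]
    have tr1 : ∀ P, (tr P).coeff 1 = 0 := by
      intro P
      simp only [tr, finsetSum_coeff, coeff_monomial]
      simp [hJ1]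
    have trE : ∀ P, (tr P).eval₂ (cl C).subtype b = ∑ i ∈ J, (P.coeff i : D) * (b:D)^i := by
      intro P
      simp [tr, eval₂_finsetSum, eval₂_monomial]
    have hu := (hLn b hbM).uniq hind P Q (tr P) (tr Q) x hP hQ (by rw [tr0, hP]) (by rw [tr0, hQ])
      (by
        rw [eval₂_eq_sum_range' (cl C).subtype (n := N) (by omega), eval₂_eq_sum_range' (cl C).subtype (n := N) (by omega)]
        exact e)
      (by rw [trE, trE]; exact h3)
    rw [tr1, tr1, sub_zero] at hu
    have : (P.coeff 1 : D) - Q.coeff 1 = 0 := by exact_mod_cast congrArg Subtype.val hu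
    rw [this, zero_mul, one_mul, hdel] at hPQ
    exact mul_ne_zero hd0 b.ne_zero hPQ.symm

end

set_option linter.unusedSectionVars false
set_option linter.unusedVariables false
open Polynomial
open scoped Pointwise

/-- product of a subgroup with a subgroup it normalizes -/
def prodSub {Γ : Type*} [Group Γ] (A C : Subgroup Γ) (h : ∀ a ∈ A, ∀ c ∈ C, a * c * a⁻¹ ∈ C) : Subgroup Γ where
  carrier := {x | ∃ a ∈ A, ∃ c ∈ C, x = a * c}
  one_mem' := ⟨1, one_mem _, 1, one_mem _, by simp⟩
  mul_mem' := by
    rintro _ _ ⟨a, ha, c, hc, rfl⟩ ⟨a', ha', c', hc', rfl⟩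
    refine ⟨a * a', mul_mem ha ha', a'⁻¹ * c * a' * c', mul_mem ?_ hc', by group⟩
    simpa using h a'⁻¹ (inv_mem ha') c hc
  inv_mem' := by
    rintro _ ⟨a, ha, c, hc, rfl⟩
    exact ⟨a⁻¹, inv_mem ha, a * c⁻¹ * a⁻¹, h a ha _ (inv_mem hc), by group⟩

theorem mem_prodSub {Γ : Type*} [Group Γ] {A C : Subgroup Γ} {h : ∀ a ∈ A, ∀ c ∈ C, a * c * a⁻¹ ∈ C} {x : Γ} :
    x ∈ prodSub A C h ↔ ∃ a ∈ A, ∃ c ∈ C, x = a * c := Iff.rfl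

theorem finite_rel {Γ : Type*} [Group Γ] {M C : Subgroup Γ} (b : Γ) (hb : b ∈ M) (m : ℕ) (hm : 1 ≤ m) (hbm : b ^ m ∈ C)
    (h : ∀ x ∈ M, ∃ z : ℤ, ∃ c ∈ C, x = b ^ z * c) : C.relIndex M ≠ 0 := by
  have : Finite (M ⧸ C.subgroupOf M) := by
    refine Finite.of_surjective (fun i : Fin m => QuotientGroup.mk (⟨b ^ (i:ℕ), pow_mem hb _⟩ : M)) ?_
    intro q
    induction q using QuotientGroup.induction_on with
    | H x =>
      obtain ⟨z, c, hc, e⟩ := h x x.2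
      have hm0 : (m:ℤ) ≠ 0 := by omega
      have h1 := Int.emod_nonneg z hm0
      have h2 := Int.emod_lt_of_pos z (by omega : (0:ℤ) < m)
      refine ⟨⟨(z % m).toNat, by omega⟩, QuotientGroup.eq.2 ?_⟩
      rw [Subgroup.mem_subgroupOf]
      simp only [Subgroup.coe_mul, Subgroup.coe_inv, e]
      have h3 : (b ^ (z % m).toNat)⁻¹ * (b ^ z * c) = (b ^ m) ^ (z / m) * c := by
        rw [← mul_assoc]
        congr 1
        rw [← zpow_natCast, ← zpow_neg, ← zpow_add, ← zpow_natCast, ← zpow_mul, Int.toNat_of_nonneg h1]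
        congr 1
        have := Int.emod_add_mul_ediv z m
        linarith
      rw [h3]
      exact mul_mem (zpow_mem hbm _) hc
  exact Subgroup.index_ne_zero_of_finite

section
variable {D : Type*} [DivisionRing D]
variable {G M C W : Subgroup Dˣ}

/-- conclusion of the core theorem -/
def Concl (M : Subgroup Dˣ) : Prop :=
  (∃ C ≤ M, (∀ m ∈ M, ∀ x ∈ C, m * x * m⁻¹ ∈ C) ∧ (∀ x ∈ C, ∀ y ∈ C, x * y = y * x) ∧ C.relIndex M ≠ 0) ∧
    ∃ k ∈ M, ∃ e : D, ∀ s, del (k:D) s e ≠ 0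

/-- units lying in a division subring -/
def unitsIn (K : Subfield D) : Subgroup Dˣ where
  carrier := {g | (g:D) ∈ K}
  one_mem' := by simp [one_mem]
  mul_mem' := fun {a b} ha hb => by
    change ((a * b : Dˣ) : D) ∈ K
    rw [Units.val_mul]; exact mul_mem ha hb
  inv_mem' := fun {a} ha => by
    change ((a⁻¹ : Dˣ) : D) ∈ K
    rw [Units.val_inv_eq_inv_val]; exact inv_mem ha

theorem mem_unitsIn {K : Subfield D} {g : Dˣ} : g ∈ unitsIn K ↔ (g:D) ∈ K := Iff.rfl

/-- centre of a division subring -/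
def cK (K : Subfield D) : Subfield D := K ⊓ cen (K : Set D)

theorem mem_cK {K : Subfield D} {x : D} : x ∈ cK K ↔ x ∈ K ∧ ∀ s ∈ K, s * x = x * s := by
  refine ⟨fun h => ⟨h.1, mem_cen.1 h.2⟩, fun h => ⟨h.1, mem_cen.2 h.2⟩⟩

/-- if `G` normalizes `K` then `G ∩ Z(K)` is central -/
theorem cK_central (hG : IsSubnormal G) {K : Subfield D} (hK : ∀ g ∈ G, Nrm K (g:D)) {a : Dˣ} (ha : a ∈ G)
    (h : (a:D) ∈ cK K) : ∀ y : D, (a:D) * y = y * a := by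
  have hs : IsSubnormal (G ⊓ unitsIn (cK K)) := by
    refine hG.of_normal inf_le_left ?_
    intro g hg z hzz
    obtain ⟨hz, hz'⟩ := Subgroup.mem_inf.1 hzz
    refine Subgroup.mem_inf.2 ⟨mul_mem (mul_mem hg hz) (inv_mem hg), mem_unitsIn.2 ?_⟩
    rw [mem_unitsIn, mem_cK] at hz'
    refine mem_cK.2 ⟨?_, fun s hs => ?_⟩
    · simpa using ((hK g hg).2 _ hz'.1).1
    · have h1 := hz'.2 _ ((hK g hg).2 s hs).2
      have g0 := g.ne_zero
      have : (g:D) * ((g:D)⁻¹ * s * g * z) * (g:D)⁻¹ = (g:D) * (z * ((g:D)⁻¹ * s * g)) * (g:D)⁻¹ := by rw [h1]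
      simpa [mul_assoc] using this
  refine T2a hs a ⟨ha, h⟩ ?_
  rintro x ⟨hx, hx'⟩
  exact Units.ext ((mem_cK.1 hx').2 _ (mem_cK.1 h).1)

theorem Cfg.exists_SC (c : Cfg G M) {A : Subgroup Dˣ} (hA : A ≤ M) (hn : ∀ m ∈ M, ∀ a ∈ A, m * a * m⁻¹ ∈ A)
    (hc : ∀ a ∈ A, ∀ b ∈ A, a * b = b * a) {a : Dˣ} (ha : a ∈ A) {y : D} (hay : (a:D) * y ≠ y * a) : ∃ C, SC M C := by
  have hAC : A ≤ M ⊓ Subgroup.centralizer (A : Set Dˣ) := fun x hx =>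
    ⟨hA hx, Subgroup.mem_centralizer_iff.2 fun z hz => hc z hz x hx⟩
  have hCn : ∀ m ∈ M, ∀ x ∈ M ⊓ Subgroup.centralizer (A : Set Dˣ), m * x * m⁻¹ ∈ M ⊓ Subgroup.centralizer (A : Set Dˣ) := by
    intro m hm x hxx
    obtain ⟨hx, hx'⟩ := Subgroup.mem_inf.1 hxx
    refine Subgroup.mem_inf.2 ⟨mul_mem (mul_mem hm hx) (inv_mem hm), Subgroup.mem_centralizer_iff.2 fun z hz => ?_⟩
    have h1 : m⁻¹ * z * m ∈ A := by simpa using hn m⁻¹ (inv_mem hm) z hz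
    have h2 := Subgroup.mem_centralizer_iff.1 hx' _ h1
    calc z * (m * x * m⁻¹) = m * ((m⁻¹ * z * m) * x) * m⁻¹ := by group
      _ = m * x * m⁻¹ * z := by rw [h2]; group
  refine ⟨_, inf_le_left, hCn, ?_, ?_⟩
  · by_contra! hcon
    have hK := c.dichot inf_le_left hCn hcon
    refine hay (cK_central c.hG hK (c.le (hA ha)) (mem_cK.2 ⟨mem_cl (hAC ha), ?_⟩) y)
    refine cl_comm1 ?_
    rintro x ⟨hx, hx'⟩
    exact congrArg Units.val (Subgroup.mem_centralizer_iff.1 hx' a ha).symm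
  · intro m hm h
    exact ⟨hm, Subgroup.mem_centralizer_iff.2 fun z hz => (h z (hAC hz)).symm⟩

/-- non-unipotency from an eigenvector -/
theorem nu_of {k b d : Dˣ} (hkb : k * b ≠ b * k) (hd : d = k * b * k⁻¹ * b⁻¹) (hdk : d * k = k * d) :
    ∀ s, del (k:D) s (b:D) ≠ 0 := by
  intro s
  have hd1 : d ≠ 1 := by
    intro h1
    apply hkb
    calc k * b = d * (b * k) := by rw [hd]; group
      _ = b * k := by rw [h1]; simp
  rw [del_eig (k:D) b d (congrArg Units.val hdk) (by simp [hd]) s]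
  exact mul_ne_zero (pow_ne_zero _ (sub_ne_zero.2 fun e => hd1 (Units.ext (by simpa using e.symm)))) b.ne_zero

theorem SC.concl (h : SC M C) (c : Cfg G M) : Concl M := by
  obtain ⟨b, hbM, hbC⟩ : ∃ b ∈ M, b ∉ C := by
    by_contra! hcon
    obtain ⟨x, hx, y, hy, hxy⟩ := c.nab
    exact hxy (h.comm x (hcon x hx) y (hcon y hy))
  constructor
  · refine ⟨C, h.le, h.nrm, h.comm, ?_⟩
    obtain ⟨N, hN, hNn, hNs, hNi⟩ := c.sbf
    by_cases hNC : N ≤ C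
    · exact fun h0 => hNi (Nat.eq_zero_of_zero_dvd (h0 ▸ Subgroup.relIndex_dvd_of_le_left M hNC))
    obtain ⟨n, hn⟩ := ds_bot hNs
    have hex : ∃ n, ds N n ≤ C := ⟨n, by rw [hn]; exact bot_le⟩
    classical
    obtain ⟨i, hi1, hi2⟩ : ∃ i, ¬ ds N i ≤ C ∧ ds N (i+1) ≤ C := by
      obtain ⟨j, hj⟩ : ∃ j, Nat.find hex = j + 1 := by
        refine Nat.exists_eq_succ_of_ne_zero fun h0 => hNC ?_
        have := Nat.find_spec hex
        rw [h0] at this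
        exact this
      refine ⟨j, Nat.find_min hex (by omega), ?_⟩
      rw [← hj]
      exact Nat.find_spec hex
    have hAM : ds N i ≤ M := (ds_le N i).trans hN
    have hAn : ∀ m ∈ M, ∀ a ∈ ds N i, m * a * m⁻¹ ∈ ds N i := fun m hm => ds_conj (hNn m hm) i
    have hAC : ∀ a ∈ ds N i, ∀ c ∈ C, a * c * a⁻¹ ∈ C := fun a ha => h.nrm a (hAM ha)
    obtain ⟨w, hw, hwC⟩ := Set.not_subset.1 hi1
    have hWM : prodSub (ds N i) C hAC ≤ M := by
      rintro _ ⟨a, ha, c, hc, rfl⟩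
      exact mul_mem (hAM ha) (h.le hc)
    have hMW : M ≤ prodSub (ds N i) C hAC := by
      refine claimI c h hWM (fun x hx => ⟨1, one_mem _, x, hx, by simp⟩) ?_ ?_ (w := w)
        ⟨w, hw, 1, one_mem _, by simp⟩ hwC
      · rintro m hm _ ⟨a, ha, c, hc, rfl⟩
        exact ⟨m * a * m⁻¹, hAn m hm a ha, m * c * m⁻¹, h.nrm m hm c hc, by group⟩
      · rintro _ ⟨a, ha, c, hc, rfl⟩ _ ⟨a', ha', c', hc', rfl⟩
        have h1 : a * a' * a⁻¹ * a'⁻¹ ∈ C := hi2 (Subgroup.commutator_mem_commutator ha ha')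
        have h2 : (a'⁻¹ * c * a') * c' * c⁻¹ ∈ C := by
          refine mul_mem (mul_mem ?_ hc') (inv_mem hc)
          simpa using hAC a'⁻¹ (inv_mem ha') c hc
        have h3 := hAC _ ha' _ (hAC _ ha _ h2)
        have h4 := hAC _ ha' _ (inv_mem hc')
        have := mul_mem (mul_mem h1 h3) h4
        have e : a * c * (a' * c') * (a * c)⁻¹ * (a' * c')⁻¹ = a * a' * a⁻¹ * a'⁻¹ *
          (a' * (a * (a'⁻¹ * c * a' * c' * c⁻¹) * a⁻¹) * a'⁻¹) * (a' * c'⁻¹ * a'⁻¹) := by group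
        rw [e]
        exact this
    have hMM : ∀ u ∈ M, ∀ v ∈ M, u * v * u⁻¹ * v⁻¹ ∈ C := by
      intro u hu v hv
      obtain ⟨a, ha, c, hc, rfl⟩ := hMW hu
      obtain ⟨a', ha', c', hc', rfl⟩ := hMW hv
      have h1 : a * a' * a⁻¹ * a'⁻¹ ∈ C := hi2 (Subgroup.commutator_mem_commutator ha ha')
      have h2 : (a'⁻¹ * c * a') * c' * c⁻¹ ∈ C := by
        refine mul_mem (mul_mem ?_ hc') (inv_mem hc)
        simpa using hAC a'⁻¹ (inv_mem ha') c hc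
      have h3 := hAC _ ha' _ (hAC _ ha _ h2)
      have h4 := hAC _ ha' _ (inv_mem hc')
      have := mul_mem (mul_mem h1 h3) h4
      have e : a * c * (a' * c') * (a * c)⁻¹ * (a' * c')⁻¹ = a * a' * a⁻¹ * a'⁻¹ *
        (a' * (a * (a'⁻¹ * c * a' * c' * c⁻¹) * a⁻¹) * a'⁻¹) * (a' * c'⁻¹ * a'⁻¹) := by group
      rw [e]
      exact this
    have hz : ∀ d ∈ M, d ∉ C → ∀ x ∈ M, ∃ z : ℤ, ∃ c ∈ C, x = d ^ z * c := by
      intro d hd hdC x hx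
      have hdn : ∀ a ∈ Subgroup.zpowers d, ∀ c ∈ C, a * c * a⁻¹ ∈ C := by
        rintro _ ⟨z, rfl⟩ c hc
        exact h.nrm _ (zpow_mem hd z) c hc
      have hle : prodSub (Subgroup.zpowers d) C hdn ≤ M := by
        rintro _ ⟨_, ⟨z, rfl⟩, c, hc, rfl⟩
        exact mul_mem (zpow_mem hd z) (h.le hc)
      have hCle : C ≤ prodSub (Subgroup.zpowers d) C hdn := fun x hx => ⟨1, one_mem _, x, hx, by simp⟩
      have := claimI c h hle hCle (fun m hm x hx => by
          have h1 := mul_mem (hCle (hMM m hm x (hle hx))) hx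
          simpa using h1)
        (fun u hu v hv => hMM u (hle hu) v (hle hv)) (w := d) ⟨d, Subgroup.mem_zpowers d, 1, one_mem _, by simp⟩ hdC hx
      obtain ⟨_, ⟨z, rfl⟩, c, hc, e⟩ := this
      exact ⟨z, c, hc, e⟩
    obtain ⟨m, hm, hbm⟩ : ∃ m : ℕ, 1 ≤ m ∧ b ^ m ∈ C := by
      by_cases hb2 : b ^ 2 ∈ C
      · exact ⟨2, by norm_num, hb2⟩
      · obtain ⟨z, c, hc, e⟩ := hz (b ^ 2) (pow_mem hbM 2) hb2 b hbM
        have h1 : b ^ (1 - 2 * z) = c := by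
          have : b ^ (1 - 2 * z) = (b ^ (2 * z))⁻¹ * b := by
            rw [← zpow_neg, ← zpow_add_one]; congr 1; ring
          rw [this]
          have h2 : (b ^ 2) ^ z = b ^ (2 * z) := by rw [zpow_mul]; norm_cast
          rw [h2] at e
          nth_rewrite 2 [e]
          simp
        refine ⟨(1 - 2 * z).natAbs, by omega, ?_⟩
        rcases Int.natAbs_eq (1 - 2 * z) with h3 | h3
        · rw [← zpow_natCast, ← h3, h1]; exact hc
        · have : ((1 - 2 * z).natAbs : ℤ) = -(1 - 2 * z) := by omega
          rw [← zpow_natCast, this, zpow_neg, h1]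
          exact inv_mem hc
    exact finite_rel b hbM m hm hbm (hz b hbM hbC)
  · obtain ⟨k, hk, hkb⟩ : ∃ k ∈ C, b * k ≠ k * b := by
      by_contra! hcon
      exact hbC (h.self b hbM hcon)
    refine ⟨k, h.le hk, b, nu_of hkb.symm rfl (h.comm _ ?_ _ hk)⟩
    have := mul_mem hk (h.nrm b hbM _ (inv_mem hk))
    simpa [mul_assoc] using this

end

set_option linter.unusedSectionVars false
set_option linter.unusedVariables false
open Polynomial
open scoped Pointwise

section
variable {D : Type*} [DivisionRing D]
variable {G M C W B : Subgroup Dˣ}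

theorem center_iff {x : Dˣ} : x ∈ Subgroup.center Dˣ ↔ (x:D) ∈ ctr D := by
  rw [Subgroup.mem_center_iff, mem_ctr]
  constructor
  · intro h s
    by_cases hs : s = 0
    · simp [hs]
    · exact congrArg Units.val (h (Units.mk0 s hs))
  · intro h g
    exact Units.ext (h g)

theorem center_comm {x : Dˣ} (h : x ∈ Subgroup.center Dˣ) (y : Dˣ) : x * y = y * x :=
  (Subgroup.mem_center_iff.1 h y).symm

/-- abelian normal subgroups are central -/
def AbC (M : Subgroup Dˣ) : Prop := ∀ A : Subgroup Dˣ, A ≤ M → (∀ m ∈ M, ∀ a ∈ A, m * a * m⁻¹ ∈ A) →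
    (∀ a ∈ A, ∀ b ∈ A, a * b = b * a) → A ≤ Subgroup.center Dˣ

/-- class two normal nonabelian subgroup -/
structure C2 (M B : Subgroup Dˣ) : Prop where
  le : B ≤ M
  nrm : ∀ m ∈ M, ∀ a ∈ B, m * a * m⁻¹ ∈ B
  nab : ∃ x ∈ B, ∃ y ∈ B, x * y ≠ y * x
  cen : ∀ x ∈ B, ∀ y ∈ B, x * y * x⁻¹ * y⁻¹ ∈ Subgroup.center Dˣ

theorem Cfg.nu_abel (c : Cfg G M) (hAb : AbC M) {N : Subgroup Dˣ} (hN : N ≤ M) (hNn : ∀ m ∈ M, ∀ a ∈ N, m * a * m⁻¹ ∈ N)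
    (hNc : ∀ a ∈ N, ∀ b ∈ N, a * b = b * a) (hNi : N.relIndex M ≠ 0) : Concl M := by
  refine ⟨⟨N, hN, hNn, hNc, hNi⟩, ?_⟩
  have hz := hAb N hN hNn hNc
  have hfin := schur hN (fun x hx y _ => center_comm (hz hx) y) hNi
  by_cases hM' : ⁅M, M⁆ ≤ Subgroup.center Dˣ
  · obtain ⟨x, hx, y, hy, hxy⟩ := c.nab
    exact ⟨x, hx, y, nu_of hxy rfl (center_comm (hM' (Subgroup.commutator_mem_commutator hx hy)) x)⟩
  have hle : ⁅M, M⁆ ≤ M := comm_le_self M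
  have hMn : ∀ m ∈ M, ∀ a ∈ ⁅M, M⁆, m * a * m⁻¹ ∈ ⁅M, M⁆ := fun m hm =>
    ds_conj (H := M) (fun x hx => mul_mem (mul_mem hm hx) (inv_mem hm)) 1
  obtain ⟨p, hp⟩ := CharP.exists D
  rcases CharP.char_is_prime_or_zero D p with hpp | rfl
  · exact absurd (hAb _ hle hMn fun a ha b hb => finite_subgroup_comm p hpp _ hfin a b ha hb) hM'
  · have : CharZero D := CharP.charP_to_charZero D
    obtain ⟨k, hk, hkc⟩ := Set.not_subset.1 hM'
    have hkc' : (k:D) ∉ ctr D := fun h => hkc (center_iff.2 h)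
    rw [mem_ctr] at hkc'
    push Not at hkc'
    obtain ⟨y, hy⟩ := hkc'
    refine ⟨k, hle hk, y, fun s hs => hy ?_⟩
    have : Finite (⁅M, M⁆ : Subgroup Dˣ) := hfin
    obtain ⟨m, hm, hkm⟩ := (isOfFinOrder_iff_pow_eq_one).1 (isOfFinOrder_of_finite (⟨k, hk⟩ : (⁅M, M⁆ : Subgroup Dˣ)))
    have hkm' : (k:D) ^ m = 1 := by
      have := congrArg (fun z : (⁅M, M⁆ : Subgroup Dˣ) => ((z : Dˣ) : D)) hkm
      simpa using this
    exact (unip (k:D) m hm hkm' s y hs).symm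

theorem AbC.cyc (hAb : AbC M) {x : Dˣ} (hx : x ∈ M) (h : ∀ m ∈ M, x⁻¹ * (m * x * m⁻¹) ∈ Subgroup.center Dˣ) :
    x ∈ Subgroup.center Dˣ := by
  have hn : ∀ a ∈ Subgroup.zpowers x, ∀ c ∈ M ⊓ Subgroup.center Dˣ, a * c * a⁻¹ ∈ M ⊓ Subgroup.center Dˣ := by
    intro a ha c hc
    rw [← center_comm hc.2 a]
    simpa using hc
  refine hAb (prodSub (Subgroup.zpowers x) (M ⊓ Subgroup.center Dˣ) hn) ?_ ?_ ?_
    (mem_prodSub.2 ⟨x, Subgroup.mem_zpowers x, 1, one_mem _, by simp⟩)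
  · rintro _ ⟨_, ⟨z, rfl⟩, c, hc, rfl⟩
    exact mul_mem (zpow_mem hx z) hc.1
  · rintro m hm _ ⟨_, ⟨z, rfl⟩, c, hc, rfl⟩
    set g := x⁻¹ * (m * x * m⁻¹) with hg
    have hgm : g ∈ M ⊓ Subgroup.center Dˣ :=
      Subgroup.mem_inf.2 ⟨mul_mem (inv_mem hx) (mul_mem (mul_mem hm hx) (inv_mem hm)), h m hm⟩
    refine ⟨x ^ z, ⟨z, rfl⟩, g ^ z * c, mul_mem (zpow_mem hgm z) hc, ?_⟩
    have h1 : m * x * m⁻¹ = x * g := by rw [hg]; group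
    have h2 : m * x ^ z * m⁻¹ = x ^ z * g ^ z := by
      rw [← conj_zpow, h1]
      exact (show Commute x g from (center_comm hgm.2 x).symm).mul_zpow z
    calc m * (x ^ z * c) * m⁻¹ = m * x ^ z * (c * m⁻¹) := by group
      _ = m * x ^ z * (m⁻¹ * c) := by rw [center_comm hc.2]
      _ = (m * x ^ z * m⁻¹) * c := by group
      _ = x ^ z * (g ^ z * c) := by rw [h2]; group
  · rintro _ ⟨_, ⟨z, rfl⟩, c, hc, rfl⟩ _ ⟨_, ⟨z', rfl⟩, c', hc', rfl⟩
    calc x ^ z * c * (x ^ z' * c') = x ^ z * (c * x ^ z') * c' := by group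
      _ = x ^ z * x ^ z' * (c * c') := by rw [center_comm hc.2]; group
      _ = x ^ z' * x ^ z * (c' * c) := by rw [center_comm hc.2 c', ← zpow_add, ← zpow_add, add_comm]
      _ = x ^ z' * (x ^ z * c') * c := by group
      _ = x ^ z' * c' * (x ^ z * c) := by rw [← center_comm hc'.2]; group

theorem C2.center (h : C2 M B) (hAb : AbC M) {z : Dˣ} (hz : z ∈ B) (hzB : ∀ y ∈ B, z * y = y * z) :
    z ∈ Subgroup.center Dˣ := by
  refine hAb (B ⊓ Subgroup.centralizer (B : Set Dˣ)) (inf_le_left.trans h.le) ?_ ?_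
    ⟨hz, Subgroup.mem_centralizer_iff.2 fun y hy => (hzB y hy).symm⟩
  · intro m hm x hxx
    obtain ⟨hx, hx'⟩ := Subgroup.mem_inf.1 hxx
    refine Subgroup.mem_inf.2 ⟨h.nrm m hm x hx, Subgroup.mem_centralizer_iff.2 fun z hz => ?_⟩
    have h1 : m⁻¹ * z * m ∈ B := by simpa using h.nrm m⁻¹ (inv_mem hm) z hz
    have h2 := Subgroup.mem_centralizer_iff.1 hx' _ h1
    calc z * (m * x * m⁻¹) = m * ((m⁻¹ * z * m) * x) * m⁻¹ := by group
      _ = m * x * m⁻¹ * z := by rw [h2]; group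
  · intro a ha b hb
    exact (Subgroup.mem_centralizer_iff.1 ha.2 b hb.1).symm

/-- commutator as a function -/
def cm {Γ : Type*} [Group Γ] (x y : Γ) : Γ := x * y * x⁻¹ * y⁻¹

theorem cm_mul {Γ : Type*} [Group Γ] (x x' y : Γ) (h : cm x' y ∈ Subgroup.center Γ) : cm (x * x') y = cm x y * cm x' y := by
  have h1 := Subgroup.mem_center_iff.1 h
  calc cm (x * x') y = x * cm x' y * (y * x⁻¹ * y⁻¹) := by simp only [cm]; group
    _ = cm x' y * x * (y * x⁻¹ * y⁻¹) := by rw [h1]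
    _ = cm x' y * cm x y := by simp only [cm]; group
    _ = _ := (h1 _).symm

theorem cm_pow {Γ : Type*} [Group Γ] (x y : Γ) (h : cm x y ∈ Subgroup.center Γ) (n : ℕ) : cm (x ^ n) y = cm x y ^ n := by
  induction n with
  | zero => simp [cm]
  | succ n ih => rw [pow_succ, cm_mul _ _ _ h, ih, pow_succ]

theorem cm_eq_one {Γ : Type*} [Group Γ] {x y : Γ} : cm x y = 1 ↔ x * y = y * x := by
  simp only [cm]
  rw [mul_inv_eq_one, mul_inv_eq_iff_eq_mul]

theorem C2.cm (h : C2 M B) {x y : Dˣ} (hx : x ∈ B) (hy : y ∈ B) : cm x y ∈ Subgroup.center Dˣ := h.cen x hx y hy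

theorem C2.pow_center (h : C2 M B) (hAb : AbC M) {x : Dˣ} (hx : x ∈ B) (n : ℕ) :
    x ^ n ∈ Subgroup.center Dˣ ↔ ∀ y ∈ B, (_root_.cm x y) ^ n = 1 := by
  constructor
  · intro hc y hy
    rw [← cm_pow _ _ (h.cm hx hy), cm_eq_one]
    exact center_comm hc y
  · intro hc
    refine h.center hAb (pow_mem hx n) fun y hy => ?_
    rw [← cm_eq_one, cm_pow _ _ (h.cm hx hy), hc y hy]

/-- `p`-torsion part -/
def C2.tor (h : C2 M B) (p : ℕ) : Subgroup Dˣ where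
  carrier := {x | x ∈ B ∧ ∀ y ∈ B, (_root_.cm x y) ^ p = 1}
  one_mem' := ⟨one_mem _, fun y _ => by simp [_root_.cm]⟩
  mul_mem' := by
    rintro a b ⟨ha, ha'⟩ ⟨hb, hb'⟩
    refine ⟨mul_mem ha hb, fun y hy => ?_⟩
    rw [cm_mul _ _ _ (h.cm hb hy), Commute.mul_pow, ha' y hy, hb' y hy, one_mul]
    exact center_comm (h.cm ha hy) _
  inv_mem' := by
    rintro a ⟨ha, ha'⟩
    refine ⟨inv_mem ha, fun y hy => ?_⟩
    have h1 := cm_mul a a⁻¹ y (h.cm (inv_mem ha) hy)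
    have h2 : _root_.cm (a * a⁻¹) y = 1 := by simp [_root_.cm]
    rw [h2] at h1
    rw [eq_inv_of_mul_eq_one_right h1.symm, inv_pow, ha' y hy, inv_one]

theorem C2.tor_c2 (h : C2 M B) (hAb : AbC M) (p : ℕ) {x : Dˣ} (hx : x ∈ B) (hxp : x ^ p ∈ Subgroup.center Dˣ)
    (hxc : x ∉ Subgroup.center Dˣ) : C2 M (h.tor p) := by
  have hn : ∀ m ∈ M, ∀ a ∈ h.tor p, m * a * m⁻¹ ∈ h.tor p := by
    rintro m hm a ⟨ha, ha'⟩
    refine ⟨h.nrm m hm a ha, fun y hy => ?_⟩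
    have h1 : m⁻¹ * y * m ∈ B := by simpa using h.nrm m⁻¹ (inv_mem hm) y hy
    have h2 : _root_.cm (m * a * m⁻¹) y = m * _root_.cm a (m⁻¹ * y * m) * m⁻¹ := by simp only [_root_.cm]; group
    rw [h2, conj_pow, ha' _ h1]; simp
  have hle : h.tor p ≤ M := fun a ha => h.le ha.1
  refine ⟨hle, hn, ?_, fun x hx y hy => h.cen x hx.1 y hy.1⟩
  by_contra! hcon
  exact hxc (hAb _ hle hn hcon ⟨hx, (h.pow_center hAb hx p).1 hxp⟩)

theorem root_pow {ζ g : D} (hc : ζ * g = g * ζ) {p : ℕ} (hp : p.Prime) (h1 : ζ ≠ 1) (hζ : ζ ^ p = 1) (hg : g ^ p = 1) :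
    ∃ i : ℕ, ζ ^ i = g := by
  let E := Subfield.closure ({ζ, g} : Set D)
  have hE : ∀ x ∈ E, ∀ y ∈ E, x * y = y * x := by
    refine closure_comm ?_
    rintro s (rfl | rfl) t (rfl | rfl)
    · rfl
    · exact hc
    · exact hc.symm
    · rfl
  let _ : Field E := { (inferInstance : DivisionRing E) with mul_comm := fun a b => Subtype.ext (hE a a.2 b b.2) }
  have hp' : Fact p.Prime := ⟨hp⟩
  have : NeZero p := ⟨hp.ne_zero⟩
  let z : E := ⟨ζ, Subfield.subset_closure (by simp)⟩
  let g' : E := ⟨g, Subfield.subset_closure (by simp)⟩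
  have hz : z ^ p = 1 := Subtype.ext hζ
  have hz1 : z ≠ 1 := fun h => h1 (congrArg Subtype.val h)
  have ho := orderOf_eq_prime hz hz1
  have hpr : IsPrimitiveRoot z p := ho ▸ IsPrimitiveRoot.orderOf z
  obtain ⟨i, _, hi⟩ := hpr.eq_pow_of_pow_eq_one (ξ := g') (Subtype.ext hg)
  exact ⟨i, congrArg Subtype.val hi⟩

theorem mul_pow_cm {Γ : Type*} [Group Γ] (a b : Γ) (h : cm b a ∈ Subgroup.center Γ) (n : ℕ) :
    (a * b) ^ n = a ^ n * b ^ n * cm b a ^ (∑ i ∈ Finset.range n, i) := by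
  induction n with
  | zero => simp
  | succ n ih =>
    have h1 : b ^ n * a = cm b a ^ n * (a * b ^ n) := by
      rw [← cm_pow _ _ h]; simp only [cm]; group
    have hc : ∀ i : ℕ, ∀ g, cm b a ^ i * g = g * cm b a ^ i := fun i g =>
      ((Subgroup.mem_center_iff.1 (pow_mem h i)) g).symm
    rw [pow_succ, ih, Finset.sum_range_succ]
    calc a ^ n * b ^ n * cm b a ^ (∑ i ∈ Finset.range n, i) * (a * b)
        = a ^ n * b ^ n * (cm b a ^ (∑ i ∈ Finset.range n, i) * (a * b)) := by rw [mul_assoc]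
      _ = a ^ n * (b ^ n * a) * b * cm b a ^ (∑ i ∈ Finset.range n, i) := by rw [hc]; simp only [mul_assoc]
      _ = a ^ n * (cm b a ^ n * (a * b ^ n)) * b * cm b a ^ (∑ i ∈ Finset.range n, i) := by rw [h1]
      _ = a ^ n * (a * b ^ n * cm b a ^ n) * b * cm b a ^ (∑ i ∈ Finset.range n, i) := by rw [hc]
      _ = a ^ n * a * b ^ n * (cm b a ^ n * b) * cm b a ^ (∑ i ∈ Finset.range n, i) := by simp only [mul_assoc]
      _ = a ^ n * a * b ^ n * (b * cm b a ^ n) * cm b a ^ (∑ i ∈ Finset.range n, i) := by rw [hc]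
      _ = _ := by
        rw [pow_succ, pow_succ, add_comm, pow_add]; simp only [mul_assoc]

/-- odd torsion is impossible -/
theorem C2.odd (h : C2 M B) (hAb : AbC M) {p : ℕ} (hp : p.Prime) (hp2 : p ≠ 2)
    (hB : ∀ x ∈ B, x ^ p ∈ Subgroup.center Dˣ) : False := by
  obtain ⟨u, hu, v, hv, huv⟩ := h.nab
  refine huv (center_comm ?_ v)
  have hζ1 : ((_root_.cm u v : Dˣ) : D) ≠ 1 := fun e => huv (cm_eq_one.1 (Units.ext e))
  have hζp : ((_root_.cm u v : Dˣ) : D) ^ p = 1 := by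
    rw [← Units.val_pow_eq_pow_val, (h.pow_center hAb hu p).1 (hB u hu) v hv]; simp
  have hζc := center_iff.1 (h.cm hu hv)
  refine hAb.cyc (h.le hu) fun m hm => ?_
  have hw := h.nrm m hm u hu
  set w := m * u * m⁻¹ with hwd
  have hwp : w ^ p = u ^ p := by
    rw [hwd, conj_pow, ← center_comm (hB u hu)]; simp
  have hs : p ∣ ∑ i ∈ Finset.range p, i := by
    have := Finset.sum_range_id_mul_two p
    have h3 : p ∣ (∑ i ∈ Finset.range p, i) * 2 := by rw [this]; exact dvd_mul_right _ _
    exact (Nat.Coprime.dvd_of_dvd_mul_right ((Nat.coprime_primes hp Nat.prime_two).2 hp2) h3)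
  have hg : (u⁻¹ * w) ^ p = 1 := by
    rw [mul_pow_cm _ _ (h.cm hw (inv_mem hu)), hwp, inv_pow, inv_mul_cancel, one_mul]
    obtain ⟨q, hq⟩ := hs
    rw [hq, pow_mul, (h.pow_center hAb hw p).1 (hB w hw) _ (inv_mem hu), one_pow]
  obtain ⟨i, hi⟩ := root_pow (g := ((u⁻¹ * w : Dˣ) : D)) (mem_ctr.1 hζc _).symm hp hζ1 hζp
    (by rw [← Units.val_pow_eq_pow_val, hg]; simp)
  rw [center_iff, ← hi]
  exact pow_mem hζc i

theorem C2.keyM (c : Cfg G M) (h : ∃ k ∈ B, ∃ e ∈ B, k * e ≠ e * k ∧ ∀ s, del (k:D) s (e:D) ≠ 0) (hB : B ≤ M)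
    (hn : ∀ m ∈ M, ∀ a ∈ B, m * a * m⁻¹ ∈ B) (hF : (ctr D : Set D).Infinite) : ∀ m ∈ M, (m:D) ∈ cl B := by
  obtain ⟨k, hk, e, he, hke, hs⟩ := h
  have hK := c.dichot hB hn ⟨k, hk, e, he, hke⟩
  obtain ⟨n, hw⟩ := wit_in c.hG hK (c.le (hB hk)) (mem_cl hk)
  intro m hm
  by_contra hmK
  exact key (hK m (c.le hm)) hmK (mem_cl hk) k.ne_zero n (ctr D : Set D) hF (fun x hx => ctr_le_cl _ hx)
    (fun t ht x _ => (mem_ctr.1 ht x).symm) (fun t ht => (mem_ctr.1 ht m).symm) hw e (mem_cl he) hs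

end

set_option linter.unusedSectionVars false
set_option linter.unusedVariables false
open Polynomial
open scoped Pointwise

section
variable {D : Type*} [DivisionRing D]
variable {G M C W B : Subgroup Dˣ}

theorem closure_conj {Γ : Type*} [Group Γ] {I : Set Γ} {m : Γ} (h : ∀ g ∈ I, m * g * m⁻¹ ∈ I) :
    ∀ g ∈ Subgroup.closure I, m * g * m⁻¹ ∈ Subgroup.closure I := by
  have : Subgroup.closure I ≤ (Subgroup.closure I).comap (MulAut.conj m).toMonoidHom := by
    rw [Subgroup.closure_le]
    intro g hg
    exact Subgroup.subset_closure (h g hg)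
  exact fun g hg => this hg

/-- kernel of the conjugation action on a finite set has finite index -/
theorem finite_act {Γ : Type*} [Group Γ] {M C : Subgroup Γ} {I : Set Γ} (hI : I.Finite)
    (h : ∀ m ∈ M, ∀ g ∈ I, m * g * m⁻¹ ∈ I) (hC : ∀ m ∈ M, (∀ g ∈ I, m * g = g * m) → m ∈ C) : C.relIndex M ≠ 0 := by
  have : Finite I := hI
  let _ : MulAction M I :=
    { smul := fun m g => ⟨m * g * (m:Γ)⁻¹, h m m.2 g g.2⟩
      one_smul := fun g => Subtype.ext (by change (1:Γ) * g * (1:Γ)⁻¹ = g; simp)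
      mul_smul := fun a b g => Subtype.ext (by
        change (a * b : Γ) * g * (a * b : Γ)⁻¹ = a * (b * g * (b:Γ)⁻¹) * (a:Γ)⁻¹
        group) }
  have hk := Subgroup.finiteIndex_ker (MulAction.toPermHom M I)
  have hle : (MulAction.toPermHom M I).ker ≤ C.subgroupOf M := by
    intro m hm
    rw [Subgroup.mem_subgroupOf]
    refine hC m m.2 fun g hg => ?_
    have h1 : (MulAction.toPermHom M I m) ⟨g, hg⟩ = ⟨g, hg⟩ := by rw [MonoidHom.mem_ker.1 hm]; rfl
    have h2 : (m:Γ) * g * (m:Γ)⁻¹ = g := congrArg Subtype.val h1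
    exact mul_inv_eq_iff_eq_mul.1 h2
  have := Subgroup.finiteIndex_of_le hle
  exact this.index_ne_zero

theorem C2.two (h : C2 M B) (hAb : AbC M) (c : Cfg G M) (hB : ∀ x ∈ B, x ^ 2 ∈ Subgroup.center Dˣ) : Concl M := by
  have sg : ∀ x ∈ B, ∀ y ∈ B, (x:D) * y = y * x ∨ (x:D) * y = -(y * x) := by
    intro x hx y hy
    have h1 := (h.pow_center hAb hx 2).1 (hB x hx) y hy
    have h2 : ((_root_.cm x y : Dˣ) : D) * (_root_.cm x y : Dˣ) = 1 := by
      rw [← Units.val_mul, ← sq, h1]; simp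
    have h3 : (x:D) * y = (_root_.cm x y : Dˣ) * ((y:D) * x) := by
      rw [← Units.val_mul, ← Units.val_mul, ← Units.val_mul]
      congr 1
      simp only [_root_.cm]; group
    rcases mul_self_eq_one_iff.1 h2 with h4 | h4
    · left; rw [h3, h4, one_mul]
    · right; rw [h3, h4, neg_one_mul]
  have sqc : ∀ x y : D, x * x = y * y → x * y = y * x → x = y ∨ x = -y := fun x y h1 h2 =>
    (Commute.mul_self_eq_mul_self_iff h2).1 h1
  let I : Set Dˣ := {g | g ∈ B ∧ (g:D) * g = -1}
  have hIn : ∀ m ∈ M, ∀ g ∈ I, m * g * m⁻¹ ∈ I := by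
    rintro m hm g ⟨hg, hg2⟩
    refine ⟨h.nrm m hm g hg, ?_⟩
    have : ((m * g * m⁻¹ : Dˣ) : D) * (m * g * m⁻¹ : Dˣ) = m * ((g:D) * g) * (m:D)⁻¹ := by
      simp [mul_assoc]
    rw [this, hg2]; simp
  have hXM : Subgroup.closure I ≤ M := (Subgroup.closure_le _).2 fun g hg => h.le hg.1
  have hXn : ∀ m ∈ M, ∀ g ∈ Subgroup.closure I, m * g * m⁻¹ ∈ Subgroup.closure I := fun m hm =>
    closure_conj (hIn m hm)
  have hstep : ∀ x ∈ B, ∀ m ∈ M, x⁻¹ * (m * x * m⁻¹) ∈ Subgroup.center Dˣ ∨ x⁻¹ * (m * x * m⁻¹) ∈ I := by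
    intro x hx m hm
    have hw := h.nrm m hm x hx
    set w := m * x * m⁻¹ with hwd
    have hw2 : (w:D) * w = x * x := by
      rw [← Units.val_mul, ← Units.val_mul, ← sq, ← sq, hwd, conj_pow, ← center_comm (hB x hx)]; simp
    have x0 := x.ne_zero
    rcases sg x hx w hw with h1 | h1
    · left
      rw [center_iff]
      rcases sqc _ _ hw2 h1.symm with h2 | h2
      · rw [Units.val_mul, h2]; simp [one_mem]
      · rw [Units.val_mul, h2]; simp [one_mem]
    · right
      refine ⟨mul_mem (inv_mem hx) hw, ?_⟩
      have h2 : (w:D) * (x:D)⁻¹ = -((x:D)⁻¹ * w) := by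
        have : (x:D)⁻¹ * (x * w) * (x:D)⁻¹ = (x:D)⁻¹ * (-(w * x)) * (x:D)⁻¹ := by rw [h1]
        simpa [mul_assoc] using this
      calc ((x⁻¹ * w : Dˣ) : D) * (x⁻¹ * w : Dˣ) = (x:D)⁻¹ * ((w:D) * (x:D)⁻¹) * w := by simp [mul_assoc]
        _ = -((x:D)⁻¹ * (x:D)⁻¹ * (w * w)) := by rw [h2]; simp [mul_assoc]
        _ = -1 := by rw [hw2]; simp [mul_assoc]
  obtain ⟨i, hi, j, hj, hij⟩ : ∃ i ∈ I, ∃ j ∈ I, i * j ≠ j * i := by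
    by_contra! hcon
    have hz := hAb _ hXM hXn (fun a ha b hb =>
      congrArg Subtype.val ((Subgroup.closureCommGroupOfComm hcon).mul_comm ⟨a, ha⟩ ⟨b, hb⟩))
    obtain ⟨u, hu, v, hv, huv⟩ := h.nab
    refine huv (center_comm (hAb.cyc (h.le hu) fun m hm => ?_) v)
    rcases hstep u hu m hm with h1 | h1
    · exact h1
    · exact hz (Subgroup.subset_closure h1)
  have hanti : (i:D) * j = -(j * i) := (sg i hi.1 j hj.1).resolve_left fun e => hij (Units.ext e)
  have hIf : I.Finite := by
    have hfin : ({(i:D), -(i:D), (j:D), -(j:D), (i:D) * j, -((i:D) * j)} : Set D).Finite := Set.toFinite _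
    refine (hfin.preimage (f := (Units.val : Dˣ → D)) (Units.val_injective.injOn)).subset ?_
    rintro g ⟨hg, hg2⟩
    rw [Set.mem_preimage]
    rcases sg g hg i hi.1 with h1 | h1
    · rcases sqc g i (by rw [hg2, hi.2]) h1 with h2 | h2 <;> simp [h2]
    rcases sg g hg j hj.1 with h2 | h2
    · rcases sqc g j (by rw [hg2, hj.2]) h2 with h2 | h2 <;> simp [h2]
    have h3 : (i:D) * j * (i * j) = -1 := by
      calc (i:D) * j * (i * j) = (i * j) * (-(j * i)) := by rw [← hanti]
        _ = -(i * (j * j) * i) := by simp [mul_assoc]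
        _ = -1 := by rw [hj.2]; simp [hi.2]
    have h4 : (g:D) * (i * j) = i * j * g := by
      rw [← mul_assoc, h1, neg_mul, mul_assoc, h2]; simp [mul_assoc]
    rcases sqc g (i * j) (by rw [hg2, h3]) h4 with h2 | h2 <;> simp [h2]
  have hF : (ctr D : Set D).Infinite := by
    intro hfin
    have := finQ (ctr D) hfin (fun f hf x => (mem_ctr.1 hf x).symm) (j:D) (i:D) (-1) j.ne_zero i.ne_zero
      (neg_mem (one_mem _)) 2 (by norm_num) (by rw [sq, hj.2]; exact neg_mem (one_mem _))
      (by rw [sq, hi.2]; exact neg_mem (one_mem _)) (by rw [hanti]; simp)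
    exact hij (Units.ext this)
  have hnu : ∀ s, del (i:D) s (j:D) ≠ 0 := nu_of hij rfl (center_comm (h.cen i hi.1 j hj.1) i)
  have hMK := C2.keyM c ⟨i, Subgroup.subset_closure hi, j, Subgroup.subset_closure hj, hij, hnu⟩ hXM hXn hF
  have htop : ∀ y : D, y ∈ cl (Subgroup.closure I) := by
    intro y
    have : Subfield.closure (Units.val '' (M : Set Dˣ)) ≤ cl (Subgroup.closure I) := by
      rw [Subfield.closure_le]
      rintro _ ⟨m, hm, rfl⟩
      exact hMK m hm
    rw [c.gen] at this
    exact this trivial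
  refine ⟨⟨M ⊓ Subgroup.center Dˣ, inf_le_left, ?_, ?_, ?_⟩, i, h.le hi.1, j, hnu⟩
  · intro m hm x hx
    rw [← center_comm hx.2 m]
    simpa using hx
  · intro x hx y hy
    exact center_comm hx.2 y
  · refine finite_act hIf hIn fun m hm hc => Subgroup.mem_inf.2 ⟨hm, center_iff.2 (mem_ctr.2 fun s => ?_)⟩
    refine cl_comm1 (A := Subgroup.closure I) ?_ s (htop s)
    have hle : Subgroup.closure I ≤ Subgroup.centralizer {m} := by
      rw [Subgroup.closure_le]
      intro g hg
      refine Subgroup.mem_centralizer_iff.2 ?_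
      rintro _ rfl
      exact hc g hg
    intro a ha
    exact congrArg Units.val (Subgroup.mem_centralizer_iff.1 (hle ha) m rfl).symm

end

set_option linter.unusedSectionVars false
set_option linter.unusedVariables false
open Polynomial
open scoped Pointwise

section
variable {D : Type*} [DivisionRing D]
variable {G M C W B : Subgroup Dˣ}

theorem C2.chi (h : C2 M B) (hAb : AbC M) {b : Dˣ} (hb : b ∈ B) (hTF : ∀ n : ℕ, 1 ≤ n → b ^ n ∉ Subgroup.center Dˣ) :
    ∃ χ : Dˣ → ℚ, (∀ u ∈ B, ∀ v ∈ B, χ (u * v) = χ u + χ v) ∧ χ b = 1 ∧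
      ∀ u ∈ B, ∀ v ∈ B, (∀ y ∈ B, _root_.cm y u = _root_.cm y v) → χ u = χ v := by
  classical
  let _ : CommGroup (Subgroup.center Dˣ) :=
    { (inferInstance : Group (Subgroup.center Dˣ)) with
      mul_comm := fun a b => Subtype.ext (center_comm a.2 b) }
  let Φ : B →* (B → Subgroup.center Dˣ) := MonoidHom.mk' (fun u y => ⟨_root_.cm u y, h.cm u.2 y.2⟩) (by
    intro u v
    funext y
    exact Subtype.ext (cm_mul _ _ _ (h.cm v.2 y.2)))
  let f : ℤ →ₗ[ℤ] Additive (B → Subgroup.center Dˣ) := LinearMap.toSpanSingleton ℤ _ (Additive.ofMul (Φ ⟨b, hb⟩))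
  have hf0 : ∀ n : ℕ, 1 ≤ n → Φ ⟨b, hb⟩ ^ n ≠ 1 := by
    intro n hn e
    refine hTF n hn ((h.pow_center hAb hb n).2 fun y hy => ?_)
    exact congrArg Subtype.val (congrFun e ⟨y, hy⟩)
  have hf : Function.Injective f := by
    rw [injective_iff_map_eq_zero]
    intro z hz
    have h1 : Φ ⟨b, hb⟩ ^ z = 1 := hz
    by_contra hz0
    refine hf0 z.natAbs (by omega) ?_
    rcases Int.natAbs_eq z with h3 | h3
    · rw [← zpow_natCast, ← h3, h1]
    · have : (z.natAbs : ℤ) = -z := by omega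
      rw [← zpow_natCast, this, zpow_neg, h1, inv_one]
  obtain ⟨g, hg⟩ := (Module.Baer.of_divisible ℚ).extension_property f hf (Int.castAddHom ℚ).toIntLinearMap
  let χ0 : B → ℚ := fun u => g (Additive.ofMul (Φ u))
  have hχ0 : ∀ u v, χ0 (u * v) = χ0 u + χ0 v := by
    intro u v
    simp only [χ0, map_mul, ofMul_mul, map_add]
  refine ⟨fun u => if hu : u ∈ B then χ0 ⟨u, hu⟩ else 0, ?_, ?_, ?_⟩
  · intro u hu v hv
    simp only [hu, hv, mul_mem hu hv, dif_pos]
    exact hχ0 ⟨u, hu⟩ ⟨v, hv⟩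
  · simp only [hb, dif_pos]
    have := LinearMap.congr_fun hg 1
    simpa [f, χ0] using this
  · intro u hu v hv e
    simp only [hu, hv, dif_pos, χ0]
    congr 2
    funext y
    refine Subtype.ext ?_
    change _root_.cm u y = _root_.cm v y
    have hinv : ∀ a b : Dˣ, _root_.cm a b = (_root_.cm b a)⁻¹ := by
      intro a b; simp only [_root_.cm]; group
    rw [hinv, e y y.2, ← hinv]

/-- leading degree -/
def Ld (B : Subgroup Dˣ) (χ : Dˣ → ℚ) (r : D) (q : ℚ) : Prop :=
  ∃ r0 ∈ sp (ctr D) {b | b ∈ B ∧ χ b = q}, ∃ r1 ∈ sp (ctr D) {b | b ∈ B ∧ χ b < q}, r0 ≠ 0 ∧ r = r0 + r1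

theorem ctr_nrm (w : Dˣ) : Nrm (ctr D) (w:D) := by
  refine ⟨w.ne_zero, fun x hx => ?_⟩
  have := mem_ctr.1 hx
  rw [this, this]
  simpa using hx

theorem Ld.exists {χ : Dˣ → ℚ} {r : D} (hr : r ∈ sp (ctr D) (B : Set Dˣ)) (hr0 : r ≠ 0) : ∃ q, Ld B χ r q := by
  classical
  obtain ⟨S, hS, hrS⟩ := sp_finset hr
  clear hr
  induction hn : S.card using Nat.strong_induction_on generalizing S with
  | _ n ih =>
    rcases S.eq_empty_or_nonempty with rfl | hne
    · exfalso
      apply hr0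
      simpa [sp] using hrS
    obtain ⟨b, hb, hmax⟩ := S.exists_max_image χ hne
    have hsp : sp (ctr D) (S : Set Dˣ) ≤ sp (ctr D) ((S.filter (fun u => χ u = χ b) : Finset Dˣ) : Set Dˣ) ⊔
        sp (ctr D) ((S.filter (fun u => χ u < χ b) : Finset Dˣ) : Set Dˣ) := by
      refine Submodule.span_le.2 ?_
      rintro _ ⟨u, hu, rfl⟩
      rcases (hmax u hu).eq_or_lt with h1 | h1
      · exact Submodule.mem_sup_left (mem_sp (by simpa using! ⟨hu, h1⟩))
      · exact Submodule.mem_sup_right (mem_sp (by simpa using! ⟨hu, h1⟩))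
    obtain ⟨r0, h0, r1, h1, e⟩ := Submodule.mem_sup.1 (hsp hrS)
    by_cases hz : r0 = 0
    · refine ih _ ?_ (S.filter (fun u => χ u < χ b)) (fun u hu => hS (Finset.mem_filter.1 hu).1) ?_ rfl
      · rw [← hn]
        refine Finset.card_lt_card (Finset.filter_ssubset.2 ⟨b, hb, lt_irrefl _⟩)
      · rw [← e, hz, zero_add]; exact h1
    · refine ⟨χ b, r0, sp_mono ?_ h0, r1, sp_mono ?_ h1, hz, e.symm⟩
      · intro u hu
        obtain ⟨hu1, hu2⟩ := Finset.mem_filter.1 hu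
        exact ⟨hS hu1, hu2⟩
      · intro u hu
        obtain ⟨hu1, hu2⟩ := Finset.mem_filter.1 hu
        exact ⟨hS hu1, hu2⟩

theorem Ld.mul {χ : Dˣ → ℚ} (hχ : ∀ u ∈ B, ∀ v ∈ B, χ (u * v) = χ u + χ v) {r s : D} {p q : ℚ} (hr : Ld B χ r p)
    (hs : Ld B χ s q) : Ld B χ (r * s) (p + q) := by
  obtain ⟨r0, hr0, r1, hr1, hrn, rfl⟩ := hr
  obtain ⟨s0, hs0, s1, hs1, hsn, rfl⟩ := hs
  have hn : ∀ A : Set Dˣ, ∀ w ∈ A, Nrm (ctr D) (w:D) := fun A w _ => ctr_nrm w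
  refine ⟨r0 * s0, sp_mono ?_ (sp_mul (hn _) hr0 hs0), r0 * s1 + r1 * s0 + r1 * s1, add_mem (add_mem
    (sp_mono ?_ (sp_mul (hn _) hr0 hs1)) (sp_mono ?_ (sp_mul (hn _) hr1 hs0))) (sp_mono ?_ (sp_mul (hn _) hr1 hs1)),
    mul_ne_zero hrn hsn, by noncomm_ring⟩
  all_goals
    rintro _ ⟨u, ⟨hu, hu'⟩, v, ⟨hv, hv'⟩, rfl⟩
    refine ⟨mul_mem hu hv, ?_⟩
    simp only [hχ u hu v hv]
    linarith

theorem Ld.disj (h : C2 M B) {χ : Dˣ → ℚ}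
    (hχ' : ∀ u ∈ B, ∀ v ∈ B, (∀ y ∈ B, _root_.cm y u = _root_.cm y v) → χ u = χ v) {q : ℚ} {x : D}
    (hx : x ∈ sp (ctr D) {b | b ∈ B ∧ χ b = q}) (hx' : x ∈ sp (ctr D) {b | b ∈ B ∧ χ b < q}) : x = 0 := by
  have hUB : ∀ u ∈ {b | b ∈ B ∧ χ b = q} ∪ {b | b ∈ B ∧ χ b < q}, u ∈ B := by
    rintro u (hu | hu)
    · exact hu.1
    · exact hu.1
  refine sp_disj (Y := B) (ctr D) _ _ (fun y => (AddMonoidHom.mulLeft ((y:Dˣ):D)).comp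
      (AddMonoidHom.mulRight (((y:Dˣ):D)⁻¹))) ?_
    (fun u y => ((_root_.cm (y:Dˣ) u : Dˣ) : D)) ?_ ?_ ?_ ?_ x hx hx'
  · intro y l hl x
    simp only [AddMonoidHom.comp_apply, AddMonoidHom.coe_mulLeft, AddMonoidHom.coe_mulRight]
    rw [← mul_assoc, ← mul_assoc, mem_ctr.1 hl]
    simp only [mul_assoc]
  · intro u hu y
    exact center_iff.1 (h.cm y.2 (hUB u hu))
  · intro u hu y l hl
    exact (mem_ctr.1 hl _).symm
  · intro u hu y
    simp [_root_.cm, mul_assoc]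
  · intro u hu v hv e
    have := hχ' u hu.1 v hv.1 (fun y hy => Units.ext (congrFun e ⟨y, hy⟩))
    have h1 := hu.2
    have h2 := hv.2
    linarith

theorem Ld.uniq (h : C2 M B) {χ : Dˣ → ℚ}
    (hχ' : ∀ u ∈ B, ∀ v ∈ B, (∀ y ∈ B, _root_.cm y u = _root_.cm y v) → χ u = χ v) {r : D} {p q : ℚ} (hr : Ld B χ r p)
    (hs : Ld B χ r q) : p = q := by
  have aux : ∀ {p q : ℚ}, Ld B χ r p → Ld B χ r q → ¬ p < q := by
    rintro p q ⟨r0, hr0, r1, hr1, hrn, e⟩ ⟨s0, hs0, s1, hs1, hsn, e'⟩ hlt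
    refine hsn (Ld.disj h hχ' hs0 ?_)
    have : s0 = r0 + r1 - s1 := by rw [← e, e']; simp
    rw [this]
    refine sub_mem (add_mem (sp_mono ?_ hr0) (sp_mono ?_ hr1)) hs1
    · rintro u ⟨hu, hu'⟩; exact ⟨hu, hu' ▸ hlt⟩
    · rintro u ⟨hu, hu'⟩; exact ⟨hu, hu'.trans hlt⟩
  rcases lt_trichotomy p q with h1 | h1 | h1
  · exact absurd h1 (aux hr hs)
  · exact h1
  · exact absurd h1 (aux hs hr)

theorem sp_conj (h : C2 M B) {A : Set Dˣ} (hA : A ⊆ B) {y : Dˣ} (hy : y ∈ B) {x : D} (hx : x ∈ sp (ctr D) A) :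
    (y:D)⁻¹ * x * y ∈ sp (ctr D) A := by
  refine Submodule.span_induction (p := fun x _ => (y:D)⁻¹ * x * y ∈ sp (ctr D) A) ?_ ?_ ?_ ?_ hx
  · rintro _ ⟨u, hu, rfl⟩
    have hc := center_iff.1 (h.cm (inv_mem hy) (hA hu))
    have e : (y:D)⁻¹ * u * y = (⟨_, hc⟩ : ctr D) • (u:D) := by
      rw [smul_sf]; simp [_root_.cm, mul_assoc]
    rw [e]
    exact Submodule.smul_mem _ _ (mem_sp hu)
  · simp
  · intro a b _ _ ha hb
    rw [mul_add, add_mul]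
    exact add_mem ha hb
  · intro l a _ ha
    have e : (y:D)⁻¹ * (l • a) * y = l • ((y:D)⁻¹ * a * y) := by
      rw [smul_sf, smul_sf, ← mul_assoc, mem_ctr.1 l.2]; simp only [mul_assoc]
    rw [e]
    exact Submodule.smul_mem _ _ ha

theorem Ld.conj (h : C2 M B) {χ : Dˣ → ℚ} {r : D} {q : ℚ} (hr : Ld B χ r q) {y : Dˣ} (hy : y ∈ B) :
    Ld B χ ((y:D)⁻¹ * r * y) q := by
  obtain ⟨r0, hr0, r1, hr1, hrn, rfl⟩ := hr
  refine ⟨_, sp_conj h (fun u hu => hu.1) hy hr0, _, sp_conj h (fun u hu => hu.1) hy hr1,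
    mul_ne_zero (mul_ne_zero (inv_ne_zero y.ne_zero) hrn) y.ne_zero, by rw [mul_add, add_mul]⟩

theorem Ld.unit {χ : Dˣ → ℚ} {b : Dˣ} (hb : b ∈ B) : Ld B χ (b:D) (χ b) :=
  ⟨b, mem_sp ⟨hb, rfl⟩, 0, zero_mem _, b.ne_zero, by simp⟩

theorem C2.tf (h : C2 M B) (hAb : AbC M) (c : Cfg G M)
    (hTF : ∀ x ∈ B, ∀ n : ℕ, 1 ≤ n → x ^ n ∈ Subgroup.center Dˣ → x ∈ Subgroup.center Dˣ) : False := by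
  have hF : (ctr D : Set D).Infinite := by
    intro hfin
    obtain ⟨r, hr, hFr⟩ := finR (ctr D) hfin
    obtain ⟨x, hx, y, hy, hxy⟩ := h.nab
    refine hxy (center_comm (hTF x hx r hr ((h.pow_center hAb hx r).2 fun y hy => Units.ext ?_)) y)
    rw [Units.val_pow_eq_pow_val, hFr _ (center_iff.1 (h.cm hx hy)) (Units.ne_zero _)]
    simp
  obtain ⟨u, hu, v, hv, huv⟩ := h.nab
  have hMK := C2.keyM c ⟨u, hu, v, hv, huv, nu_of huv rfl (center_comm (h.cen u hu v hv) u)⟩ h.le h.nrm hF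
  refine huv (center_comm (hAb.cyc (h.le hu) fun m hm => ?_) v)
  have hw := h.nrm m hm u hu
  set w := m * u * m⁻¹ with hwd
  by_contra hcon
  have huw : u⁻¹ * w ∈ B := mul_mem (inv_mem hu) hw
  obtain ⟨χ, hχ, hχ1, hχ'⟩ := h.chi hAb huw (fun n hn hh => hcon (hTF _ huw n hn hh))
  have hn : ∀ w ∈ B, Nrm (ctr D) (w:D) := fun w _ => ctr_nrm w
  have hc : ∀ u ∈ B, ∀ v ∈ B, ((u * v * u⁻¹ * v⁻¹ : Dˣ) : D) ∈ ctr D := fun u hu v hv => center_iff.1 (h.cen u hu v hv)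
  have hKF : cl B ≤ Fr (ctr D) B hn hc := cl_le (fun x hx => sp_le_Fr hn hc (le_sp hx))
    (fun a ha => sp_le_Fr hn hc (mem_sp ha))
  obtain ⟨r, hr, hr0, hp⟩ := mem_Fr hn hc (hKF (hMK m hm))
  have hr' : (w:D)⁻¹ * r * w ∈ sp (ctr D) (B : Set Dˣ) := sp_conj h subset_rfl hw hr
  have hr'0 : (w:D)⁻¹ * r * w ≠ 0 := mul_ne_zero (mul_ne_zero (inv_ne_zero w.ne_zero) hr0) w.ne_zero
  obtain ⟨g, hg, hg0, k, hk, e⟩ := ore hn hc hr' hr hr'0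
  have hk0 : k ≠ 0 := by
    rintro rfl
    rw [zero_mul] at e
    exact mul_ne_zero hg0 hr0 e
  have hp0 : r * m ≠ 0 := mul_ne_zero hr0 m.ne_zero
  have e2 : g * (r * m) = k * ((w⁻¹ : Dˣ) : D) * (r * m) * u := by
    have hwm : (w:D) * m = m * u := by rw [hwd]; simp
    calc g * (r * m) = (g * r) * m := by rw [mul_assoc]
      _ = k * (w:D)⁻¹ * r * (w * m) := by rw [e]; simp only [mul_assoc]
      _ = _ := by rw [hwm]; simp [mul_assoc]
  obtain ⟨ρ, hρ⟩ := Ld.exists (χ := χ) hr hr0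
  obtain ⟨π, hπ⟩ := Ld.exists (χ := χ) hp hp0
  obtain ⟨γ, hγ⟩ := Ld.exists (χ := χ) hg hg0
  obtain ⟨κ, hκ⟩ := Ld.exists (χ := χ) hk hk0
  have l1 := Ld.mul hχ hγ hρ
  rw [e] at l1
  have q1 := Ld.uniq h hχ' l1 (Ld.mul hχ hκ (hρ.conj h hw))
  have l2 := Ld.mul hχ hγ hπ
  rw [e2] at l2
  have q2 := Ld.uniq h hχ' l2 (Ld.mul hχ (Ld.mul hχ (Ld.mul hχ hκ (Ld.unit (inv_mem hw))) hπ) (Ld.unit hu))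
  have q3 := hχ w hw _ (inv_mem hw)
  have q4 := hχ u hu _ huw
  have q5 := hχ 1 (one_mem _) 1 (one_mem _)
  rw [mul_inv_cancel] at q3
  rw [mul_inv_cancel_left, hχ1] at q4
  rw [mul_one] at q5
  linarith

theorem Cfg.core (c : Cfg G M) : Concl M := by
  by_cases hAb : AbC M
  swap
  · simp only [AbC] at hAb
    push Not at hAb
    obtain ⟨A, hA, hn, hc, hnc⟩ := hAb
    obtain ⟨a, ha, hac⟩ := Set.not_subset.1 hnc
    have : (a:D) ∉ ctr D := fun hh => hac (center_iff.2 hh)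
    rw [mem_ctr] at this
    push Not at this
    obtain ⟨y, hy⟩ := this
    obtain ⟨C, hC⟩ := c.exists_SC hA hn hc ha hy.symm
    exact hC.concl c
  obtain ⟨N, hN, hNn, hNs, hNi⟩ := c.sbf
  by_cases hNc : ∀ a ∈ N, ∀ b ∈ N, a * b = b * a
  · exact c.nu_abel hAb hN hNn hNc hNi
  classical
  obtain ⟨n, hn⟩ := ds_bot hNs
  have hex : ∃ n, ∀ a ∈ ds N n, ∀ b ∈ ds N n, a * b = b * a := ⟨n, by
    rw [hn]
    intro a ha b hb
    rw [Subgroup.mem_bot.1 ha, Subgroup.mem_bot.1 hb]⟩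
  obtain ⟨i, hi1, hi2⟩ : ∃ i, (¬ ∀ a ∈ ds N i, ∀ b ∈ ds N i, a * b = b * a) ∧
      ∀ a ∈ ds N (i+1), ∀ b ∈ ds N (i+1), a * b = b * a := by
    obtain ⟨j, hj⟩ : ∃ j, Nat.find hex = j + 1 := by
      refine Nat.exists_eq_succ_of_ne_zero fun h0 => hNc ?_
      have := Nat.find_spec hex
      rw [h0] at this
      exact this
    refine ⟨j, Nat.find_min hex (by omega), ?_⟩
    rw [← hj]
    exact Nat.find_spec hex
  have hcen := hAb _ ((ds_le N (i+1)).trans hN) (fun m hm => ds_conj (hNn m hm) (i+1)) hi2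
  have h : C2 M (ds N i) := ⟨(ds_le N i).trans hN, fun m hm => ds_conj (hNn m hm) i, by push Not at hi1; exact hi1,
    fun x hx y hy => hcen (Subgroup.commutator_mem_commutator hx hy)⟩
  by_cases ht : ∃ p : ℕ, p.Prime ∧ ∃ x ∈ ds N i, x ^ p ∈ Subgroup.center Dˣ ∧ x ∉ Subgroup.center Dˣ
  · obtain ⟨p, hp, x, hx, hxp, hxc⟩ := ht
    have h2 := h.tor_c2 hAb p hx hxp hxc
    have h3 : ∀ x ∈ h.tor p, x ^ p ∈ Subgroup.center Dˣ := fun x hx => (h.pow_center hAb hx.1 p).2 hx.2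
    by_cases hp2 : p = 2
    · subst hp2
      exact h2.two hAb c h3
    · exact (h2.odd hAb hp hp2 h3).elim
  · push Not at ht
    refine (h.tf hAb c fun x hx n hn hxn => ?_).elim
    induction n using Nat.strong_induction_on with
    | _ n ih =>
      by_cases h1 : n = 1
      · subst h1; simpa using hxn
      obtain ⟨p, hp, q, rfl⟩ := Nat.exists_prime_and_dvd h1
      have hq : 1 ≤ q := by
        rcases Nat.eq_zero_or_pos q with rfl | h0
        · simp at hn
        · exact h0
      refine ih q ?_ hq (ht p hp _ (pow_mem hx q) ?_)
      · have := hp.two_le; nlinarith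
      · rw [← pow_mul, mul_comm]; exact hxn

end

set_option linter.unusedSectionVars false
set_option linter.unusedVariables false
open Polynomial
open scoped Pointwise

section
variable {D : Type*} [DivisionRing D]
variable {G M : Subgroup Dˣ}

theorem fin_quot {Γ : Type*} [Group Γ] {C M : Subgroup Γ} (h : C.relIndex M ≠ 0) : Finite (M ⧸ C.subgroupOf M) := by
  exact Nat.finite_of_card_ne_zero h

theorem fin_sp (c : Cfg G M) {C : Subgroup Dˣ} (hC : C ≤ M) (hn : ∀ m ∈ M, ∀ x ∈ C, m * x * m⁻¹ ∈ C)
    (hi : C.relIndex M ≠ 0) : ∃ T : Set Dˣ, T.Finite ∧ ∀ x : D, x ∈ sp (cl C) T := by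
  have := fin_quot hi
  let o : (M ⧸ C.subgroupOf M) → Dˣ := fun q => (q.out : M)
  have hTf : (Set.range o).Finite := Set.finite_range o
  refine ⟨Set.range o, hTf, ?_⟩
  have hNr := nrm_of hn
  have hle : sp (cl C) (M : Set Dˣ) ≤ sp (cl C) (Set.range o) := by
    refine Submodule.span_le.2 ?_
    rintro _ ⟨m, hm, rfl⟩
    obtain ⟨u, hu⟩ := QuotientGroup.mk_out_eq_mul (C.subgroupOf M) ⟨m, hm⟩
    have h1 : o (QuotientGroup.mk ⟨m, hm⟩) = m * (u : M) := congrArg Subtype.val hu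
    have huC : ((u : M) : Dˣ) ∈ C := u.2
    have h2 : m * ((u : M) : Dˣ)⁻¹ * m⁻¹ ∈ C := hn m hm _ (inv_mem huC)
    have h3 : (m : D) = (⟨_, mem_cl h2⟩ : cl C) • ((o (QuotientGroup.mk ⟨m, hm⟩) : Dˣ) : D) := by
      rw [smul_sf, h1]
      simp [mul_assoc]
    rw [h3]
    exact Submodule.smul_mem _ _ (mem_sp ⟨_, rfl⟩)
  have hfd : FiniteDimensional (cl C) (sp (cl C) (M : Set Dˣ)) := by
    have : sp (cl C) (M : Set Dˣ) = sp (cl C) (Set.range o) :=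
      le_antisymm hle (sp_mono (by rintro _ ⟨q, rfl⟩; exact q.out.2))
    rw [this]
    exact FiniteDimensional.span_of_finite _ (hTf.image _)
  have hinv : ∀ x ∈ sp (cl C) (M : Set Dˣ), x⁻¹ ∈ sp (cl C) (M : Set Dˣ) := by
    intro x hx
    by_cases hx0 : x = 0
    · simp [hx0]
    let f : sp (cl C) (M : Set Dˣ) →ₗ[cl C] sp (cl C) (M : Set Dˣ) :=
      (rmul (cl C) x).restrict (fun y hy => sp_mul' hNr hy hx)
    have hf : Function.Injective f := by
      intro y z h
      exact Subtype.ext (mul_right_cancel₀ hx0 (congrArg Subtype.val h))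
    obtain ⟨y, hy⟩ := (LinearMap.injective_iff_surjective.1 hf) ⟨1, le_sp (one_mem _)⟩
    have h1 : (y : D) * x = 1 := congrArg Subtype.val hy
    rw [← eq_inv_of_mul_eq_one_left h1]
    exact y.2
  let K : Subfield D :=
    { carrier := sp (cl C) (M : Set Dˣ)
      mul_mem' := fun hx hy => sp_mul' hNr hx hy
      one_mem' := le_sp (one_mem _)
      add_mem' := fun hx hy => add_mem hx hy
      zero_mem' := zero_mem _
      neg_mem' := fun hx => neg_mem hx
      inv_mem' := hinv }
  have hK : ⊤ ≤ K := by
    rw [← c.gen, Subfield.closure_le]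
    rintro _ ⟨m, hm, rfl⟩
    exact mem_sp hm
  exact fun x => hle (hK (Subfield.mem_top x))

theorem fin_L (c : Cfg G M) {C : Subgroup Dˣ} (hC : C ≤ M) (hn : ∀ m ∈ M, ∀ x ∈ C, m * x * m⁻¹ ∈ C)
    (hcm : ∀ x ∈ C, ∀ y ∈ C, x * y = y * x)
    (hi : C.relIndex M ≠ 0) : ∃ S : Set D, S.Finite ∧ ∀ x ∈ cl C, x ∈ Submodule.span (Subring.center D) S := by
  have hLc := cl_comm hcm
  have hNr := nrm_of hn
  let _ : Field (cl C) :=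
    { (inferInstance : DivisionRing (cl C)) with
      mul_comm := fun a b => Subtype.ext (hLc a a.2 b b.2) }
  let Φ : M →* (cl C ≃+* cl C) :=
    { toFun := fun m =>
        { toFun := fun x => ⟨((m : Dˣ) : D) * x * ((m : Dˣ) : D)⁻¹, ((hNr m m.2).2 x x.2).1⟩
          invFun := fun x => ⟨((m : Dˣ) : D)⁻¹ * x * ((m : Dˣ) : D), ((hNr m m.2).2 x x.2).2⟩
          left_inv := fun x => Subtype.ext (by simp [mul_assoc])
          right_inv := fun x => Subtype.ext (by simp [mul_assoc])
          map_mul' := fun x y => Subtype.ext (by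
            change _ * ((x:D) * y) * _ = _ * (x:D) * _ * (_ * (y:D) * _)
            simp [mul_assoc])
          map_add' := fun x y => Subtype.ext (by
            change _ * ((x:D) + y) * _ = _ * (x:D) * _ + (_ * (y:D) * _)
            simp [mul_add, add_mul]) }
      map_one' := RingEquiv.ext fun x => Subtype.ext (by
        change ((1:Dˣ) : D) * x * ((1:Dˣ) : D)⁻¹ = x
        simp)
      map_mul' := fun a b => RingEquiv.ext fun x => Subtype.ext (by
        change (((a:Dˣ) * (b:Dˣ) : Dˣ) : D) * x * (((a:Dˣ) * (b:Dˣ) : Dˣ) : D)⁻¹ =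
          ((a:Dˣ) : D) * (((b:Dˣ) : D) * x * ((b:Dˣ) : D)⁻¹) * ((a:Dˣ) : D)⁻¹
        simp [mul_assoc]) }
  have hker : C.subgroupOf M ≤ Φ.ker := by
    intro m hm
    rw [MonoidHom.mem_ker]
    refine RingEquiv.ext fun x => Subtype.ext ?_
    change ((m : Dˣ) : D) * x * ((m : Dˣ) : D)⁻¹ = x
    have hm' : (m : Dˣ) ∈ C := hm
    rw [hLc _ (mem_cl hm') _ x.2]
    simp
  have : (C.subgroupOf M).FiniteIndex := ⟨hi⟩
  have hk := Subgroup.finiteIndex_of_le hker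
  have hfin : Finite Φ.range := by
    have : Finite (M ⧸ Φ.ker) := inferInstance
    exact Finite.of_equiv _ (QuotientGroup.quotientKerEquivRange Φ).toEquiv
  obtain ⟨S, hS⟩ := (inferInstance : FiniteDimensional (FixedPoints.subfield Φ.range (cl C)) (cl C)).fg_top
  have hfix : ∀ z : cl C, z ∈ FixedPoints.subfield Φ.range (cl C) → (z : D) ∈ Subring.center D := by
    intro z hz
    rw [Subring.mem_center_iff]
    refine c.central fun m hm => ?_
    have h1 : Φ ⟨m, hm⟩ z = z := hz ⟨Φ ⟨m, hm⟩, ⟨_, rfl⟩⟩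
    have h2 : (m : D) * z * (m : D)⁻¹ = z := congrArg Subtype.val h1
    exact (mul_inv_eq_iff_eq_mul₀ m.ne_zero).1 h2
  refine ⟨Subtype.val '' (S : Set (cl C)), S.finite_toSet.image _, fun x hx => ?_⟩
  have hx' : (⟨x, hx⟩ : cl C) ∈ Submodule.span (FixedPoints.subfield Φ.range (cl C)) (S : Set (cl C)) := by
    rw [hS]; trivial
  have key : ∀ y : cl C, y ∈ Submodule.span (FixedPoints.subfield Φ.range (cl C)) (S : Set (cl C)) →
      (y : D) ∈ Submodule.span (Subring.center D) (Subtype.val '' (S : Set (cl C))) := by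
    intro y hy
    induction hy using Submodule.span_induction with
    | mem y hy => exact Submodule.subset_span ⟨y, hy, rfl⟩
    | zero => exact zero_mem _
    | add y z _ _ h1 h2 => exact add_mem h1 h2
    | smul l y _ h => exact Submodule.smul_mem _ (⟨(l : cl C), hfix _ l.2⟩ : Subring.center D) h
  exact key _ hx'

theorem fin_D (c : Cfg G M) {C : Subgroup Dˣ} (hC : C ≤ M) (hn : ∀ m ∈ M, ∀ x ∈ C, m * x * m⁻¹ ∈ C)
    (hcm : ∀ x ∈ C, ∀ y ∈ C, x * y = y * x)
    (hi : C.relIndex M ≠ 0) : FiniteDimensional (Subring.center D) D := by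
  obtain ⟨T, hT, hTs⟩ := fin_sp c hC hn hi
  obtain ⟨S, hS, hSs⟩ := fin_L c hC hn hcm hi
  refine ⟨Submodule.fg_def.2 ⟨S * (Units.val '' T), hS.mul (hT.image _), ?_⟩⟩
  rw [eq_top_iff]
  rintro x -
  have hm : ∀ l ∈ Submodule.span (Subring.center D) S, ∀ y ∈ Submodule.span (Subring.center D) (Units.val '' T),
      l * y ∈ Submodule.span (Subring.center D) (S * (Units.val '' T)) := by
    intro l hl y hy
    rw [← Submodule.span_mul_span]
    exact Submodule.mul_mem_mul hl hy
  have hx : x ∈ sp (cl C) (hT.toFinset : Set Dˣ) := by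
    rw [hT.coe_toFinset]; exact hTs x
  obtain ⟨a, rfl⟩ := sp_sum hx
  refine Submodule.sum_mem _ fun u hu => ?_
  rw [smul_sf]
  exact hm _ (hSs _ (a u).2) _ (Submodule.subset_span ⟨u, hT.mem_toFinset.1 hu, rfl⟩)

end

set_option linter.unusedSectionVars false
set_option linter.unusedVariables false
open Polynomial
open scoped Pointwise

section
variable {D : Type*} [DivisionRing D]
variable {G M : Subgroup Dˣ}

/-- lifting a unit of `D` lying in `K` to a unit of `K` -/
theorem lift_unit {K : Subfield D} {g : Dˣ} (hg : (g:D) ∈ K) :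
    ∃ u : Kˣ, Units.map (K.subtype : K →* D) u = g :=
  ⟨Units.mk0 ⟨g, hg⟩ (by simp [Subtype.ext_iff]), Units.ext rfl⟩

theorem cfg_sub (hG : IsSubnormal G) (hle : M ≤ G)
    (hmax : ∀ H : Subgroup Dˣ, M ≤ H → H ≤ G → H = M ∨ H = G)
    (hnab : ∃ x ∈ M, ∃ y ∈ M, x * y ≠ y * x) (hs : SBF M) {K : Subfield D}
    (hK : K = Subfield.closure (Units.val '' (M : Set Dˣ))) (hGK : ∀ g ∈ G, (g:D) ∈ K) :
    Cfg (G.comap (Units.map (K.subtype : K →* D))) (M.comap (Units.map (K.subtype : K →* D))) := by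
  have hf : Function.Injective (Units.map (K.subtype : K →* D)) := Units.map_injective Subtype.val_injective
  refine ⟨hG.comap _, Subgroup.comap_mono hle, ?_, ?_, hs.pull _ hf _ fun x hx => hx, ?_⟩
  · intro H h1 h2
    have e := Subgroup.comap_map_eq_self_of_injective hf H
    have h3 : M ≤ H.map (Units.map (K.subtype : K →* D)) := by
      intro m hm
      obtain ⟨u, rfl⟩ := lift_unit (hGK m (hle hm))
      exact ⟨u, h1 hm, rfl⟩
    rcases hmax _ h3 (Subgroup.map_le_iff_le_comap.2 h2) with h | h
    · left; rw [← e, h]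
    · right; rw [← e, h]
  · obtain ⟨x, hx, y, hy, hxy⟩ := hnab
    obtain ⟨u, rfl⟩ := lift_unit (hGK x (hle hx))
    obtain ⟨v, rfl⟩ := lift_unit (hGK y (hle hy))
    refine ⟨u, hx, v, hy, fun h => hxy ?_⟩
    rw [← map_mul, h, map_mul]
  · rw [eq_top_iff]
    rintro x -
    have h1 : K ≤ (Subfield.closure (Units.val '' (M.comap (Units.map (K.subtype : K →* D)) : Set Kˣ))).map K.subtype := by
      conv_lhs => rw [hK]
      rw [Subfield.closure_le]
      rintro _ ⟨m, hm, rfl⟩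
      obtain ⟨u, rfl⟩ := lift_unit (hGK m (hle hm))
      exact ⟨u, Subfield.subset_closure ⟨u, hm, rfl⟩, rfl⟩
    obtain ⟨y, hy, e⟩ := h1 x.2
    rwa [← Subtype.ext e]

theorem closure_top (hG : IsSubnormal G) (hle : M ≤ G)
    (hmax : ∀ H : Subgroup Dˣ, M ≤ H → H ≤ G → H = M ∨ H = G)
    (hnab : ∃ x ∈ M, ∃ y ∈ M, x * y ≠ y * x) (hs : SBF M) :
    Subfield.closure (Units.val '' (M : Set Dˣ)) = ⊤ := by
  obtain ⟨K, hK⟩ : ∃ K, K = Subfield.closure (Units.val '' (M : Set Dˣ)) := ⟨_, rfl⟩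
  rw [← hK]
  have hMK : ∀ m ∈ M, (m:D) ∈ K := fun m hm => by rw [hK]; exact Subfield.subset_closure ⟨m, hm, rfl⟩
  have hGK : ∀ g ∈ G, (g:D) ∈ K := by
    rcases hmax (G ⊓ unitsIn K) (le_inf hle hMK) inf_le_left with h | h
    · exfalso
      obtain ⟨x, hx, y, hy, hxy⟩ := hnab
      refine hxy (Units.ext (T2K hG hs K (fun z hz hzK => ?_) x (hle hx) (hMK x hx) y (hMK y hy)))
      rw [← h]
      exact Subgroup.mem_inf.2 ⟨hz, hzK⟩
    · intro g hg
      rw [← h] at hg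
      exact (Subgroup.mem_inf.1 hg).2
  have c := cfg_sub hG hle hmax hnab hs hK hGK
  obtain ⟨⟨C, hC, hn, hcm, hi⟩, k, hk, e, hke⟩ := c.core
  have hfd := fin_D c hC hn hcm hi
  have hinf : (cK K : Set D).Infinite := by
    intro hfin
    have h1 : Finite (Subring.center K) := by
      refine Set.Finite.to_subtype ?_
      refine Set.Finite.of_finite_image (f := Subtype.val) (hfin.subset ?_) Subtype.val_injective.injOn
      rintro _ ⟨x, hx, rfl⟩
      refine mem_cK.2 ⟨x.2, fun s hs => ?_⟩
      exact congrArg Subtype.val (Subring.mem_center_iff.1 hx ⟨s, hs⟩)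
    have h2 : Finite K := Module.finite_of_finite (Subring.center K)
    obtain ⟨x, hx, y, hy, hxy⟩ := c.nab
    refine hxy (Units.ext ?_)
    let _ := littleWedderburn K
    exact mul_comm (x : K) (y : K)
  have hcKc : ∀ x ∈ cK K, ∀ y ∈ cK K, x * y = y * x := fun x hx y hy => (mem_cK.1 hy).2 x (mem_cK.1 hx).1
  by_contra hne
  have hX : unitsIn K ≠ ⊤ := by
    intro h
    refine hne (eq_top_iff.2 fun x _ => ?_)
    by_cases hx : x = 0
    · rw [hx]; exact zero_mem _
    have : Units.mk0 x hx ∈ unitsIn K := by rw [h]; trivial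
    exact this
  obtain ⟨S, hS, hGS, hSK, b, hbK, hb1, hb2⟩ := hG.exists_step (unitsIn K) hGK hX
  have hKS : K = Subfield.closure (Units.val '' (S : Set Dˣ)) := by
    refine le_antisymm ?_ ?_
    · rw [hK]
      exact Subfield.closure_mono (Set.image_mono (hle.trans hGS))
    · rw [Subfield.closure_le]
      rintro _ ⟨s, hs, rfl⟩
      exact hSK hs
  have hbN : Nrm K (b:D) := by
    rw [hKS]
    refine closure_nrm b.ne_zero ?_ ?_
    · rintro _ ⟨s, hs, rfl⟩
      exact Subfield.subset_closure ⟨_, hb1 s hs, by simp⟩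
    · rintro _ ⟨s, hs, rfl⟩
      exact Subfield.subset_closure ⟨_, hb2 s hs, by simp⟩
  have hbP : Nrm (cK K) (b:D) := by
    refine ⟨b.ne_zero, fun x hx => ?_⟩
    obtain ⟨hxK, hxc⟩ := mem_cK.1 hx
    refine ⟨mem_cK.2 ⟨(hbN.2 x hxK).1, fun s hs => ?_⟩, mem_cK.2 ⟨(hbN.2 x hxK).2, fun s hs => ?_⟩⟩
    · have h1 := hxc _ (hbN.2 s hs).2
      have h2 := congrArg (fun z => (b:D) * z * (b:D)⁻¹) h1
      simpa [mul_assoc] using h2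
    · have h1 := hxc _ (hbN.2 s hs).1
      have h2 := congrArg (fun z => (b:D)⁻¹ * z * (b:D)) h1
      simpa [mul_assoc] using h2
  have hk0 : (((k : K) : D)) ≠ 0 := by
    simp [Subtype.ext_iff]
  have hke' : ∀ s, del ((k : K) : D) s (e : D) ≠ 0 := by
    intro s h
    refine hke s (Subtype.ext ?_)
    have := map_del K.subtype (k : K) s e
    exact this.trans h
  obtain ⟨n, hn'⟩ := hS.wit_mem
  have hw : ∀ a : D, a ≠ 0 → wit ((k : K) : D) n a ∈ K := by
    intro a ha
    obtain ⟨g, hg, e1⟩ := hn' n le_rfl (Units.map (K.subtype : K →* D) k) (hGS (hle hk)) a ha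
    have e2 : (g : D) = wit ((k : K) : D) n a := e1
    rw [← e2]
    exact hSK hg
  by_cases hm : ∃ m, 1 ≤ m ∧ ∀ x ∈ cK K, (b:D) ^ m * x = x * (b:D) ^ m
  · obtain ⟨m, hm1, hbm⟩ := hm
    refine key hbN hbK (k : K).2 hk0 n {x ∈ (cK K : Set D) | (b:D) * x = x * b}
      (fun h => hinf (fix_fin (cK K) hcKc b hbP m hm1 hbm h)) ?_ ?_ ?_ hw e e.2 hke'
    · exact fun x hx => (mem_cK.1 hx.1).1
    · exact fun t ht x hx => ((mem_cK.1 ht.1).2 x hx).symm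
    · exact fun t ht => ht.2.symm
  · have hI : Ind K (b:D) := by
      refine ind_of K b b.ne_zero (cK K) (fun x hx => (mem_cK.1 hx).1) (fun y hy l hl => (mem_cK.1 hy).2 l hl)
        (fun y hy => (hbP.2 y hy).1) ?_
      intro m hm1
      by_contra hcon
      push Not at hcon
      exact hm ⟨m, hm1, hcon⟩
    refine keyEnd hbN (k : K).2 hk0 n (fun e he => ?_) e e.2 hke'
    refine hbN.del_zero hI _ hk0 (k : K).2 e he n (hw _ ?_)
    intro h0
    by_cases he0 : e = 0
    · simp [he0] at h0
    · apply hbK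
      have h1 : e * (b:D) = -1 := by
        rw [add_comm] at h0; exact eq_neg_of_add_eq_zero_left h0
      have h2 : (b:D) = e⁻¹ * (-1) := by rw [← h1, inv_mul_cancel_left₀ he0]
      change (b:D) ∈ K
      rw [h2]
      exact mul_mem (inv_mem he) (neg_mem (one_mem _))

end

/-- Let `D` be a division ring with center `F` and `G` a subnormal subgroup of `Dˣ`.
If `M` is a non-abelian solvable-by-finite maximal subgroup of `G`, then `M` is
abelian-by-finite and `D` is finite-dimensional over `F`. -/
theorem abelianByFinite_and_finiteDimensional {D : Type*} [DivisionRing D]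
    (G M : Subgroup Dˣ) (hG : IsSubnormal G)
    (hmax : M < G ∧ ∀ H : Subgroup Dˣ, M ≤ H → H ≤ G → H = M ∨ H = G)
    (hnonab : ¬ ∀ x ∈ M, ∀ y ∈ M, x * y = y * x)
    (hsbf : ∃ N : Subgroup Dˣ, N ≤ M ∧ (N.subgroupOf M).Normal ∧ IsSolvable ↥N ∧
      Finite (↥M ⧸ N.subgroupOf M)) :
    (∃ A : Subgroup Dˣ, A ≤ M ∧ (A.subgroupOf M).Normal ∧
      (∀ a ∈ A, ∀ b ∈ A, a * b = b * a) ∧ Finite (↥M ⧸ A.subgroupOf M)) ∧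
    FiniteDimensional (Subring.center D) D := by
  have hs : SBF M := by
    obtain ⟨N, hN, hn, hsol, hfin⟩ := hsbf
    refine ⟨N, hN, fun g hg x hx => ?_, hsol, ?_⟩
    · exact hn.conj_mem ⟨x, hN hx⟩ hx ⟨g, hg⟩
    · exact Nat.card_pos.ne'
  have hnab : ∃ x ∈ M, ∃ y ∈ M, x * y ≠ y * x := by
    push Not at hnonab
    exact hnonab
  have c : Cfg G M := ⟨hG, hmax.1.le, hmax.2, hnab, hs, closure_top hG hmax.1.le hmax.2 hnab hs⟩
  obtain ⟨⟨C, hC, hn, hcm, hi⟩, -⟩ := c.core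
  exact ⟨⟨C, hC, ⟨fun x hx g => hn g g.2 x hx⟩, hcm, fin_quot hi⟩, fin_D c hC hn hcm hi⟩
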